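/- If C is a permutation class with ugr(C) < ξ, then the limit lim_{n→∞} |C_n|^{1/n} exists (so the growth rate gr(C) exists), and there is a sum closed permutation class D with gr(D) = gr(C); that is, every growth rate of permutation classes below ξ is achieved by a sum closed permutation class. -/

import Mathlib

open Filter

/-- A permutation of some finite length `n`. -/
abbrev Permu : Type := Σ n : ℕ, Equiv.Perm (Fin n)

/-- `PLe σ π` : the permutation `σ` is contained in `π` as a pattern. -/
def PLe (σ π : Permu) : Prop :=
  ∃ f : Fin σ.1 → Fin π.1, StrictMono f ∧
    ∀ i j : Fin σ.1, σ.2 i < σ.2 j ↔ π.2 (f i) < π.2 (f j)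

/-- A permutation class: a set of permutations closed downward under containment. -/
def IsPermClass (C : Set Permu) : Prop :=
  ∀ σ π : Permu, PLe σ π → π ∈ C → σ ∈ C

/-- The number of permutations of length `n` in `C`. -/
noncomputable def pcount (C : Set Permu) (n : ℕ) : ℕ :=
  Set.ncard {π ∈ C | π.1 = n}

/-- The upper growth rate of a class, as an extended real. -/
noncomputable def ugr (C : Set Permu) : EReal :=
  limsup (fun n : ℕ => (((pcount C n : ℝ) ^ ((n : ℝ)⁻¹) : ℝ) : EReal)) atTop

/-- The lower growth rate of a class, as an extended real. -/
noncomputable def lgr (C : Set Permu) : EReal :=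
  liminf (fun n : ℕ => (((pcount C n : ℝ) ^ ((n : ℝ)⁻¹) : ℝ) : EReal)) atTop
/-- The direct sum of two permutations, on underlying finite types. -/
def permSum {m n : ℕ} (π : Equiv.Perm (Fin m)) (σ : Equiv.Perm (Fin n)) :
    Equiv.Perm (Fin (m + n)) :=
  finSumFinEquiv.symm.trans ((Equiv.sumCongr π σ).trans finSumFinEquiv)

/-- The sum `π ⊕ σ` of two permutations. -/
def psum (π σ : Permu) : Permu := ⟨π.1 + σ.1, permSum π.2 σ.2⟩

/-- The skew sum of two permutations, on underlying finite types. -/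
def permSkew {m n : ℕ} (π : Equiv.Perm (Fin m)) (σ : Equiv.Perm (Fin n)) :
    Equiv.Perm (Fin (m + n)) :=
  finSumFinEquiv.symm.trans ((Equiv.sumCongr π σ).trans
    (((Equiv.sumComm (Fin m) (Fin n)).trans finSumFinEquiv).trans (finCongr (Nat.add_comm n m))))

/-- The skew sum `π ⊖ σ` of two permutations. -/
def pskew (π σ : Permu) : Permu := ⟨π.1 + σ.1, permSkew π.2 σ.2⟩

/-- A set of permutations is sum closed if it is closed under `⊕`. -/
def SumClosed (C : Set Permu) : Prop := ∀ π σ : Permu, π ∈ C → σ ∈ C → psum π σ ∈ C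

/-- A set of permutations is skew closed if it is closed under `⊖`. -/
def SkewClosed (C : Set Permu) : Prop := ∀ π σ : Permu, π ∈ C → σ ∈ C → pskew π σ ∈ C

/-- A permutation is sum indecomposable if it is not the sum of two nonempty permutations. -/
def SumIndec (τ : Permu) : Prop := ¬ ∃ π σ : Permu, 0 < π.1 ∧ 0 < σ.1 ∧ τ = psum π σ

/-- A permutation is skew indecomposable if it is not the skew sum of two nonempty
permutations. -/
def SkewIndec (τ : Permu) : Prop := ¬ ∃ π σ : Permu, 0 < π.1 ∧ 0 < σ.1 ∧ τ = pskew π σ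

/-- `Sub π` : the class of all permutations contained in `π`. -/
def SubCl (π : Permu) : Set Permu := {σ | PLe σ π}

/-- The sum closure of a set of permutations: the smallest sum closed class containing it. -/
def sumClosure (C : Set Permu) : Set Permu :=
  ⋂₀ {D : Set Permu | IsPermClass D ∧ SumClosed D ∧ C ⊆ D}

/-- The skew closure of a set of permutations: the smallest skew closed class containing it. -/
def skewClosure (C : Set Permu) : Set Permu :=
  ⋂₀ {D : Set Permu | IsPermClass D ∧ SkewClosed D ∧ C ⊆ D}

/-- The cell class `G_γ`: permutations `π` with `gr(⊕Sub(π)) < γ` or `gr(⊖Sub(π)) < γ`.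
(These growth rates exist, so they coincide with the upper growth rates used here.) -/
noncomputable def cellClass (γ : ℝ) : Set Permu :=
  {π | ugr (sumClosure (SubCl π)) < (γ : EReal) ∨ ugr (skewClosure (SubCl π)) < (γ : EReal)}

section basics
variable {ι α β : Type*} [LinearOrder α] [LinearOrder β]

/-- `σ` is the standardization of the configuration `(x, y)`. -/
def IsStd (σ : Permu) (x : ι → α) (y : ι → β) : Prop :=
  ∃ e : Fin σ.1 ≃ ι, (∀ i j, i < j ↔ x (e i) < x (e j)) ∧
    ∀ i j, σ.2 i < σ.2 j ↔ y (e i) < y (e j)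

theorem exists_rk [Fintype ι] (x : ι → α) (hx : Function.Injective x) :
    ∃ e : Fin (Fintype.card ι) ≃ ι, ∀ i j, i < j ↔ x (e i) < x (e j) := by
  let _ : LinearOrder ι := LinearOrder.lift' x hx
  let e := Fintype.orderIsoFinOfCardEq ι rfl
  exact ⟨e.toEquiv, fun i j => (e.lt_iff_lt (x := i) (y := j)).symm⟩

theorem exists_std [Fintype ι] (x : ι → α) (y : ι → β) (hx : Function.Injective x)
    (hy : Function.Injective y) : ∃ σ : Permu, σ.1 = Fintype.card ι ∧ IsStd σ x y := by
  obtain ⟨e, he⟩ := exists_rk x hx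
  obtain ⟨d, hd⟩ := exists_rk y hy
  refine ⟨⟨_, e.trans d.symm⟩, rfl, e, he, fun i j => ?_⟩
  simp [hd]

theorem IsStd.card [Fintype ι] {σ : Permu} {x : ι → α} {y : ι → β} (h : IsStd σ x y) :
    σ.1 = Fintype.card ι := by
  obtain ⟨e, _⟩ := h
  simpa using Fintype.card_congr e

theorem perm_fin_id {n : ℕ} (e : Fin n → Fin n) (h : ∀ i j, i < j ↔ e i < e j) : e = id := by
  have hm : StrictMono e := fun i j hij => (h i j).1 hij
  have hi := hm.injective
  have := Finite.injective_iff_surjective.1 hi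
  let f : Fin n ≃o Fin n := StrictMono.orderIsoOfSurjective e hm this
  have : f = OrderIso.refl _ := Subsingleton.elim _ _
  funext i
  exact congrArg (fun g : Fin n ≃o Fin n => g i) this

theorem Permu.ext_lt {σ τ : Permu} (hn : σ.1 = τ.1)
    (h : ∀ i j : Fin σ.1, σ.2 i < σ.2 j ↔ τ.2 (Fin.cast hn i) < τ.2 (Fin.cast hn j)) :
    σ = τ := by
  obtain ⟨n, p⟩ := σ
  obtain ⟨m, q⟩ := τ
  obtain rfl : n = m := hn
  have h1 : ∀ i j : Fin n, p i < p j ↔ q i < q j := h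
  have h2 : (fun i => q (p.symm i)) = id := perm_fin_id _ fun i j => by
    rw [← h1]; simp
  congr 1
  ext i
  have := congrFun h2 (p i)
  simp at this
  rw [this]

theorem IsStd.unique {ι' α' β' : Type*} [LinearOrder α'] [LinearOrder β'] {σ σ' : Permu}
    {x : ι → α} {y : ι → β} {x' : ι' → α'} {y' : ι' → β'} (h : IsStd σ x y)
    (h' : IsStd σ' x' y') (g : ι ≃ ι') (hx : ∀ a b, x a < x b ↔ x' (g a) < x' (g b))
    (hy : ∀ a b, y a < y b ↔ y' (g a) < y' (g b)) : σ = σ' := by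
  obtain ⟨e, he, hs⟩ := h
  obtain ⟨e', he', hs'⟩ := h'
  have hn : σ.1 = σ'.1 := by simpa using Fintype.card_congr ((e.trans g).trans e'.symm)
  have key : (fun i => Fin.cast hn.symm (e'.symm (g (e i)))) = id := perm_fin_id _ fun i j => by
    rw [he, hx, Fin.lt_def]
    simp only [Fin.val_cast, ← Fin.lt_def]
    rw [he']; simp
  refine Permu.ext_lt hn fun i j => ?_
  have k : ∀ i, Fin.cast hn i = e'.symm (g (e i)) := fun i => by
    have := congrFun key i
    simp at this
    conv_lhs => rw [← this]
    simp
  rw [hs, hy, k, k, hs']; simp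

theorem IsStd.eq_iff {σ : Permu} {x : ι → α} {y y' : ι → β} (hx : Function.Injective x) (h : IsStd σ x y)
    (h' : IsStd σ x y') (a b : ι) : y a < y b ↔ y' a < y' b := by
  obtain ⟨e, he, hs⟩ := h
  obtain ⟨e', he', hs'⟩ := h'
  have : (fun i => e'.symm (e i)) = id := perm_fin_id _ fun i j => by
    rw [he, he']; simp
  have k : ∀ i, e i = e' i := fun i => by
    have := congrFun this i
    simpa [Equiv.symm_apply_eq] using this
  obtain ⟨i, rfl⟩ := e.surjective a
  obtain ⟨j, rfl⟩ := e.surjective b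
  rw [← hs, k, k, hs']

/-- `σ` is contained in the configuration `(x, y)`. -/
def Rz (σ : Permu) (x : ι → α) (y : ι → β) : Prop :=
  ∃ f : Fin σ.1 → ι, (∀ i j, i < j ↔ x (f i) < x (f j)) ∧
    ∀ i j, σ.2 i < σ.2 j ↔ y (f i) < y (f j)

theorem PLe_iff {σ π : Permu} : PLe σ π ↔ Rz σ (fun i : Fin π.1 => i) (fun i => π.2 i) := by
  constructor
  · rintro ⟨f, hf, h⟩
    exact ⟨f, fun i j => hf.lt_iff_lt.symm, h⟩
  · rintro ⟨f, hf, h⟩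
    exact ⟨f, fun i j => (hf i j).1, h⟩

theorem IsStd.rz {σ : Permu} {x : ι → α} {y : ι → β} (h : IsStd σ x y) : Rz σ x y := by
  obtain ⟨e, h⟩ := h
  exact ⟨e, h⟩

theorem Rz.mono {ι' α' β' : Type*} [LinearOrder α'] [LinearOrder β'] {σ : Permu} {x : ι → α}
    {y : ι → β} {x' : ι' → α'} {y' : ι' → β'} (h : Rz σ x y) (g : ι → ι')
    (hx : ∀ a b, x a < x b ↔ x' (g a) < x' (g b)) (hy : ∀ a b, y a < y b ↔ y' (g a) < y' (g b)) :
    Rz σ x' y' := by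
  obtain ⟨f, h1, h2⟩ := h
  exact ⟨g ∘ f, fun i j => (h1 i j).trans (hx _ _), fun i j => (h2 i j).trans (hy _ _)⟩

theorem Rz.ple {σ π : Permu} {x : ι → α} {y : ι → β} (h : Rz σ x y) (h' : IsStd π x y) :
    PLe σ π := by
  obtain ⟨e, h1, h2⟩ := h'
  exact PLe_iff.2 (h.mono e.symm (fun a b => by rw [h1]; simp) (fun a b => by rw [h2]; simp))

theorem PLe.rz {σ π : Permu} {x : ι → α} {y : ι → β} (h : PLe σ π) (h' : Rz π x y) :
    Rz σ x y := by
  obtain ⟨f, h1, h2⟩ := h'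
  exact (PLe_iff.1 h).mono f h1 h2

theorem PLe.refl (π : Permu) : PLe π π := ⟨id, strictMono_id, fun _ _ => Iff.rfl⟩

theorem PLe.trans {σ τ π : Permu} (h : PLe σ τ) (h' : PLe τ π) : PLe σ π :=
  PLe_iff.2 (h.rz (PLe_iff.1 h'))

theorem PLe.card_le {σ π : Permu} (h : PLe σ π) : σ.1 ≤ π.1 := by
  obtain ⟨f, hf, _⟩ := h
  simpa using Fintype.card_le_of_injective f hf.injective

end basics

/-- Pattern of `π` on a set of positions (as a relation). -/
def IsPat {n : ℕ} (π : Equiv.Perm (Fin n)) (S : Finset (Fin n)) (σ : Permu) : Prop :=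
  IsStd σ (fun i : S => i.1) (fun i : S => π i.1)

theorem exists_pat {n : ℕ} (π : Equiv.Perm (Fin n)) (S : Finset (Fin n)) :
    ∃ σ : Permu, σ.1 = S.card ∧ IsPat π S σ := by
  obtain ⟨σ, h1, h2⟩ := exists_std (fun i : S => i.1) (fun i : S => π i.1)
    Subtype.val_injective (π.injective.comp Subtype.val_injective)
  exact ⟨σ, by simpa using h1, h2⟩

/-- Pattern of `π` on a set of positions. -/
noncomputable def pat {n : ℕ} (π : Equiv.Perm (Fin n)) (S : Finset (Fin n)) : Permu :=
  (exists_pat π S).choose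

theorem pat_card {n : ℕ} (π : Equiv.Perm (Fin n)) (S : Finset (Fin n)) :
    (pat π S).1 = S.card := (exists_pat π S).choose_spec.1

theorem pat_std {n : ℕ} (π : Equiv.Perm (Fin n)) (S : Finset (Fin n)) :
    IsStd (pat π S) (fun i : S => i.1) (fun i : S => π i.1) := (exists_pat π S).choose_spec.2

theorem pat_ple {n : ℕ} (π : Equiv.Perm (Fin n)) (S : Finset (Fin n)) :
    PLe (pat π S) ⟨n, π⟩ :=
  PLe_iff.2 ((pat_std π S).rz.mono (fun i => i.1) (fun _ _ => Iff.rfl) (fun _ _ => Iff.rfl))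

theorem pat_eq_iff {n : ℕ} {π π' : Equiv.Perm (Fin n)} {S : Finset (Fin n)}
    (h : pat π S = pat π' S) {i j : Fin n} (hi : i ∈ S) (hj : j ∈ S) :
    π i < π j ↔ π' i < π' j := by
  have h1 := pat_std π S
  have h2 := pat_std π' S
  rw [← h] at h2
  exact h1.eq_iff Subtype.val_injective h2 ⟨i, hi⟩ ⟨j, hj⟩

/-- A colour-preserving permutation increasing on colours is trivial. -/
theorem color_id {n : ℕ} {κ : Type*} (c : Fin n → κ) (e : Equiv.Perm (Fin n))
    (hc : ∀ i, c (e i) = c i) (hm : ∀ i j, c i = c j → i < j → e i < e j) : e = 1 := by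
  ext i
  simp only [Equiv.Perm.coe_one, id]
  congr 1
  induction i using WellFoundedLT.induction with
  | _ v ih =>
    by_contra hne
    have h1 : v < e v := by
      rcases lt_trichotomy (e v) v with h | h | h
      · exact absurd (e.injective (ih _ h)) hne
      · exact absurd h hne
      · exact h
    set u := e.symm v with hu
    have hu' : e u = v := by simp [hu]
    have h2 : v < u := by
      rcases lt_trichotomy u v with h | h | h
      · have := ih _ h; rw [hu'] at this; exact absurd this h.ne'
      · rw [h] at hu'; exact absurd hu' hne
      · exact h
    have h3 := hm v u (by rw [← hc u, hu']) h2
    rw [hu'] at h3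
    exact absurd h3 h1.asymm

/-- Two permutations with the same colour words and the same comparisons within colours. -/
theorem color_eq {n : ℕ} {κ : Type*} (π π' : Equiv.Perm (Fin n)) (c : Fin n → κ)
    (hv : ∀ v, c (π.symm v) = c (π'.symm v))
    (hm : ∀ i j, c i = c j → (π i < π j ↔ π' i < π' j)) : π = π' := by
  have := color_id (fun v => c (π.symm v)) (π.symm.trans π') (fun i => by
    rw [hv]; simp) (fun i j hij h => by
    have := (hm (π.symm i) (π.symm j) hij).1 (by simpa using h)
    simpa using this)
  ext i
  have := congrArg (fun e : Equiv.Perm (Fin n) => e (π i)) this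
  simp at this
  rw [this]

open Classical in
/-- The members of `C` of length `n`, as permutations of `Fin n`. -/
noncomputable def PC (C : Set Permu) (n : ℕ) : Finset (Equiv.Perm (Fin n)) :=
  Finset.univ.filter fun p => (⟨n, p⟩ : Permu) ∈ C

theorem mem_PC {C : Set Permu} {n : ℕ} {p : Equiv.Perm (Fin n)} :
    p ∈ PC C n ↔ (⟨n, p⟩ : Permu) ∈ C := by simp [PC]

theorem pcount_eq (C : Set Permu) (n : ℕ) : pcount C n = (PC C n).card := by
  have : {π ∈ C | π.1 = n} = (fun p => (⟨n, p⟩ : Permu)) '' (PC C n : Set (Equiv.Perm (Fin n))) := by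
    ext ⟨m, p⟩
    simp only [Set.mem_setOf_eq, Set.mem_image, Finset.mem_coe, mem_PC]
    constructor
    · rintro ⟨h, rfl⟩
      exact ⟨p, h, rfl⟩
    · rintro ⟨q, hq, h⟩
      have h1 : n = m := congrArg Sigma.fst h
      exact ⟨h ▸ hq, h1.symm⟩
  rw [pcount, this, Set.ncard_image_of_injective _ (f := fun p => (⟨n, p⟩ : Permu))
    (fun p q h => by simpa using h), Set.ncard_coe_finset]

theorem pcount_mono {C D : Set Permu} (h : C ⊆ D) (n : ℕ) : pcount C n ≤ pcount D n := by
  rw [pcount_eq, pcount_eq]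
  exact Finset.card_le_card fun p hp => mem_PC.2 (h (mem_PC.1 hp))

/-- Inverse. -/
def pinv (π : Permu) : Permu := ⟨π.1, π.2.symm⟩
/-- Reverse. -/
def prev (π : Permu) : Permu := ⟨π.1, Fin.revPerm.trans π.2⟩

theorem pinv_pinv (π : Permu) : pinv (pinv π) = π := rfl
theorem prev_prev (π : Permu) : prev (prev π) = π := by
  obtain ⟨n, p⟩ := π
  simp only [prev]
  congr 1
  ext i; simp

theorem PLe.pinv {σ π : Permu} (h : PLe σ π) : PLe (pinv σ) (pinv π) := by
  obtain ⟨n, p⟩ := σ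
  obtain ⟨m, q⟩ := π
  obtain ⟨f, h1, h2⟩ := h
  refine PLe_iff.2 ⟨fun i : Fin n => q (f (p.symm i)), fun (i j : Fin n) => ?_,
    fun (i j : Fin n) => ?_⟩
  · refine Iff.trans ?_ (h2 (p.symm i) (p.symm j))
    show i < j ↔ p (p.symm i) < p (p.symm j)
    rw [Equiv.apply_symm_apply, Equiv.apply_symm_apply]
  · refine (h1.lt_iff_lt (a := p.symm i) (b := p.symm j)).symm.trans ?_
    show _ ↔ q.symm (q (f (p.symm i))) < q.symm (q (f (p.symm j)))
    simp

theorem PLe.prev {σ π : Permu} (h : PLe σ π) : PLe (prev σ) (prev π) := by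
  obtain ⟨n, p⟩ := σ
  obtain ⟨m, q⟩ := π
  obtain ⟨f, h1, h2⟩ := h
  refine PLe_iff.2 ⟨fun i : Fin n => Fin.rev (f (Fin.rev i)), fun (i j : Fin n) => ?_,
    fun (i j : Fin n) => ?_⟩
  · refine Iff.trans ?_ (Fin.rev_lt_rev (i := f i.rev) (j := f j.rev)).symm
    rw [h1.lt_iff_lt]
    exact Fin.rev_lt_rev.symm
  · show p (Fin.rev i) < p (Fin.rev j) ↔ q (Fin.rev (Fin.rev (f (Fin.rev i)))) < q (Fin.rev (Fin.rev (f (Fin.rev j))))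
    rw [Fin.rev_rev, Fin.rev_rev]
    exact h2 _ _

/-- Inverse class. -/
def cinv (C : Set Permu) : Set Permu := {π | pinv π ∈ C}
/-- Reverse class. -/
def crev (C : Set Permu) : Set Permu := {π | prev π ∈ C}

theorem IsPermClass.cinv {C : Set Permu} (h : IsPermClass C) : IsPermClass (cinv C) :=
  fun _ _ hs hp => h _ _ hs.pinv hp
theorem IsPermClass.crev {C : Set Permu} (h : IsPermClass C) : IsPermClass (crev C) :=
  fun _ _ hs hp => h _ _ hs.prev hp
theorem crev_crev (C : Set Permu) : crev (crev C) = C := by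
  ext π; simp [crev, prev_prev]
theorem cinv_cinv (C : Set Permu) : cinv (cinv C) = C := rfl

theorem pcount_cinv (C : Set Permu) (n : ℕ) : pcount (cinv C) n = pcount C n := by
  rw [pcount_eq, pcount_eq]
  refine Finset.card_bij (fun p _ => p.symm) (fun p hp => ?_) (fun p _ q _ h => ?_)
    (fun p hp => ⟨p.symm, ?_, rfl⟩)
  · rw [mem_PC] at hp ⊢; exact hp
  · exact Equiv.symm_bijective.1 h
  · rw [mem_PC] at hp ⊢; exact hp

theorem pcount_crev (C : Set Permu) (n : ℕ) : pcount (crev C) n = pcount C n := by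
  rw [pcount_eq, pcount_eq]
  have key : ∀ p : Equiv.Perm (Fin n), Fin.revPerm.trans (Fin.revPerm.trans p) = p := by
    intro p; ext i; simp
  refine Finset.card_bij (fun p _ => Fin.revPerm.trans p) (fun p hp => ?_) (fun p _ q _ h => ?_)
    (fun p hp => ⟨Fin.revPerm.trans p, ?_, key p⟩)
  · rw [mem_PC] at hp ⊢; exact hp
  · rw [← key p, h, key q]
  · rw [mem_PC] at hp ⊢
    show (⟨n, Fin.revPerm.trans (Fin.revPerm.trans p)⟩ : Permu) ∈ C
    rwa [key]

/-- Lower bounds for `pcount` from families of configurations. -/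
theorem count_conf {C : Set Permu} (hC : IsPermClass C) {n : ℕ} {φ κ : Type*} [Fintype φ]
    [Fintype κ] (st : φ → κ) (X Y : φ → Fin n → Fin n → Prop)
    (H : ∀ f : φ, ∃ π ∈ C, ∃ Q : Fin n → Fin π.1, Function.Injective Q ∧
      ∀ i j, (Q i < Q j ↔ X f i j) ∧ (π.2 (Q i) < π.2 (Q j) ↔ Y f i j))
    (inj : ∀ f f' (e : Equiv.Perm (Fin n)), st f = st f' → (∀ i j, X f i j ↔ X f' (e i) (e j)) →
      (∀ i j, Y f i j ↔ Y f' (e i) (e j)) → f = f') :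
    Fintype.card φ ≤ Fintype.card κ * pcount C n := by
  classical
  have H2 : ∀ f, ∃ p ∈ PC C n, ∃ e : Equiv.Perm (Fin n), (∀ i j, i < j ↔ X f (e i) (e j)) ∧
      ∀ i j, p i < p j ↔ Y f (e i) (e j) := by
    intro f
    obtain ⟨π, hπ, Q, hQ, h⟩ := H f
    obtain ⟨⟨m, p⟩, hc, hs⟩ := exists_std Q (fun i => π.2 (Q i)) hQ (π.2.injective.comp hQ)
    rw [Fintype.card_fin] at hc
    obtain rfl : m = n := hc
    refine ⟨p, mem_PC.2 (hC _ _ (PLe_iff.2 (hs.rz.mono Q (fun _ _ => Iff.rfl)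
      (fun _ _ => Iff.rfl))) hπ), ?_⟩
    obtain ⟨e, h1, h2⟩ := hs
    exact ⟨e, fun i j => (h1 i j).trans (h _ _).1, fun i j => (h2 i j).trans (h _ _).2⟩
  choose p hp e h1 h2 using H2
  rw [pcount_eq]
  have : Function.Injective (fun f => (st f, (⟨p f, hp f⟩ : PC C n))) := by
    intro f f' hff
    simp only [Prod.mk.injEq, Subtype.mk.injEq] at hff
    refine inj f f' ((e f).symm.trans (e f')) hff.1 (fun i j => ?_) (fun i j => ?_)
    · have a := h1 f ((e f).symm i) ((e f).symm j)
      have b := h1 f' ((e f).symm i) ((e f).symm j)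
      simp at a b ⊢
      rw [← a, b]
    · have a := h2 f ((e f).symm i) ((e f).symm j)
      have b := h2 f' ((e f).symm i) ((e f).symm j)
      simp at a b ⊢
      rw [← a, ← b, hff.2]
  simpa using Fintype.card_le_of_injective _ this


/-- Evaluation as a function on natural numbers. -/
def ev (π : Permu) (i : ℕ) : ℕ := if h : i < π.1 then (π.2 ⟨i, h⟩ : ℕ) else i

theorem ev_fin (π : Permu) (i : Fin π.1) : ev π i = π.2 i := by simp [ev]
theorem ev_lt {π : Permu} {i : ℕ} (h : i < π.1) : ev π i < π.1 := by simp [ev, h]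
theorem ev_ge {π : Permu} {i : ℕ} (h : π.1 ≤ i) : ev π i = i := by simp [ev, not_lt.2 h]
theorem ev_inj (π : Permu) : Function.Injective (ev π) := by
  intro i j h
  by_cases hi : i < π.1 <;> by_cases hj : j < π.1
  · simp only [ev, hi, hj, dif_pos] at h
    have := π.2.injective (Fin.ext h)
    simpa using this
  · have := ev_lt hi; rw [h, ev_ge (not_lt.1 hj)] at this; exact absurd this hj
  · have := ev_lt hj; rw [← h, ev_ge (not_lt.1 hi)] at this; exact absurd this hi
  · rwa [ev_ge (not_lt.1 hi), ev_ge (not_lt.1 hj)] at h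

theorem Permu.ext_ev {σ τ : Permu} (hn : σ.1 = τ.1) (h : ∀ i < σ.1, ev σ i = ev τ i) : σ = τ := by
  obtain ⟨n, p⟩ := σ
  obtain ⟨m, q⟩ := τ
  obtain rfl : n = m := hn
  congr 1
  ext i
  have := h i i.2
  rwa [ev_fin ⟨n, p⟩ i, ev_fin ⟨n, q⟩ i] at this

theorem ple_ev {σ π : Permu} (f : ℕ → ℕ) (h1 : ∀ i < σ.1, f i < π.1)
    (h2 : ∀ i j, i < j → j < σ.1 → f i < f j)
    (h3 : ∀ i j, i < σ.1 → j < σ.1 → (ev σ i < ev σ j ↔ ev π (f i) < ev π (f j))) : PLe σ π := by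
  refine ⟨fun i => ⟨f i, h1 i i.2⟩, fun i j hij => h2 i j hij j.2, fun i j => ?_⟩
  have := h3 i j i.2 j.2
  rw [ev_fin, ev_fin] at this
  simp only [ev, h1 _ i.2, h1 _ j.2, dif_pos] at this
  exact this

theorem PLe.ev {σ π : Permu} (h : PLe σ π) : ∃ f : ℕ → ℕ, (∀ i < σ.1, f i < π.1) ∧
    (∀ i j, i < j → j < σ.1 → f i < f j) ∧
    (∀ i j, i < σ.1 → j < σ.1 → (_root_.ev σ i < _root_.ev σ j ↔
      _root_.ev π (f i) < _root_.ev π (f j))) := by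
  obtain ⟨f, h1, h2⟩ := h
  refine ⟨fun i => if h : i < σ.1 then f ⟨i, h⟩ else 0, fun i hi => ?_, fun i j hij hj => ?_,
    fun i j hi hj => ?_⟩
  · simp [hi]
  · simp only [hij.trans hj, hj, dif_pos]
    exact h1 (show (⟨i, _⟩ : Fin σ.1) < ⟨j, _⟩ from hij)
  · simp only [hi, hj, dif_pos]
    rw [ev_fin, ev_fin]
    simp only [_root_.ev, hi, hj, dif_pos]
    exact h2 _ _

theorem exists_ev (n : ℕ) (f : ℕ → ℕ) (h : ∀ i < n, f i < n)
    (hi : ∀ i j, i < n → j < n → f i = f j → i = j) :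
    ∃ π : Permu, π.1 = n ∧ ∀ i < n, ev π i = f i := by
  have inj : Function.Injective (fun i : Fin n => (⟨f i, h i i.2⟩ : Fin n)) := fun i j hij =>
    Fin.ext (hi i j i.2 j.2 (by simpa using hij))
  refine ⟨⟨n, Equiv.ofBijective _ (Finite.injective_iff_bijective.1 inj)⟩, rfl, fun i hi => ?_⟩
  simp [ev, hi]

theorem ev_psum_lt (τ ρ : Permu) {i : ℕ} (h : i < τ.1) : ev (psum τ ρ) i = ev τ i := by
  have h' : i < (psum τ ρ).1 := by show i < τ.1 + ρ.1; omega
  have e : (⟨i, h'⟩ : Fin (τ.1 + ρ.1)) = Fin.castAdd ρ.1 ⟨i, h⟩ := rfl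
  simp only [ev, h, h', dif_pos]
  show (permSum τ.2 ρ.2 (⟨i, h'⟩ : Fin (τ.1 + ρ.1)) : ℕ) = _
  rw [e, permSum]
  simp only [Equiv.trans_apply, finSumFinEquiv_symm_apply_castAdd, Equiv.sumCongr_apply,
    Sum.map_inl, finSumFinEquiv_apply_left, Fin.val_castAdd]

theorem ev_psum_ge (τ ρ : Permu) (i : ℕ) : ev (psum τ ρ) (τ.1 + i) = τ.1 + ev ρ i := by
  by_cases h : i < ρ.1
  · have h' : τ.1 + i < (psum τ ρ).1 := by show _ < τ.1 + ρ.1; omega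
    have e : (⟨τ.1 + i, h'⟩ : Fin (τ.1 + ρ.1)) = Fin.natAdd τ.1 ⟨i, h⟩ := rfl
    simp only [ev, h, h', dif_pos]
    show (permSum τ.2 ρ.2 (⟨τ.1 + i, h'⟩ : Fin (τ.1 + ρ.1)) : ℕ) = _
    rw [e, permSum]
    simp only [Equiv.trans_apply, finSumFinEquiv_symm_apply_natAdd, Equiv.sumCongr_apply,
      Sum.map_inr, finSumFinEquiv_apply_right, Fin.val_natAdd]
  · rw [ev_ge (not_lt.1 h), ev_ge (show τ.1 + ρ.1 ≤ τ.1 + i by omega)]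

theorem psum_fst (τ ρ : Permu) : (psum τ ρ).1 = τ.1 + ρ.1 := rfl

theorem ple_psum_left (τ ρ : Permu) : PLe τ (psum τ ρ) := by
  refine ple_ev id (fun i hi => by simp [psum_fst]; omega) (fun i j h _ => h) fun i j hi hj => ?_
  simp [ev_psum_lt, hi, hj]

theorem ple_psum_right (τ ρ : Permu) : PLe ρ (psum τ ρ) := by
  refine ple_ev (fun i => τ.1 + i) (fun i hi => by simp [psum_fst]; omega)
    (fun i j h _ => by simp; omega) fun i j hi hj => ?_
  simp [ev_psum_ge]

/-- Sum indecomposable and nonempty. -/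
def SI (τ : Permu) : Prop := 0 < τ.1 ∧ ∀ m, 0 < m → m < τ.1 → ∃ i < m, m ≤ ev τ i

theorem psum_inj {τ ρ τ' ρ' : Permu} (h : SI τ) (h' : SI τ') (e : psum τ ρ = psum τ' ρ') :
    τ = τ' ∧ ρ = ρ' := by
  have key : ∀ {τ ρ τ' ρ' : Permu}, SI τ → SI τ' → psum τ ρ = psum τ' ρ' → ¬ τ.1 < τ'.1 := by
    intro τ ρ τ' ρ' h h' e hlt
    obtain ⟨i, hi, hm⟩ := h'.2 _ h.1 hlt
    rw [← ev_psum_lt τ' ρ' (by omega), ← e, ev_psum_lt τ ρ hi] at hm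
    exact absurd (ev_lt hi) (by omega)
  have h1 : τ.1 = τ'.1 := by
    have := key h h' e
    have := key h' h e.symm
    omega
  have h2 : ρ.1 = ρ'.1 := by
    have := congrArg Sigma.fst e
    simp only [psum_fst] at this
    omega
  refine ⟨Permu.ext_ev h1 fun i hi => ?_, Permu.ext_ev h2 fun i hi => ?_⟩
  · rw [← ev_psum_lt τ ρ hi, e, ev_psum_lt τ' ρ' (by omega)]
  · have := ev_psum_ge τ ρ i
    rw [e, h1, ev_psum_ge] at this
    omega

theorem psum_decomp (π : Permu) (h : 0 < π.1) : ∃ τ ρ, SI τ ∧ π = psum τ ρ := by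
  classical
  have ex : ∃ m, 0 < m ∧ ∀ i < m, ev π i < m := ⟨π.1, h, fun i hi => ev_lt hi⟩
  set m := Nat.find ex with hm
  obtain ⟨h0, h1⟩ := Nat.find_spec ex
  rw [← hm] at h0 h1
  have hle : m ≤ π.1 := Nat.find_min' ex ⟨h, fun i hi => ev_lt hi⟩
  have h2 : ∀ i, m ≤ i → m ≤ ev π i := by
    intro i hi
    by_contra hlt
    have := Finset.card_le_card_of_injOn (s := insert i (Finset.range m)) (t := Finset.range m)
      (ev π) (fun j hj => by
        rcases Finset.mem_insert.1 hj with rfl | hj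
        · exact Finset.mem_coe.2 (Finset.mem_range.2 (not_le.1 hlt))
        · exact Finset.mem_coe.2 (Finset.mem_range.2 (h1 _ (Finset.mem_range.1 hj))))
      (ev_inj π).injOn
    rw [Finset.card_insert_of_notMem (by simp; omega)] at this
    simp at this
  obtain ⟨τ, t1, t2⟩ := exists_ev m (ev π) h1 (fun i j _ _ h => ev_inj π h)
  obtain ⟨ρ, r1, r2⟩ := exists_ev (π.1 - m) (fun i => ev π (m + i) - m)
    (fun i hi => by have := ev_lt (π := π) (i := m + i) (by omega); omega)
    (fun i j _ _ h => by
      have a := h2 (m + i) (by omega)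
      have b := h2 (m + j) (by omega)
      have := ev_inj π (show ev π (m + i) = ev π (m + j) by omega)
      omega)
  refine ⟨τ, ρ, ⟨by omega, fun k hk0 hk => ?_⟩, ?_⟩
  · by_contra hcon
    push Not at hcon
    exact Nat.find_min ex (m := k) (by omega) ⟨hk0, fun i hi => by
      rw [← t2 i (by omega)]; exact hcon i hi⟩
  · refine Permu.ext_ev (by simp [psum_fst]; omega) fun i hi => ?_
    by_cases him : i < m
    · rw [ev_psum_lt _ _ (by omega), t2 i him]
    · obtain ⟨j, rfl⟩ : ∃ j, i = τ.1 + j := ⟨i - τ.1, by omega⟩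
      rw [ev_psum_ge, r2 j (by omega), t1]
      have := h2 (m + j) (by omega)
      omega

/-- The members of `C` of length `n`. -/
noncomputable def PS (C : Set Permu) (n : ℕ) : Finset Permu :=
  (PC C n).map ⟨fun p => (⟨n, p⟩ : Permu), fun p q h => by simpa using h⟩

theorem mem_PS {C : Set Permu} {n : ℕ} {π : Permu} : π ∈ PS C n ↔ π ∈ C ∧ π.1 = n := by
  simp only [PS, Finset.mem_map, mem_PC, Function.Embedding.coeFn_mk]
  constructor
  · rintro ⟨p, hp, rfl⟩; exact ⟨hp, rfl⟩
  · rintro ⟨h, rfl⟩; exact ⟨π.2, h, rfl⟩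

theorem card_PS (C : Set Permu) (n : ℕ) : (PS C n).card = pcount C n := by
  simp [PS, pcount_eq]

/-- Number of sum indecomposables. -/
noncomputable def sic (C : Set Permu) (n : ℕ) : ℕ := pcount (C ∩ {π | SI π}) n

theorem sic_mono {C D : Set Permu} (h : C ⊆ D) (n : ℕ) : sic C n ≤ sic D n :=
  pcount_mono (Set.inter_subset_inter_left _ h) n

theorem rec_upper {D : Set Permu} (hD : IsPermClass D) {n : ℕ} (hn : 0 < n) :
    pcount D n ≤ ∑ k ∈ Finset.Icc 1 n, sic D k * pcount D (n - k) := by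
  classical
  have : ∑ k ∈ Finset.Icc 1 n, sic D k * pcount D (n - k) =
      ((Finset.Icc 1 n).sigma fun k => PS (D ∩ {π | SI π}) k ×ˢ PS D (n - k)).card := by
    rw [Finset.card_sigma]
    exact Finset.sum_congr rfl fun k _ => by rw [Finset.card_product, card_PS, card_PS, sic]
  rw [this, ← card_PS]
  refine Finset.card_le_card_of_surjOn (fun z => psum z.2.1 z.2.2) fun π hπ => ?_
  obtain ⟨h1, h2⟩ := mem_PS.1 (Finset.mem_coe.1 hπ)
  obtain ⟨τ, ρ, hs, rfl⟩ := psum_decomp π (by omega)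
  rw [psum_fst] at h2
  have := hs.1
  refine ⟨⟨τ.1, τ, ρ⟩, ?_, rfl⟩
  simp only [Finset.coe_sigma, Set.mem_sigma_iff, Finset.mem_coe, Finset.mem_product, mem_PS,
    Finset.mem_Icc]
  exact ⟨by omega, ⟨⟨hD _ _ (ple_psum_left τ ρ) h1, hs⟩, trivial⟩,
    hD _ _ (ple_psum_right τ ρ) h1, by omega⟩

theorem rec_lower {D : Set Permu} (hD : SumClosed D) {n N : ℕ} (hn : N ≤ n) :
    ∑ k ∈ Finset.Icc 1 N, sic D k * pcount D (n - k) ≤ pcount D n := by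
  classical
  have : ∑ k ∈ Finset.Icc 1 N, sic D k * pcount D (n - k) =
      ((Finset.Icc 1 N).sigma fun k => PS (D ∩ {π | SI π}) k ×ˢ PS D (n - k)).card := by
    rw [Finset.card_sigma]
    exact Finset.sum_congr rfl fun k _ => by rw [Finset.card_product, card_PS, card_PS, sic]
  rw [this, ← card_PS]
  refine Finset.card_le_card_of_injOn (fun z => psum z.2.1 z.2.2) ?_ ?_
  · rintro ⟨k, τ, ρ⟩ h
    simp only [Finset.coe_sigma, Set.mem_sigma_iff, Finset.mem_coe, Finset.mem_product, mem_PS,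
      Finset.mem_Icc] at h ⊢
    exact ⟨hD _ _ h.2.1.1.1 h.2.2.1, by rw [psum_fst]; omega⟩
  · rintro ⟨k, τ, ρ⟩ h ⟨k', τ', ρ'⟩ h' e
    simp only [Finset.coe_sigma, Set.mem_sigma_iff, Finset.mem_coe, Finset.mem_product, mem_PS,
      Finset.mem_Icc] at h h' e
    obtain ⟨rfl, rfl⟩ := psum_inj h.2.1.1.2 h'.2.1.1.2 e
    obtain rfl : k = k' := by omega
    rfl

/-- Truncated weight of the sum indecomposables. -/
noncomputable def Wt (D : Set Permu) (g : ℝ) (N : ℕ) : ℝ :=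
  ∑ k ∈ Finset.Icc 1 N, (sic D k : ℝ) / g ^ k

theorem Wt_mono {C D : Set Permu} (h : C ⊆ D) {g : ℝ} (hg : 0 < g) (N : ℕ) : Wt C g N ≤ Wt D g N :=
  Finset.sum_le_sum fun k _ => by have := sic_mono h k; gcongr

theorem Wt_mono_N {D : Set Permu} {g : ℝ} (hg : 0 < g) {N M : ℕ} (h : N ≤ M) : Wt D g N ≤ Wt D g M :=
  Finset.sum_le_sum_of_subset_of_nonneg (Finset.Icc_subset_Icc_right h) fun _ _ _ => by positivity

theorem Wt_anti {D : Set Permu} {g g' : ℝ} (hg : 0 < g) (h : g ≤ g') (N : ℕ) :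
    Wt D g' N ≤ Wt D g N :=
  Finset.sum_le_sum fun k _ => by gcongr

theorem pcount_zero_le (D : Set Permu) : pcount D 0 ≤ 1 := by
  rw [pcount_eq]
  exact (Finset.card_le_univ _).trans (by simp)

theorem Wt_upper {D : Set Permu} (hD : IsPermClass D) {g : ℝ} (hg : 0 < g)
    (h : ∀ N, Wt D g N ≤ 1) (n : ℕ) : (pcount D n : ℝ) ≤ g ^ n := by
  induction n using Nat.strong_induction_on with
  | _ n ih =>
    rcases Nat.eq_zero_or_pos n with rfl | hn
    · simpa using pcount_zero_le D
    · calc (pcount D n : ℝ) ≤ ∑ k ∈ Finset.Icc 1 n, (sic D k : ℝ) * pcount D (n - k) := by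
            exact_mod_cast rec_upper hD hn
        _ ≤ ∑ k ∈ Finset.Icc 1 n, (sic D k : ℝ) * g ^ (n - k) := by
            refine Finset.sum_le_sum fun k hk => ?_
            have := ih (n - k) (by simp at hk; omega)
            gcongr
        _ = g ^ n * Wt D g n := by
            rw [Wt, Finset.mul_sum]
            refine Finset.sum_congr rfl fun k hk => ?_
            rw [pow_sub₀ _ hg.ne' (by simp at hk; omega)]
            field_simp
        _ ≤ g ^ n * 1 := by gcongr; exact h n
        _ = g ^ n := mul_one _

theorem SumClosed.exists_len {D : Set Permu} (hC : IsPermClass D) (hD : SumClosed D) {τ : Permu}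
    (hτ : τ ∈ D) (h : 0 < τ.1) (n : ℕ) : 1 ≤ pcount D n := by
  obtain ⟨π, hπ, hn⟩ : ∃ π ∈ D, n ≤ π.1 := by
    induction n with
    | zero => exact ⟨τ, hτ, by omega⟩
    | succ n ih =>
      obtain ⟨π, h1, h2⟩ := ih
      exact ⟨psum τ π, hD _ _ hτ h1, by rw [psum_fst]; omega⟩
  rw [← card_PS]
  refine Finset.card_pos.2 ⟨pat π.2 (Finset.univ.filter fun i => i.1 < n), mem_PS.2 ⟨?_, ?_⟩⟩
  · exact hC _ _ (pat_ple _ _) hπ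
  · rw [pat_card]
    rw [show (Finset.univ.filter fun i : Fin π.1 => i.1 < n) =
      Finset.univ.map (Fin.castLEEmb hn) from ?_]
    · simp
    · ext i
      simp only [Finset.mem_filter, Finset.mem_univ, true_and, Finset.mem_map]
      exact ⟨fun h => ⟨⟨i, h⟩, rfl⟩, by rintro ⟨j, rfl⟩; exact j.2⟩

theorem Wt_lower {D : Set Permu} (hC : IsPermClass D) (hD : SumClosed D) {g : ℝ} (hg : 1 ≤ g)
    {N : ℕ} (h : 1 ≤ Wt D g N) (n : ℕ) : g ^ n ≤ g ^ N * pcount D n := by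
  have hg0 : 0 < g := by linarith
  obtain ⟨τ, hτ, ht⟩ : ∃ τ ∈ D, 0 < τ.1 := by
    by_contra hcon
    push Not at hcon
    have : Wt D g N = 0 := Finset.sum_eq_zero fun k hk => by
      have : sic D k = 0 := by
        rw [sic, ← card_PS, Finset.card_eq_zero, Finset.eq_empty_iff_forall_notMem]
        intro π hπ
        have h1 := mem_PS.1 hπ
        have := hcon π h1.1.1
        have := h1.1.2.1
        omega
      simp [this]
    linarith
  have hp := fun n => hD.exists_len hC hτ ht n
  induction n using Nat.strong_induction_on with
  | _ n ih =>
    by_cases hn : n ≤ N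
    · calc g ^ n ≤ g ^ N * 1 := by rw [mul_one]; exact pow_le_pow_right₀ hg hn
        _ ≤ _ := by have := hp n; gcongr; exact_mod_cast this
    · push Not at hn
      calc g ^ n ≤ g ^ n * Wt D g N := le_mul_of_one_le_right (by positivity) h
        _ = ∑ k ∈ Finset.Icc 1 N, (sic D k : ℝ) * g ^ (n - k) := by
            rw [Wt, Finset.mul_sum]
            refine Finset.sum_congr rfl fun k hk => ?_
            rw [pow_sub₀ _ hg0.ne' (by simp at hk; omega)]
            field_simp
        _ ≤ ∑ k ∈ Finset.Icc 1 N, (sic D k : ℝ) * (g ^ N * pcount D (n - k)) := by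
            refine Finset.sum_le_sum fun k hk => ?_
            have := ih (n - k) (by simp at hk; omega)
            gcongr
        _ = g ^ N * ∑ k ∈ Finset.Icc 1 N, (sic D k : ℝ) * pcount D (n - k) := by
            rw [Finset.mul_sum]
            exact Finset.sum_congr rfl fun k _ => by ring
        _ ≤ _ := by
            gcongr
            exact_mod_cast rec_lower hD hn.le


theorem ramsey_pre {κ : Type*} [Finite κ] [Nonempty κ] (t : ℕ) : ∃ M : ℕ, ∀ (c : ℕ → ℕ → κ) (S : Finset ℕ),
    M ≤ S.card → ∃ f : ℕ → ℕ, ∃ d : ℕ → κ, (∀ i < t, f i ∈ S) ∧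
      ∀ i j, i < j → j < t → f i < f j ∧ c (f i) (f j) = d i := by
  classical
  have := Fintype.ofFinite κ
  induction t with
  | zero => exact ⟨0, fun c S _ => ⟨id, fun _ => Classical.arbitrary κ, by simp, by simp⟩⟩
  | succ t ih =>
    obtain ⟨M, hM⟩ := ih
    refine ⟨Fintype.card κ * M + 1, fun c S hS => ?_⟩
    have hne : S.Nonempty := Finset.card_pos.1 (by omega)
    set v := S.min' hne
    have hv : v ∈ S := S.min'_mem hne
    obtain ⟨k, _, hk⟩ := Finset.exists_le_card_fiber_of_mul_le_card_of_maps_to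
      (s := S.erase v) (t := Finset.univ) (f := fun w => c v w) (n := M) (by simp)
      (by simp) (by rw [Finset.card_erase_of_mem hv]; simp; omega)
    obtain ⟨f, d, h1, h2⟩ := hM c _ hk
    refine ⟨fun i => i.casesOn v f, fun i => i.casesOn k d, ?_, ?_⟩
    · rintro (_ | i) hi
      · exact hv
      · have := h1 i (by omega)
        simp at this
        exact this.1.2
    · rintro (_ | i) (_ | j) hij hj
      · omega
      · have := h1 j (by omega)
        simp only [Finset.mem_filter, Finset.mem_erase] at this
        exact ⟨lt_of_le_of_ne (S.min'_le _ this.1.2) (Ne.symm this.1.1), this.2⟩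
      · omega
      · exact h2 i j (by omega) (by omega)

theorem ramsey {κ : Type*} [Finite κ] [Nonempty κ] (m : ℕ) : ∃ M : ℕ, ∀ (c : ℕ → ℕ → κ),
    ∃ f : ℕ → ℕ, ∃ k : κ, (∀ i < m, f i < M) ∧
      ∀ i j, i < j → j < m → f i < f j ∧ c (f i) (f j) = k := by
  classical
  have := Fintype.ofFinite κ
  obtain ⟨M, hM⟩ := ramsey_pre (κ := κ) (Fintype.card κ * m)
  refine ⟨M, fun c => ?_⟩
  obtain ⟨f, d, h1, h2⟩ := hM c (Finset.range M) (by simp)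
  obtain ⟨k, _, hk⟩ := Finset.exists_le_card_fiber_of_mul_le_card_of_maps_to
      (s := Finset.range (Fintype.card κ * m)) (t := Finset.univ) (f := d) (n := m) (by simp)
      (by simp) (by simp)
  obtain ⟨U, hU, hUc⟩ := Finset.exists_subset_card_eq hk
  let o := U.orderEmbOfFin hUc
  have ho : ∀ i, o i < Fintype.card κ * m ∧ d (o i) = k := fun i => by
    have := hU (U.orderEmbOfFin_mem hUc i)
    simpa using this
  refine ⟨fun i => if h : i < m then f (o ⟨i, h⟩) else 0, k, fun i hi => ?_, fun i j hij hj => ?_⟩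
  · simp only [hi, dif_pos]
    simpa using h1 _ (ho ⟨i, hi⟩).1
  · have hi := hij.trans hj
    simp only [hi, hj, dif_pos]
    have := h2 (o ⟨i, hi⟩) (o ⟨j, hj⟩) (o.lt_iff_lt.2 hij) (ho _).1
    exact ⟨this.1, this.2.trans (ho _).2⟩

/-- Homogeneous types. -/
structure Ty (k : ℕ) where
  A : Fin k → Fin k → Prop
  B : Fin k → Fin k → Prop
  R : Fin k → Fin k → Prop
  S : Fin k → Fin k → Prop
  E : Fin k → Fin k → Prop

/-- `P` is a homogeneous sequence of `m` gadgets of type `T` in `π`. -/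
def Hom {k : ℕ} (T : Ty k) (m : ℕ) (π : Permu) (P : ℕ → Fin k → Fin π.1) : Prop :=
  ∀ i < m, ∀ a b, (P i a < P i b ↔ T.A a b) ∧ (π.2 (P i a) < π.2 (P i b) ↔ T.B a b) ∧
    ∀ j < m, i < j → (P i a < P j b ↔ T.R a b) ∧ (π.2 (P i a) < π.2 (P j b) ↔ T.S a b) ∧
      (P i a = P j b ↔ T.E a b)

/-- The class contains arbitrarily long homogeneous sequences of type `T`. -/
def HasT (C : Set Permu) {k : ℕ} (T : Ty k) : Prop := ∀ m, ∃ π ∈ C, ∃ P, Hom T m π P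

/-- Restricting roles. -/
def Ty.comap {k l : ℕ} (T : Ty k) (f : Fin l → Fin k) : Ty l where
  A a b := T.A (f a) (f b)
  B a b := T.B (f a) (f b)
  R a b := T.R (f a) (f b)
  S a b := T.S (f a) (f b)
  E a b := T.E (f a) (f b)

theorem HasT.comap {C : Set Permu} {k l : ℕ} {T : Ty k} (h : HasT C T) (f : Fin l → Fin k) :
    HasT C (T.comap f) := fun m => by
  obtain ⟨π, hπ, P, hP⟩ := h m
  exact ⟨π, hπ, fun i a => P i (f a), fun i hi a b => hP i hi (f a) (f b)⟩

theorem hom {k : ℕ} {κ : Type} [Finite κ] {C : Set Permu}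
    (Ψ : (π : Permu) → (Fin k → Fin π.1) → κ → (Fin k → Fin π.1) → κ → Prop)
    (H : ∀ m, ∃ π ∈ C, ∃ P : ℕ → Fin k → Fin π.1, ∃ l : ℕ → κ,
      ∀ i j, i < j → j < m → Ψ π (P i) (l i) (P j) (l j)) :
    ∃ (T : Ty k) (l : κ), ∀ m, ∃ π ∈ C, ∃ P, Hom T m π P ∧
      ∀ i j, i < j → j < m → Ψ π (P i) l (P j) l := by
  classical
  have hne : Nonempty κ := by
    obtain ⟨_, _, _, l, _⟩ := H 0
    exact ⟨l 0⟩
  let K := ((Fin k → Fin k → Prop) × (Fin k → Fin k → Prop) × (Fin k → Fin k → Prop) ×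
    (Fin k → Fin k → Prop) × (Fin k → Fin k → Prop)) × κ
  let ty : K → Ty k := fun z => ⟨z.1.1, z.1.2.1, z.1.2.2.1, z.1.2.2.2.1, z.1.2.2.2.2⟩
  have key : ∀ m, ∃ z : K, ∃ π ∈ C, ∃ P, Hom (ty z) m π P ∧
      ∀ i j, i < j → j < m → Ψ π (P i) z.2 (P j) z.2 := by
    intro m
    obtain ⟨M, hM⟩ := ramsey (κ := K) (m + 1)
    obtain ⟨π, hπ, P, l, hP⟩ := H M
    obtain ⟨f, z, h1, h2⟩ := hM fun i j => ((fun a b => P i a < P i b, fun a b =>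
      π.2 (P i a) < π.2 (P i b), fun a b => P i a < P j b, fun a b => π.2 (P i a) < π.2 (P j b),
      fun a b => P i a = P j b), l i)
    have hl : ∀ i < m, l (f i) = z.2 := fun i hi => by
      rw [← (h2 i (i + 1) (by omega) (by omega)).2]
    refine ⟨z, π, hπ, fun i => P (f i), fun i hi a b => ?_, fun i j hij hj => ?_⟩
    · have := (h2 i (i + 1) (by omega) (by omega)).2
      refine ⟨by simp [ty, ← this], by simp [ty, ← this], fun j hj hij => ?_⟩
      have := (h2 i j (by omega) (by omega)).2
      exact ⟨by simp [ty, ← this], by simp [ty, ← this], by simp [ty, ← this]⟩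
    · have := hP (f i) (f j) (h2 i j hij (by omega)).1 (h1 j (by omega))
      rwa [hl i (by omega), hl j hj] at this
  choose z hz using key
  obtain ⟨y, hy⟩ := Finite.exists_infinite_fiber z
  refine ⟨ty y, y.2, fun m => ?_⟩
  obtain ⟨m', hm', hlt⟩ := (Set.infinite_coe_iff.1 hy).exists_gt m
  obtain ⟨π, hπ, P, h1, h2⟩ := hz m'
  rw [show z m' = y from hm'] at h1 h2
  refine ⟨π, hπ, P, fun i hi a b => ?_, fun i j hij hj => h2 i j hij (by omega)⟩
  obtain ⟨ha, hb, hc⟩ := h1 i (by omega) a b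
  exact ⟨ha, hb, fun j hj => hc j (by omega)⟩

/-- Role `a` is entirely to the left of role `b`. -/
def Ty.sep {k : ℕ} (T : Ty k) (a b : Fin k) : Prop := T.R a b ∧ ¬ T.R b a ∧ T.A a b
/-- Role `a` is entirely below role `b`. -/
def Ty.vsep {k : ℕ} (T : Ty k) (a b : Fin k) : Prop := T.S a b ∧ ¬ T.S b a ∧ T.B a b

theorem two_seq {α : Type*} [LinearOrder α] (u v : ℕ → α) (aa ab ba bb : Prop)
    (h1 : ∀ i j, i < j → j < 3 → (u i < u j ↔ aa) ∧ (u i < v j ↔ ab) ∧ (v i < u j ↔ ba) ∧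
      (v i < v j ↔ bb)) (h2 : ∀ i j, i < j → j < 3 → u i ≠ u j ∧ u i ≠ v j ∧ v i ≠ u j ∧ v i ≠ v j) :
    ((ab ↔ aa) ∧ (ba ↔ aa) ∧ (bb ↔ aa)) ∨ (ab ∧ ¬ ba ∧ u 1 < v 1) ∨ (ba ∧ ¬ ab ∧ v 1 < u 1) := by
  have a1 := h1 0 1 (by norm_num) (by norm_num)
  have a2 := h1 0 2 (by norm_num) (by norm_num)
  have a3 := h1 1 2 (by norm_num) (by norm_num)
  have b1 := h2 0 1 (by norm_num) (by norm_num)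
  have b2 := h2 0 2 (by norm_num) (by norm_num)
  have b3 := h2 1 2 (by norm_num) (by norm_num)
  clear h1 h2
  by_cases aa <;> by_cases ab <;> by_cases ba <;> by_cases bb <;> simp_all <;> grind

theorem HasT.sep_or {C : Set Permu} {k : ℕ} {T : Ty k} (h : HasT C T) {a b : Fin k}
    (h1 : ¬ T.E a a) (h2 : ¬ T.E a b) (h3 : ¬ T.E b a) (h4 : ¬ T.E b b) :
    ((T.R a b ↔ T.R a a) ∧ (T.R b a ↔ T.R a a) ∧ (T.R b b ↔ T.R a a)) ∨ T.sep a b ∨ T.sep b a := by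
  obtain ⟨π, -, P, hP⟩ := h 3
  have H := fun i j a b (hi : i < 3) (hj : j < 3) hij => (hP i hi a b).2.2 j hj hij
  have := two_seq (fun i => P i a) (fun i => P i b) (T.R a a) (T.R a b) (T.R b a) (T.R b b)
    (fun i j hij hj => ⟨(H i j _ _ (by omega) hj hij).1, (H i j _ _ (by omega) hj hij).1,
      (H i j _ _ (by omega) hj hij).1, (H i j _ _ (by omega) hj hij).1⟩)
    (fun i j hij hj => by
      simp only [ne_eq, (H i j _ _ (by omega) hj hij).2.2]
      exact ⟨h1, h2, h3, h4⟩)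
  simp only [(hP 1 (by norm_num) _ _).1] at this
  exact this

theorem HasT.vsep_or {C : Set Permu} {k : ℕ} {T : Ty k} (h : HasT C T) {a b : Fin k}
    (h1 : ¬ T.E a a) (h2 : ¬ T.E a b) (h3 : ¬ T.E b a) (h4 : ¬ T.E b b) :
    ((T.S a b ↔ T.S a a) ∧ (T.S b a ↔ T.S a a) ∧ (T.S b b ↔ T.S a a)) ∨ T.vsep a b ∨ T.vsep b a := by
  obtain ⟨π, -, P, hP⟩ := h 3
  have H := fun i j a b (hi : i < 3) (hj : j < 3) hij => (hP i hi a b).2.2 j hj hij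
  have := two_seq (fun i => π.2 (P i a)) (fun i => π.2 (P i b)) (T.S a a) (T.S a b) (T.S b a)
    (T.S b b)
    (fun i j hij hj => ⟨(H i j _ _ (by omega) hj hij).2.1, (H i j _ _ (by omega) hj hij).2.1,
      (H i j _ _ (by omega) hj hij).2.1, (H i j _ _ (by omega) hj hij).2.1⟩)
    (fun i j hij hj => by
      simp only [ne_eq, π.2.injective.eq_iff, (H i j _ _ (by omega) hj hij).2.2]
      exact ⟨h1, h2, h3, h4⟩)
  simp only [(hP 1 (by norm_num) _ _).2.1] at this
  exact this

theorem HasT.not_E {C : Set Permu} {k : ℕ} {T : Ty k} (h : HasT C T) {a b : Fin k}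
    (hs : T.S a b) : ¬ T.E a b := fun he => by
  obtain ⟨π, -, P, hP⟩ := h 2
  have := (hP 0 (by norm_num) a b).2.2 1 (by norm_num) (by norm_num)
  have h1 := this.2.2.2 he
  have h2 := this.2.1.2 hs
  rw [h1] at h2
  exact lt_irrefl _ h2


/-- `k` roles interleaved by value and pairwise separated by position. -/
def LinSep (k : ℕ) (C : Set Permu) : Prop :=
  ∃ T : Ty k, HasT C T ∧ (∀ a b, T.S a b) ∧ ∀ a b, a < b → T.sep a b

theorem lower_eq {n : ℕ} {X : Fin n → Fin n → Prop} (asym : ∀ i j, X i j → ¬ X j i)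
    {L L' : Finset (Fin n)} (hc : L.card = L'.card) (h : ∀ i ∈ L, ∀ j ∉ L, X i j)
    (h' : ∀ i ∈ L', ∀ j ∉ L', X i j) : L = L' := by
  by_contra hne
  have h1 : ¬ L ⊆ L' := fun hs => hne (Finset.eq_of_subset_of_card_le hs hc.ge)
  have h2 : ¬ L' ⊆ L := fun hs => hne (Finset.eq_of_subset_of_card_le hs hc.le).symm
  obtain ⟨i, hi, hi'⟩ := Finset.not_subset.1 h1
  obtain ⟨j, hj, hj'⟩ := Finset.not_subset.1 h2
  exact asym i j (h i hi j hj') (h' j hj i hi')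

/-- Position comparison for a word. -/
def Xw {k n : ℕ} (R : Fin k → Fin k → Prop) (f : Fin n → Fin k) (i j : Fin n) : Prop :=
  i < j ∧ R (f i) (f j) ∨ j < i ∧ ¬ R (f j) (f i)

theorem Xw_asym {k n : ℕ} {R : Fin k → Fin k → Prop} {f : Fin n → Fin k} (i j : Fin n)
    (h : Xw R f i j) : ¬ Xw R f j i := by
  rintro (h' | h') <;> rcases h with h | h <;> first | exact absurd h.1 h'.1.asymm | tauto

theorem Xw_sep {k n : ℕ} {T : Ty k} {f : Fin n → Fin k} {i j : Fin n} (h : T.sep (f i) (f j))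
    (hij : i ≠ j) : Xw T.R f i j := by
  rcases lt_or_gt_of_ne hij with h' | h'
  · exact Or.inl ⟨h', h.1⟩
  · exact Or.inr ⟨h', h.2.1⟩

theorem HasT.word {C : Set Permu} {k n : ℕ} {T : Ty k} (h : HasT C T) (f : Fin n → Fin k)
    (hE : ∀ i j, i < j → ¬ T.E (f i) (f j)) :
    ∃ π ∈ C, ∃ Q : Fin n → Fin π.1, Function.Injective Q ∧
      ∀ i j, (Q i < Q j ↔ Xw T.R f i j) ∧ (π.2 (Q i) < π.2 (Q j) ↔ Xw T.S f i j) := by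
  obtain ⟨π, hπ, P, hP⟩ := h n
  have hne : ∀ i j : Fin n, i < j → P i (f i) ≠ P j (f j) := fun i j hij he =>
    hE i j hij (((hP i i.2 _ _).2.2 j j.2 hij).2.2.1 he)
  refine ⟨π, hπ, fun i => P i (f i), fun i j he => ?_, fun i j => ?_⟩
  · rcases lt_trichotomy i j with h | h | h
    · exact absurd he (hne i j h)
    · exact h
    · exact absurd he.symm (hne j i h)
  · rcases lt_trichotomy i j with h | h | h
    · have := (hP i i.2 (f i) (f j)).2.2 j j.2 h
      simp [Xw, h, h.asymm, this]
    · subst h; simp [Xw]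
    · have := (hP j j.2 (f j) (f i)).2.2 i i.2 h
      have hn := hne j i h
      have hn' : π.2 (P j (f j)) ≠ π.2 (P i (f i)) := fun e => hn (π.2.injective e)
      simp only [Xw, h, h.asymm, ← this.1, ← this.2.1, false_and, true_and, false_or, not_lt]
      exact ⟨⟨le_of_lt, fun x => lt_of_le_of_ne x hn.symm⟩,
        ⟨le_of_lt, fun x => lt_of_le_of_ne x hn'.symm⟩⟩

theorem mono_perm_id {n : ℕ} (e : Equiv.Perm (Fin n)) (h : ∀ i j, i < j ↔ e i < e j) : e = 1 := by
  have := perm_fin_id e h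
  ext i; simp [this]

theorem LinSep.count {k : ℕ} {C : Set Permu} (hC : IsPermClass C) (h : LinSep k C) (n : ℕ) :
    k ^ n ≤ (n + 1) ^ k * pcount C n := by
  classical
  obtain ⟨T, hT, hS, hsep⟩ := h
  have := count_conf hC (n := n) (φ := Fin n → Fin k) (κ := Fin k → Fin (n + 1))
    (fun f a => ⟨(Finset.univ.filter fun t => f t < a).card, by
      have := Finset.card_le_univ (Finset.univ.filter fun t => f t < a)
      simp only [Fintype.card_fin] at this
      omega⟩) (fun f => Xw T.R f) (fun f => Xw T.S f)
    (fun f => hT.word f fun i j _ => hT.not_E (hS _ _)) (fun f f' e hst hX hY => by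
      have he : e = 1 := mono_perm_id e fun i j => by
        have := hY i j
        simpa [Xw, hS] using this
      subst he
      have hXX : ∀ i j, Xw T.R f i j ↔ Xw T.R f' i j := by simpa using hX
      have key : ∀ a t, f t < a ↔ f' t < a := by
        intro a t
        have hst' := congrArg Fin.val (congrFun hst a)
        have := lower_eq (Xw_asym (R := T.R) (f := f)) (L := Finset.univ.filter fun t => f t < a)
          (L' := Finset.univ.filter fun t => f' t < a) hst'
          (fun i hi j hj => by
            simp at hi hj
            exact Xw_sep (hsep _ _ (by omega)) (by rintro rfl; omega))
          (fun i hi j hj => by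
            simp at hi hj
            exact (hXX i j).2 (Xw_sep (hsep _ _ (by omega)) (by rintro rfl; omega)))
        have := congrArg (t ∈ ·) this
        simpa using this
      funext t
      have h1 := key (f' t) t
      have h2 := key (f t) t
      simp at h1 h2
      exact le_antisymm h2 h1)
  simpa using this

theorem exp_contra {a b : ℝ} (hb : 0 < b) (hab : b < a) (d : ℕ) (c : ℝ) :
    ∀ᶠ k : ℕ in atTop, c * (k : ℝ) ^ d * b ^ k < a ^ k := by
  have h1 := tendsto_pow_const_mul_const_pow_of_abs_lt_one d (r := b / a) (by
    rw [abs_of_pos (by have := hb.trans hab; positivity), div_lt_one (hb.trans hab)]; exact hab)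
  have h2 := (h1.const_mul c).eventually_lt_const (u := 1) (by simp)
  filter_upwards [h2] with k hk
  have ha : 0 < a ^ k := pow_pos (hb.trans hab) k
  rw [div_pow] at hk
  have : c * (k : ℝ) ^ d * b ^ k = (c * ((k : ℝ) ^ d * (b ^ k / a ^ k))) * a ^ k := by
    field_simp
  rw [this]
  nlinarith

/-- Eventual exponential bound. -/
def Thin (C : Set Permu) (x : ℝ) : Prop := ∀ᶠ n in atTop, (pcount C n : ℝ) ≤ x ^ n

theorem thin_contra {C : Set Permu} {x : ℝ} (hx : 0 < x) (hT : Thin C x) (l w d : ℕ) (hl : 0 < l)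
    (hw : x ^ l < w) (h : ∀ k, w ^ k ≤ (l * k + 1) ^ d * pcount C (l * k)) : False := by
  have h1 := exp_contra (pow_pos hx l) hw d ((l + 1 : ℝ) ^ d)
  have h2 : Tendsto (fun k => l * k) atTop atTop := tendsto_id.const_mul_atTop' hl
  obtain ⟨k, a, b, hk⟩ := (h1.and ((h2.eventually hT).and (eventually_ge_atTop 1))).exists
  have hk' : (1 : ℝ) ≤ k := by exact_mod_cast hk
  have h3 : (w : ℝ) ^ k ≤ (l * k + 1) ^ d * pcount C (l * k) := by exact_mod_cast h k
  have : (w : ℝ) ^ k < w ^ k := calc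
    _ ≤ (l * k + 1 : ℝ) ^ d * pcount C (l * k) := h3
    _ ≤ (l * k + 1 : ℝ) ^ d * x ^ (l * k) := by gcongr
    _ ≤ ((l + 1) * k : ℝ) ^ d * x ^ (l * k) := by gcongr; nlinarith
    _ = (l + 1 : ℝ) ^ d * (k : ℝ) ^ d * (x ^ l) ^ k := by rw [mul_pow, pow_mul]
    _ < _ := a
  exact lt_irrefl _ this

theorem K2_false {C : Set Permu} (hC : IsPermClass C) {x : ℝ} (hx : 0 < x) (hx2 : x < 2.3053)
    (hT : Thin C x) : ¬ LinSep 3 C := fun h =>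
  thin_contra hx hT 1 3 3 one_pos (by rw [pow_one]; push_cast; linarith) fun k => by simpa using h.count hC k

/-- Glueing a sequence of blocks into a word. -/
def blockw {p : (Fin 4 → Fin 3) → Prop} {k : ℕ} (W : Fin k → {w // p w}) (t : Fin (4 * k)) : Fin 3 :=
  (W ⟨t / 4, by omega⟩).1 ⟨t % 4, by omega⟩

theorem blockw_inj {p : (Fin 4 → Fin 3) → Prop} {k : ℕ} : Function.Injective (blockw (p := p) (k := k)) := by
  intro W W' h
  funext q
  ext r
  have := congrFun h ⟨4 * q + r, by omega⟩
  simp only [blockw] at this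
  have e1 : (⟨(4 * q + r) / 4, by omega⟩ : Fin k) = q := Fin.ext (by simp; omega)
  have e2 : (⟨(4 * q + r) % 4, by omega⟩ : Fin 4) = r := Fin.ext (by simp)
  rw [e1, e2] at this
  rw [this]

/-- Good blocks for `K1`. -/
def ok1 (w : Fin 4 → Fin 3) : Prop := (∀ i : Fin 3, w i.castSucc = 0 → w i.succ = 1) ∧ w 3 ≠ 0
/-- Good blocks for `K3`. -/
def ok3 (w : Fin 4 → Fin 3) : Prop := (∀ i : Fin 3, w i.castSucc = 1 → w i.succ ≠ 2) ∧ w 3 ≠ 1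

instance : DecidablePred ok1 := fun w => by unfold ok1; infer_instance
instance : DecidablePred ok3 := fun w => by unfold ok3; infer_instance

theorem card_ok1 : Fintype.card {w // ok1 w} = 29 := by decide +kernel
theorem card_ok3 : Fintype.card {w // ok3 w} = 34 := by decide +kernel

theorem block_step {p : (Fin 4 → Fin 3) → Prop} {k : ℕ} (W : Fin k → {w // p w}) {t : ℕ}
    (ht : t + 1 < 4 * k) (q : Fin 3 → Fin 3 → Prop)
    (h1 : ∀ w, p w → ∀ i : Fin 3, q (w i.castSucc) (w i.succ)) (h2 : ∀ w, p w → ∀ a, q (w 3) a) :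
    q (blockw W ⟨t, by omega⟩) (blockw W ⟨t + 1, ht⟩) := by
  simp only [blockw]
  by_cases h : t % 4 = 3
  · have : (⟨t % 4, by omega⟩ : Fin 4) = 3 := Fin.ext (by simp [h])
    rw [this]
    exact h2 _ (W _).2 _
  · have := h1 (W ⟨t / 4, by omega⟩).1 (W _).2 ⟨t % 4, by omega⟩
    have e1 : (⟨(t + 1) / 4, by omega⟩ : Fin k) = ⟨t / 4, by omega⟩ := Fin.ext (by simp; omega)
    have e2 : (⟨(t + 1) % 4, by omega⟩ : Fin 4) = (⟨t % 4, by omega⟩ : Fin 3).succ :=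
      Fin.ext (by simp; omega)
    rw [e1, e2]
    exact this

/-- A monotone cluster with inverted pairs, plus a separated role. -/
def K1 (C : Set Permu) : Prop :=
  ∃ T : Ty 3, HasT C T ∧ (∀ a b, T.S a b) ∧ T.B 0 1 ∧ (T.A 0 1 ↔ ¬ T.R 0 0) ∧ (T.A 1 0 ↔ T.R 0 0) ∧
    (∀ a b, a ≠ 2 → b ≠ 2 → (T.R a b ↔ T.R 0 0)) ∧
    (T.sep 0 2 ∧ T.sep 1 2 ∨ T.sep 2 0 ∧ T.sep 2 1)

/-- An `L`-shaped structure. -/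
def K3 (C : Set Permu) : Prop :=
  ∃ T : Ty 3, HasT C T ∧ (∀ a b, ¬ T.E a b) ∧ (∀ a b, a ≠ 2 → b ≠ 2 → T.S a b) ∧
    (∀ a b, a ≠ 1 → b ≠ 1 → (T.R a b ↔ T.R 0 0)) ∧
    (T.sep 0 1 ∧ T.sep 2 1 ∨ T.sep 1 0 ∧ T.sep 1 2) ∧
    (T.vsep 0 2 ∧ T.vsep 1 2 ∨ T.vsep 2 0 ∧ T.vsep 2 1)


theorem K1_false {C : Set Permu} (hC : IsPermClass C) {x : ℝ} (hx : 0 < x) (hx2 : x < 2.3053)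
    (hTh : Thin C x) : ¬ K1 C := by
  classical
  rintro ⟨T, hT, hS, hB, hA, -, hR, hsep⟩
  refine thin_contra hx hTh 4 29 1 (by norm_num) ?_ fun k => ?_
  · calc x ^ 4 < (2.3053 : ℝ) ^ 4 := by gcongr
      _ < _ := by norm_num
  let U : (Fin (4 * k) → Fin 3) → Fin (4 * k) → Fin (4 * k) → Prop := fun f i j =>
    if (j : ℕ) = i + 1 ∧ f i = 0 then T.A 0 1 else T.R (f i) (f j)
  let X : (Fin (4 * k) → Fin 3) → Fin (4 * k) → Fin (4 * k) → Prop := fun f i j =>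
    i < j ∧ U f i j ∨ j < i ∧ ¬ U f j i
  have asym : ∀ f i j, X f i j → ¬ X f j i := by
    rintro f i j h (h' | h') <;> rcases h with h | h <;> first | exact absurd h.1 h'.1.asymm | tauto
  have key : ∀ W : Fin k → {w // ok1 w}, (∀ i j : Fin (4 * k), (j : ℕ) = i + 1 → blockw W i = 0 → blockw W j = 1) ∧
      ∀ i : Fin (4 * k), blockw W i = 0 → (i : ℕ) + 1 < 4 * k := fun W => by
    refine ⟨fun i j hij h => ?_, fun i h => ?_⟩
    · have := block_step W (t := i) (by omega) (fun a b => a = 0 → b = 1) (fun w hw => hw.1)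
        (fun w hw a h => absurd h hw.2) h
      convert this using 2
      exact Fin.ext hij
    · by_contra hc
      have h4 : (⟨i % 4, by omega⟩ : Fin 4) = 3 := Fin.ext (by simp; omega)
      simp only [blockw, h4] at h
      exact (W _).2.2 h
  have := count_conf hC (n := 4 * k) (φ := Fin k → {w // ok1 w}) (κ := Fin (4 * k + 1))
    (fun W => ⟨(Finset.univ.filter fun t => blockw W t ≠ 2).card, by
      have := Finset.card_le_univ (Finset.univ.filter fun t => blockw W t ≠ 2)
      simp only [Fintype.card_fin] at this
      omega⟩) (fun W => X (blockw W)) (fun W i j => i < j) (fun W => by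
      obtain ⟨k1, k2⟩ := key W
      obtain ⟨π, hπ, P, hP⟩ := hT (4 * k)
      set f := blockw W
      let g : Fin (4 * k) → ℕ := fun t => if h : 0 < (t : ℕ) ∧ f ⟨t - 1, by omega⟩ = 0 then t - 1 else t
      have hg : ∀ t, g t ≤ t ∧ (t : ℕ) ≤ g t + 1 := fun t => by simp only [g]; split_ifs <;> omega
      have hlt : ∀ i j, i < j → (P (g i) (f i) < P (g j) (f j) ↔ U f i j) ∧
          π.2 (P (g i) (f i)) < π.2 (P (g j) (f j)) := fun i j hij => by
        by_cases hc : (j : ℕ) = i + 1 ∧ f i = 0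
        · have gj : g j = i := by
            have : (⟨j - 1, by omega⟩ : Fin (4 * k)) = i := Fin.ext (by simp; omega)
            simp only [g, this, hc.2]
            rw [dif_pos ⟨by omega, trivial⟩]; omega
          have gi : g i = i := by
            simp only [g]
            rw [dif_neg]
            rintro ⟨h1, h2⟩
            have := k1 _ i (by simp; omega) h2
            rw [hc.2] at this; exact absurd this (by decide)
          have hh := hP i (by omega) 0 1
          simp only [U, if_pos hc, gi, gj, hc.2, k1 i j hc.1 hc.2]
          exact ⟨hh.1, hh.2.1.2 hB⟩
        · have hgg : g i < g j := by
            have h1 := hg i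
            have h2 := hg j
            by_cases h3 : (j : ℕ) = i + 1
            · have : g j = j := by
                simp only [g]
                rw [dif_neg]
                rintro ⟨-, h4⟩
                have : (⟨j - 1, by omega⟩ : Fin (4 * k)) = i := Fin.ext (by simp; omega)
                rw [this] at h4
                exact hc ⟨h3, h4⟩
              omega
            · have : (i : ℕ) < j := hij
              omega
          have h1 := hg i
          have h2 := hg j
          have hh := (hP (g i) (by omega) (f i) (f j)).2.2 (g j) (by omega) hgg
          simp only [U, if_neg hc]
          exact ⟨hh.1, hh.2.1.2 (hS _ _)⟩
      have hinj : Function.Injective fun t => P (g t) (f t) := fun i j he => by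
        rcases lt_trichotomy i j with h | h | h
        · have := (hlt i j h).2
          simp only at he
          rw [he] at this; exact absurd this (lt_irrefl _)
        · exact h
        · have := (hlt j i h).2
          simp only at he
          rw [he] at this; exact absurd this (lt_irrefl _)
      refine ⟨π, hπ, fun t => P (g t) (f t), hinj, fun i j => ?_⟩
      rcases lt_trichotomy i j with h | h | h
      · simp [X, h, h.asymm, hlt i j h]
      · subst h; simp [X]
      · have h1 := hlt j i h
        simp only [X, h, h.asymm, ← h1.1, false_and, true_and, false_or, not_lt, iff_false]
        exact ⟨⟨le_of_lt, fun y => lt_of_le_of_ne y fun e => h.ne' (hinj e)⟩, h1.2.le⟩)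
    (fun W W' e hst hX hY => by
      have he : e = 1 := mono_perm_id e hY
      subst he
      have hXX : ∀ i j, X (blockw W) i j ↔ X (blockw W') i j := by simpa using hX
      obtain ⟨k1, k2⟩ := key W
      obtain ⟨k1', k2'⟩ := key W'
      apply blockw_inj
      have e3 : ∀ a : Fin 3, a ≠ 2 ↔ a = 0 ∨ a = 1 := by decide
      have hc := congrArg Fin.val hst
      simp only at hc
      clear hX hY hst
      generalize blockw W = f at *
      generalize blockw W' = f' at *
      have h2 : ∀ t, f t ≠ 2 ↔ f' t ≠ 2 := by
        have : Finset.univ.filter (fun t => f t ≠ 2) = Finset.univ.filter (fun t => f' t ≠ 2) := by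
          rcases hsep with hs | hs
          · have hh : ∀ f : Fin (4 * k) → Fin 3, (∀ i j : Fin (4 * k), (j : ℕ) = i + 1 → f i = 0 → f j = 1) →
              ∀ i ∈ Finset.univ.filter (fun t => f t ≠ 2), ∀ j ∉ Finset.univ.filter (fun t => f t ≠ 2), X f i j := by
              intro f k1 i hi j hj
              simp only [Finset.mem_filter, Finset.mem_univ, true_and, not_not] at hi hj
              have hs' : T.sep (f i) 2 := by rcases (e3 _).1 hi with h | h <;> rw [h] <;> simp [hs]
              rcases lt_trichotomy i j with h | h | h
              · left; refine ⟨h, ?_⟩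
                simp only [U]
                rw [if_neg, hj]; exact hs'.1
                rintro ⟨h1, h2⟩
                have := k1 _ _ h1 h2
                rw [hj] at this; exact absurd this (by decide)
              · subst h; exact absurd hj hi
              · right; refine ⟨h, ?_⟩
                simp only [U, hj]
                simpa using hs'.2.1
            exact lower_eq (asym f) hc (hh f k1) (fun i hi j hj => (hXX i j).2 (hh f' k1' i hi j hj))
          · have hh : ∀ f : Fin (4 * k) → Fin 3, (∀ i j : Fin (4 * k), (j : ℕ) = i + 1 → f i = 0 → f j = 1) →
              ∀ i ∈ Finset.univ.filter (fun t => f t ≠ 2), ∀ j ∉ Finset.univ.filter (fun t => f t ≠ 2), X f j i := by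
              intro f k1 i hi j hj
              simp only [Finset.mem_filter, Finset.mem_univ, true_and, not_not] at hi hj
              have hs' : T.sep 2 (f i) := by rcases (e3 _).1 hi with h | h <;> rw [h] <;> simp [hs]
              rcases lt_trichotomy i j with h | h | h
              · right; refine ⟨h, ?_⟩
                simp only [U]
                rw [if_neg, hj]; exact hs'.2.1
                rintro ⟨h1, h2⟩
                have := k1 _ _ h1 h2
                rw [hj] at this; exact absurd this (by decide)
              · subst h; exact absurd hj hi
              · left; refine ⟨h, ?_⟩
                simp only [U, hj]
                simpa using hs'.1
            exact lower_eq (X := fun i j => X f j i) (fun i j h => asym f _ _ h) hc (hh f k1)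
              (fun i hi j hj => (hXX j i).2 (hh f' k1' i hi j hj))
        intro t
        have := congrArg (t ∈ ·) this
        simpa using this
      have h01 : ∀ f f' : Fin (4 * k) → Fin 3, (∀ i j : Fin (4 * k), (j : ℕ) = i + 1 → f i = 0 → f j = 1) →
          (∀ i : Fin (4 * k), f i = 0 → (i : ℕ) + 1 < 4 * k) → (∀ t, f t ≠ 2 ↔ f' t ≠ 2) →
          (∀ i j, X f i j ↔ X f' i j) → ∀ t, f t = 0 → f' t = 0 := by
        intro f f' k1 k2 h2 hXX t ht
        by_contra hne
        have hj := k2 t ht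
        have a1 := k1 t ⟨t + 1, hj⟩ rfl ht
        have a2 := (h2 t).1 (by rw [ht]; decide)
        have a3 := (h2 ⟨t + 1, hj⟩).1 (by rw [a1]; decide)
        have := hXX t ⟨t + 1, hj⟩
        have hl : t < ⟨t + 1, hj⟩ := by simp [Fin.lt_def]
        simp only [X, hl, hl.asymm, U, ht, hne, true_and, false_and, or_false, and_true, and_false, if_true, if_false] at this
        rw [hA, hR _ _ a2 a3] at this
        tauto
      funext t
      have q1 := h01 f f' k1 k2 h2 hXX t
      have q2 := h01 f' f k1' k2' (fun t => (h2 t).symm) (fun i j => (hXX i j).symm) t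
      have q3 := h2 t
      generalize f t = a at *
      generalize f' t = b at *
      revert q1 q2 q3
      revert a b
      decide)
  simpa [card_ok1] using this


theorem fin_mono {n : ℕ} {e : Fin n → Fin n} (h : ∀ i j : Fin n, (j : ℕ) = i + 1 → e i < e j)
    {i j : Fin n} (hij : i < j) : e i < e j := by
  obtain ⟨d, hd⟩ : ∃ d, (j : ℕ) = i + d + 1 := ⟨j - i - 1, by have : (i : ℕ) < j := hij; omega⟩
  clear hij
  induction d generalizing j with
  | zero => exact h i j hd
  | succ d ih => exact (ih (j := ⟨i + d + 1, by omega⟩) rfl).trans (h _ _ (by simp; omega))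

theorem K3_false {C : Set Permu} (hC : IsPermClass C) {x : ℝ} (hx : 0 < x) (hx2 : x < 2.3053)
    (hTh : Thin C x) : ¬ K3 C := by
  classical
  rintro ⟨T, hT, hE, hS, hR, hsep, hvs⟩
  refine thin_contra hx hTh 4 34 2 (by norm_num) ?_ fun k => ?_
  · calc x ^ 4 < (2.3053 : ℝ) ^ 4 := by gcongr
      _ < _ := by norm_num
  have key : ∀ W : Fin k → {w // ok3 w}, ∀ i j : Fin (4 * k), (j : ℕ) = i + 1 → blockw W i = 1 → blockw W j ≠ 2 :=
    fun W i j hij h => by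
      have := block_step W (t := i) (by omega) (fun a b => a = 1 → b ≠ 2) (fun w hw => hw.1)
        (fun w hw a h => absurd h hw.2) h
      convert this using 2
      congr 1
      exact Fin.ext hij
  have := count_conf hC (n := 4 * k) (φ := Fin k → {w // ok3 w}) (κ := Fin 2 → Fin (4 * k + 1))
    (fun W a => ⟨(Finset.univ.filter fun t => blockw W t = a.succ).card, by
      have := Finset.card_le_univ (Finset.univ.filter fun t => blockw W t = a.succ)
      simp only [Fintype.card_fin] at this
      omega⟩) (fun W => Xw T.R (blockw W)) (fun W => Xw T.S (blockw W))
    (fun W => hT.word _ fun i j _ => hE _ _)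
    (fun W W' e hst hX hY => by
      have k1' := key W'
      have k1 := key W
      apply blockw_inj
      have hc1 := congrArg Fin.val (congrFun hst 0)
      have hc2 := congrArg Fin.val (congrFun hst 1)
      simp only [Fin.succ_zero_eq_one, Fin.succ_one_eq_two] at hc1 hc2
      clear hst
      generalize blockw W = f at *
      generalize blockw W' = f' at *
      have e1 : ∀ a : Fin 3, a ≠ 1 ↔ a = 0 ∨ a = 2 := by decide
      have e2 : ∀ a : Fin 3, a ≠ 2 ↔ a = 0 ∨ a = 1 := by decide
      have tr : ∀ a : Fin 3, (Finset.univ.filter fun t => f' t = a).card = (Finset.univ.filter fun t => f' (e t) = a).card := by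
        intro a
        refine (Finset.card_bij (fun t _ => e t) ?_ ?_ ?_).symm
        · simp
        · intro i _ j _ h; exact e.injective h
        · intro b hb
          exact ⟨e.symm b, by simpa using hb, by simp⟩
      rw [tr] at hc1 hc2
      have h1 : ∀ t, f t = 1 ↔ f' (e t) = 1 := by
        have : Finset.univ.filter (fun t => f t = 1) = Finset.univ.filter (fun t => f' (e t) = 1) := by
          rcases hsep with hs | hs
          · refine lower_eq (X := fun i j => Xw T.R f j i) (fun i j h => Xw_asym _ _ h) hc1 (fun i hi j hj => ?_) (fun i hi j hj => ?_)
            · simp only [Finset.mem_filter, Finset.mem_univ, true_and] at hi hj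
              refine Xw_sep ?_ (by rintro rfl; exact hj hi)
              rw [hi]; rcases (e1 _).1 hj with h | h <;> rw [h] <;> simp [hs]
            · simp only [Finset.mem_filter, Finset.mem_univ, true_and] at hi hj
              refine (hX _ _).2 (Xw_sep ?_ (by intro h; rw [h] at hj; exact hj hi))
              rw [hi]; rcases (e1 _).1 hj with h | h <;> rw [h] <;> simp [hs]
          · refine lower_eq (X := fun i j => Xw T.R f i j) (fun i j h => Xw_asym _ _ h) hc1 (fun i hi j hj => ?_) (fun i hi j hj => ?_)
            · simp only [Finset.mem_filter, Finset.mem_univ, true_and] at hi hj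
              refine Xw_sep ?_ (by rintro rfl; exact hj hi)
              rw [hi]; rcases (e1 _).1 hj with h | h <;> rw [h] <;> simp [hs]
            · simp only [Finset.mem_filter, Finset.mem_univ, true_and] at hi hj
              refine (hX _ _).2 (Xw_sep ?_ (by intro h; rw [h] at hi; exact hj hi))
              rw [hi]; rcases (e1 _).1 hj with h | h <;> rw [h] <;> simp [hs]
        intro t
        have := congrArg (t ∈ ·) this
        simpa using this
      have vX : ∀ {f : Fin (4 * k) → Fin 3} {i j : Fin (4 * k)}, T.vsep (f i) (f j) → i ≠ j → Xw T.S f i j := by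
        intro f i j h hij
        rcases lt_or_gt_of_ne hij with h' | h'
        · exact Or.inl ⟨h', h.1⟩
        · exact Or.inr ⟨h', h.2.1⟩
      have h2 : ∀ t, f t = 2 ↔ f' (e t) = 2 := by
        have : Finset.univ.filter (fun t => f t = 2) = Finset.univ.filter (fun t => f' (e t) = 2) := by
          rcases hvs with hs | hs
          · refine lower_eq (X := fun i j => Xw T.S f j i) (fun i j h => Xw_asym _ _ h) hc2 (fun i hi j hj => ?_) (fun i hi j hj => ?_)
            · simp only [Finset.mem_filter, Finset.mem_univ, true_and] at hi hj
              refine vX ?_ (by rintro rfl; exact hj hi)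
              rw [hi]; rcases (e2 _).1 hj with h | h <;> rw [h] <;> simp [hs]
            · simp only [Finset.mem_filter, Finset.mem_univ, true_and] at hi hj
              refine (hY _ _).2 (vX ?_ (by intro h; rw [h] at hj; exact hj hi))
              rw [hi]; rcases (e2 _).1 hj with h | h <;> rw [h] <;> simp [hs]
          · refine lower_eq (X := fun i j => Xw T.S f i j) (fun i j h => Xw_asym _ _ h) hc2 (fun i hi j hj => ?_) (fun i hi j hj => ?_)
            · simp only [Finset.mem_filter, Finset.mem_univ, true_and] at hi hj
              refine vX ?_ (by rintro rfl; exact hj hi)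
              rw [hi]; rcases (e2 _).1 hj with h | h <;> rw [h] <;> simp [hs]
            · simp only [Finset.mem_filter, Finset.mem_univ, true_and] at hi hj
              refine (hY _ _).2 (vX ?_ (by intro h; rw [h] at hi; exact hj hi))
              rw [hi]; rcases (e2 _).1 hj with h | h <;> rw [h] <;> simp [hs]
        intro t
        have := congrArg (t ∈ ·) this
        simpa using this
      have m2 : ∀ i j, i < j → f i ≠ 2 → f j ≠ 2 → e i < e j := by
        intro i j hij hi hj
        rcases (hY i j).1 (Or.inl ⟨hij, hS _ _ hi hj⟩) with h | h
        · exact h.1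
        · exact absurd (hS _ _ (fun q => hj ((h2 j).2 q)) (fun q => hi ((h2 i).2 q))) h.2
      have m1 : ∀ i j, i < j → f i ≠ 1 → f j ≠ 1 → e i < e j := by
        intro i j hij hi hj
        have hX' := hX i j
        have q1 := hR _ _ hi hj
        have q2 := hR (f' (e i)) (f' (e j)) (fun q => hi ((h1 i).2 q)) (fun q => hj ((h1 j).2 q))
        have q3 := hR (f' (e j)) (f' (e i)) (fun q => hj ((h1 j).2 q)) (fun q => hi ((h1 i).2 q))
        have hn : e i ≠ e j := fun h => hij.ne (e.injective h)
        simp only [Xw, hij, hij.asymm, q1, q2, q3] at hX'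
        rcases lt_or_gt_of_ne hn with h | h
        · exact h
        · simp only [h, h.asymm] at hX'; tauto
      have ex : ∀ a b : Fin (4 * k), a < b → f' a = 1 → f' b = 2 → ∃ s, a < s ∧ s < b ∧ f' s = 0 := by
        intro a b hab ha hb
        by_contra hc
        push Not at hc
        have : ∀ d, ∀ c : Fin (4 * k), (c : ℕ) = a + d → c ≤ b → f' c = 1 := by
          intro d
          induction d with
          | zero => intro c hc _; rw [show c = a from Fin.ext hc]; exact ha
          | succ d ih =>
            intro c hc' hcb
            have := ih ⟨a + d, by omega⟩ rfl (by rw [Fin.le_def] at *; simp; omega)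
            have n2 := k1' _ c (by simp; omega) this
            have n0 := hc c (by rw [Fin.lt_def]; omega) (lt_of_le_of_ne hcb (by rintro rfl; exact n2 hb))
            revert n2 n0; generalize f' c = z; revert z; decide
        have := this (b - a) b (by rw [Fin.lt_def] at hab; omega) le_rfl
        rw [hb] at this; exact absurd this (by decide)
      have hmono : ∀ i j : Fin (4 * k), (j : ℕ) = i + 1 → e i < e j := by
        intro i j hij
        have hl : i < j := by rw [Fin.lt_def]; omega
        by_cases c1 : f i ≠ 2 ∧ f j ≠ 2
        · exact m2 i j hl c1.1 c1.2
        by_cases c2 : f i ≠ 1 ∧ f j ≠ 1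
        · exact m1 i j hl c2.1 c2.2
        have n12 := k1 i j hij
        have hi : f i = 2 := by
          revert n12 c1 c2; generalize f i = a; generalize f j = b; revert a b; decide
        have hj : f j = 1 := by
          revert n12 c1 c2; generalize f i = a; generalize f j = b; revert a b; decide
        by_contra hlt
        have hlt' : e j < e i := lt_of_le_of_ne (not_lt.1 hlt) (fun h => hl.ne' (e.injective h))
        obtain ⟨s, s1, s2, s3⟩ := ex _ _ hlt' ((h1 j).1 hj) ((h2 i).1 hi)
        obtain ⟨t, rfl⟩ := e.surjective s
        have t1 : f t ≠ 1 := fun h => by rw [(h1 t).1 h] at s3; exact absurd s3 (by decide)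
        have t2 : f t ≠ 2 := fun h => by rw [(h2 t).1 h] at s3; exact absurd s3 (by decide)
        rcases lt_trichotomy t i with h | h | h
        · exact (m2 t j (h.trans hl) t2 (by rw [hj]; decide)).asymm s1
        · subst h; exact t2 hi
        · exact (m1 i t h (by rw [hi]; decide) t1).asymm s2
      have he : e = 1 := mono_perm_id e fun i j => ⟨fun h => fin_mono hmono h, fun h => by
        by_contra hc
        rcases lt_or_eq_of_le (not_lt.1 hc) with h' | h'
        · exact h.asymm (fin_mono hmono h')
        · rw [h'] at h; exact lt_irrefl _ h⟩
      subst he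
      funext t
      have q1 := h1 t
      have q2 := h2 t
      simp only [Equiv.Perm.coe_one, id] at q1 q2
      revert q1 q2
      generalize f t = a
      generalize f' t = b
      revert a b
      decide)
  simpa [card_ok3] using this


/-- A chain of `m` bad intervals starting at `a`. -/
def Chain (Bad : ℕ → ℕ → Prop) (a m : ℕ) : Prop :=
  ∃ c d : ℕ → ℕ, (∀ i < m, a ≤ c i ∧ Bad (c i) (d i)) ∧ ∀ i j, i < j → j < m → d i ≤ c j

theorem segmentation {Bad : ℕ → ℕ → Prop} (h1 : ∀ c d, d ≤ c + 1 → ¬ Bad c d) (n m : ℕ) :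
    ∀ a, ¬ Chain Bad a m → ∃ s : ℕ → ℕ, Monotone s ∧ (∀ v, s v < 2 * m + 1) ∧
      ∀ r, ∃ c d, a ≤ c ∧ (∀ v, a ≤ v → v < n → (s v = r ↔ c ≤ v ∧ v < d)) ∧ ¬ Bad c d := by
  classical
  induction m with
  | zero => intro a h; exact absurd ⟨id, id, by simp, by simp⟩ h
  | succ m ih =>
    intro a h
    by_cases hb : ∃ b, Bad a b
    · have hB := Nat.find_spec hb
      have hmin := fun b (hlt : b < Nat.find hb) => Nat.find_min hb hlt
      set b := Nat.find hb
      clear_value b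
      have hb2 : a + 1 < b := by
        by_contra hc
        exact h1 a b (by omega) hB
      obtain ⟨s, s1, s2, s3⟩ := ih b (fun ⟨c, d, k1, k2⟩ => h ⟨fun i => i.casesOn a c,
        fun i => i.casesOn b d, by
          rintro (_ | i) hi
          · exact ⟨le_rfl, hB⟩
          · have := k1 i (by omega)
            exact ⟨by have := this.1; simp; omega, this.2⟩, by
          rintro (_ | i) (_ | j) hij hj
          · omega
          · exact (k1 j (by omega)).1
          · omega
          · exact k2 i j (by omega) (by omega)⟩)
      refine ⟨fun v => if v < b - 1 then 0 else if v < b then 1 else 2 + s v, ?_, ?_, ?_⟩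
      · intro v w hvw
        have := s1 hvw
        simp only
        split_ifs <;> omega
      · intro v
        have := s2 v
        simp only
        split_ifs <;> omega
      · rintro (_ | _ | r)
        · refine ⟨a, b - 1, le_rfl, fun v h1 h2 => ?_, hmin _ (by omega)⟩
          simp only [Nat.zero_add]
          split_ifs <;> (constructor <;> intros <;> first | contradiction | omega)
        · refine ⟨b - 1, b, by omega, fun v h1 h2 => ?_, h1 _ _ (by omega)⟩
          simp only [Nat.zero_add]
          split_ifs <;> (constructor <;> intros <;> first | contradiction | omega)
        · obtain ⟨c, d, hc, k1, k2⟩ := s3 r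
          refine ⟨c, d, by omega, fun v h1 h2 => ?_, k2⟩
          simp only [Nat.zero_add]
          by_cases hv : b ≤ v
          · have := k1 v hv h2
            split_ifs <;> (constructor <;> intros <;> first | contradiction | omega)
          · split_ifs <;> (constructor <;> intros <;> first | contradiction | omega)
    · push Not at hb
      refine ⟨fun _ => 0, monotone_const, fun v => by simp only; omega, fun r => ?_⟩
      by_cases hr : r = 0
      · exact ⟨a, n, le_rfl, fun v h1 h2 => by subst hr; simp [h1, h2], hb _⟩
      · exact ⟨a, a, le_rfl, fun v h1 h2 => by simp only; omega, h1 _ _ (by omega)⟩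

theorem pick {α : Type*} {m : ℕ} {p : ℕ → α → Prop} (h : ∀ i < m + 1, ∃ x, p i x) :
    ∃ f : ℕ → α, ∀ i < m + 1, p i (f i) := by
  obtain ⟨x0, -⟩ := h 0 (by omega)
  have : ∀ i, ∃ x, i < m + 1 → p i x := fun i => by
    by_cases hi : i < m + 1
    · obtain ⟨x, hx⟩ := h i hi; exact ⟨x, fun _ => hx⟩
    · exact ⟨x0, fun h => absurd h hi⟩
  exact ⟨fun i => (this i).choose, fun i => (this i).choose_spec⟩

/-- `Q` embeds `β` into `π`. -/
def Emb (β π : Permu) (Q : Fin β.1 → Fin π.1) : Prop :=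
  ∀ a b, (Q a < Q b ↔ a < b) ∧ (π.2 (Q a) < π.2 (Q b) ↔ β.2 a < β.2 b)

/-- SmallP permutations. -/
abbrev SmallP (B : ℕ) := Σ n : Fin (B + 1), Equiv.Perm (Fin n)

theorem pat_mono {n : ℕ} (π : Equiv.Perm (Fin n)) {S S' : Finset (Fin n)} (h : S ⊆ S') :
    PLe (pat π S) (pat π S') :=
  ((pat_std π S).rz.mono (fun i => (⟨i.1, h i.2⟩ : S')) (fun _ _ => Iff.rfl)
    (fun _ _ => Iff.rfl)).ple (pat_std π S')

theorem ple_pat {n : ℕ} (π : Equiv.Perm (Fin n)) {S : Finset (Fin n)} {β : Permu}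
    (h : PLe β (pat π S)) : ∃ Q : Fin β.1 → Fin n, Emb β ⟨n, π⟩ Q ∧ ∀ a, Q a ∈ S := by
  obtain ⟨f, h1, h2⟩ := h.rz (pat_std π S).rz
  exact ⟨fun a => (f a).1, fun a b => ⟨(h1 a b).symm, (h2 a b).symm⟩, fun a => (f a).2⟩

theorem hstep {C G : Set Permu} {B : ℕ} (hG1 : ∀ π : Permu, π.1 ≤ 1 → π ∈ G)
    (hB : ∀ π ∉ G, ∃ β, PLe β π ∧ β ∉ G ∧ β.1 ≤ B)
    (key : ∀ (β : Permu) (T : Ty β.1), β ∉ G → HasT C T →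
      (∀ a b, (T.A a b ↔ a < b) ∧ (T.B a b ↔ β.2 a < β.2 b) ∧ T.S a b) → False) :
    ∃ h : ℕ, 0 < h ∧ ∀ π ∈ C, ∃ s : Fin π.1 → Fin h, Monotone s ∧
      ∀ r, pat π.2 (Finset.univ.filter fun i => s (π.2 i) = r) ∈ G := by
  classical
  let Bad : Permu → ℕ → ℕ → Prop := fun π c d => ∃ β : SmallP B, (⟨β.1, β.2⟩ : Permu) ∉ G ∧
    ∃ Q, Emb ⟨β.1, β.2⟩ π Q ∧ ∀ a, c ≤ (π.2 (Q a) : ℕ) ∧ (π.2 (Q a) : ℕ) < d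
  by_cases hch : ∃ m, ∀ π ∈ C, ¬ Chain (Bad π) 0 m
  · obtain ⟨m, hm⟩ := hch
    refine ⟨2 * m + 1, by omega, fun π hπ => ?_⟩
    obtain ⟨s, s1, s2, s3⟩ := segmentation (Bad := Bad π) (fun c d hcd => by
      rintro ⟨⟨n, p⟩, hβ, Q, hQ, hv⟩
      apply hβ
      apply hG1
      by_contra hc
      simp only [not_le] at hc
      have a1 := hv ⟨0, by simp only; omega⟩
      have a2 := hv ⟨1, by simp only; omega⟩
      have a3 := (hQ ⟨0, by simp only; omega⟩ ⟨1, by simp only; omega⟩).1.2 (by simp [Fin.lt_def])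
      refine a3.ne (π.2.injective (Fin.ext ?_))
      omega) π.1 m 0 (hm π hπ)
    refine ⟨fun v => ⟨s v, s2 v⟩, fun v w h => s1 h, fun r => ?_⟩
    by_contra hn
    obtain ⟨β, b1, b2, b3⟩ := hB _ hn
    obtain ⟨Q, q1, q2⟩ := ple_pat _ b1
    obtain ⟨c, d, -, e1, e2⟩ := s3 r
    refine e2 ⟨⟨⟨β.1, by omega⟩, β.2⟩, b2, Q, q1, fun a => (e1 _ (by omega) (Fin.is_lt _)).1 ?_⟩
    have := q2 a
    simpa [Fin.ext_iff] using this
  · exfalso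
    push Not at hch
    obtain ⟨T, l, hT⟩ := hom (k := B) (κ := SmallP B) (C := C) (fun π P l P' l' =>
      (⟨l.1, l.2⟩ : Permu) ∉ G ∧ Emb ⟨l.1, l.2⟩ π (fun a => P (Fin.castLE (Nat.le_of_lt_succ l.1.2) a)) ∧
        ∀ a b, π.2 (P a) < π.2 (P' b)) (fun m => by
      obtain ⟨π, hπ, c, d, h1, h2⟩ := hch (m + 1)
      have := pick (m := m) (fun i hi => (h1 i hi).2)
      obtain ⟨f, hf⟩ := this
      have hpos : ∀ i < m + 1, 0 < (f i).1.1 := fun i hi => by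
        have := (hf i hi).1
        by_contra hc
        exact this (hG1 _ (by simp; omega))
      have : ∀ i < m + 1, ∃ P : Fin B → Fin π.1, Emb ⟨(f i).1, (f i).2⟩ π (fun a => P (Fin.castLE (Nat.le_of_lt_succ (f i).1.2) a)) ∧
          ∀ a, c i ≤ (π.2 (P a) : ℕ) ∧ (π.2 (P a) : ℕ) < d i := fun i hi => by
        obtain ⟨-, Q, q1, q2⟩ := hf i hi
        have h0 := hpos i hi
        refine ⟨fun a => if h : (a : ℕ) < (f i).1 then Q ⟨a, h⟩ else Q ⟨0, h0⟩, ?_, ?_⟩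
        · convert q1 using 2 with a
          simp
        · intro a
          simp only
          split_ifs
          · exact q2 _
          · exact q2 _
      obtain ⟨P, hP⟩ := pick this
      refine ⟨π, hπ, P, f, fun i j hij hj => ⟨(hf i (by omega)).1, (hP i (by omega)).1, fun a b => ?_⟩⟩
      have a1 := (hP i (by omega)).2 a
      have a2 := (hP j (by omega)).2 b
      have a3 := h2 i j hij (by omega)
      rw [Fin.lt_def]; omega)
    obtain ⟨π, hπ, P, hP, hh⟩ := hT 2
    have h01 := hh 0 1 (by norm_num) (by norm_num)
    refine key ⟨l.1, l.2⟩ (T.comap (Fin.castLE (Nat.le_of_lt_succ l.1.2))) h01.1 (HasT.comap (fun m => ?_) _) fun a b => ?_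
    · obtain ⟨π, hπ, P, hP, -⟩ := hT m
      exact ⟨π, hπ, P, hP⟩
    · have e1 := hP 0 (by norm_num) (Fin.castLE (Nat.le_of_lt_succ l.1.2) a) (Fin.castLE (Nat.le_of_lt_succ l.1.2) b)
      have e2 := h01.2.1 a b
      refine ⟨e1.1.symm.trans e2.1, e1.2.1.symm.trans e2.2, ?_⟩
      exact (e1.2.2 1 (by norm_num) (by norm_num)).2.1.1 (h01.2.2 _ _)


/-- Roles moving together. -/
def Ty.tog {k : ℕ} (T : Ty k) (a b : Fin k) : Prop :=
  (T.R a b ↔ T.R a a) ∧ (T.R b a ↔ T.R a a) ∧ (T.R b b ↔ T.R a a)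

theorem Ty.tog.symm {k : ℕ} {T : Ty k} {a b : Fin k} (h : T.tog a b) : T.tog b a := by
  unfold Ty.tog at *; tauto

theorem Ty.tog.not_sep {k : ℕ} {T : Ty k} {a b : Fin k} (h : T.tog a b) : ¬ T.sep a b := by
  unfold Ty.tog Ty.sep at *; tauto

theorem Hom.lt {k : ℕ} {T : Ty k} {m : ℕ} {π : Permu} {P : ℕ → Fin k → Fin π.1} (h : Hom T m π P)
    {i j : ℕ} (hi : i < m) (hj : j < m) (hij : i < j) (a b : Fin k) : P i a < P j b ↔ T.R a b :=
  ((h i hi a b).2.2 j hj hij).1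

theorem Hom.vlt {k : ℕ} {T : Ty k} {m : ℕ} {π : Permu} {P : ℕ → Fin k → Fin π.1} (h : Hom T m π P)
    {i j : ℕ} (hi : i < m) (hj : j < m) (hij : i < j) (a b : Fin k) :
    π.2 (P i a) < π.2 (P j b) ↔ T.S a b :=
  ((h i hi a b).2.2 j hj hij).2.1

theorem Hom.ne {k : ℕ} {T : Ty k} {m : ℕ} {π : Permu} {P : ℕ → Fin k → Fin π.1} (h : Hom T m π P)
    {i j : ℕ} (hi : i < m) (hj : j < m) (hij : i < j) {a b : Fin k} (hE : ¬ T.E a b) : P i a ≠ P j b :=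
  fun he => hE (((h i hi a b).2.2 j hj hij).2.2.1 he)

theorem HasT.sep_trans {C : Set Permu} {k : ℕ} {T : Ty k} (h : HasT C T) {a b c : Fin k}
    (hE : ¬ T.E b a) (h1 : T.sep a b) (h2 : T.sep b c) : T.sep a c := by
  obtain ⟨π, -, P, hP⟩ := h 2
  have l := fun a b => hP.lt (i := 0) (j := 1) (by norm_num) (by norm_num) (by norm_num) a b
  have A0 := fun a b => (hP 0 (by norm_num) a b).1
  have A1 := fun a b => (hP 1 (by norm_num) a b).1
  have hne := hP.ne (i := 0) (j := 1) (by norm_num) (by norm_num) (by norm_num) hE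
  unfold Ty.sep at *
  refine ⟨?_, ?_, ?_⟩
  · exact (l a c).1 (((l a b).2 h1.1).trans ((A1 b c).2 h2.2.2))
  · intro hh
    have q1 : P 1 a < P 0 b := lt_of_le_of_ne (not_lt.1 fun q => h1.2.1 ((l b a).1 q)) hne.symm
    exact absurd ((l c a).2 hh) (q1.trans ((A0 b c).2 h2.2.2)).asymm
  · exact (A0 a c).1 (((A0 a b).2 h1.2.2).trans ((A0 b c).2 h2.2.2))

theorem HasT.tog_trans {C : Set Permu} {k : ℕ} {T : Ty k} (h : HasT C T) {a b c : Fin k}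
    (hE : ¬ T.E a b) (hE' : ¬ T.E b c) (hE2 : ¬ T.E b a) (hE2' : ¬ T.E c b) (h1 : T.tog a b) (h2 : T.tog b c) : T.tog a c := by
  obtain ⟨π, -, P, hP⟩ := h 3
  have l01 := fun a b => hP.lt (i := 0) (j := 1) (by norm_num) (by norm_num) (by norm_num) a b
  have l02 := fun a b => hP.lt (i := 0) (j := 2) (by norm_num) (by norm_num) (by norm_num) a b
  have l12 := fun a b => hP.lt (i := 1) (j := 2) (by norm_num) (by norm_num) (by norm_num) a b
  have n1 := hP.ne (i := 0) (j := 1) (by norm_num) (by norm_num) (by norm_num) hE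
  have n2 := hP.ne (i := 1) (j := 2) (by norm_num) (by norm_num) (by norm_num) hE'
  have n3 := hP.ne (i := 0) (j := 1) (by norm_num) (by norm_num) (by norm_num) hE2'
  have n4 := hP.ne (i := 1) (j := 2) (by norm_num) (by norm_num) (by norm_num) hE2
  obtain ⟨u1, u2, u3⟩ := h1
  obtain ⟨v1, v2, v3⟩ := h2
  by_cases hr : T.R a a
  · simp only [hr, iff_true] at u1 u2 u3
    simp only [u3, iff_true] at v1 v2 v3
    have q1 := (l02 a c).1 (((l01 a b).2 u1).trans ((l12 b c).2 v1))
    have q2 := (l02 c a).1 (((l01 c b).2 v2).trans ((l12 b a).2 u2))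
    exact ⟨by simp [hr, q1], by simp [hr, q2], by simp [hr, v3]⟩
  · simp only [hr, iff_false] at u1 u2 u3
    simp only [u3, iff_false] at v1 v2 v3
    have q1 : ¬ T.R a c := fun hh => by
      have := (l02 a c).2 hh
      have w1 : P 1 b < P 0 a := lt_of_le_of_ne (not_lt.1 fun q => u1 ((l01 a b).1 q)) n1.symm
      have w2 : P 2 c < P 1 b := lt_of_le_of_ne (not_lt.1 fun q => v1 ((l12 b c).1 q)) n2.symm
      exact absurd this (w2.trans w1).asymm
    have q2 : ¬ T.R c a := fun hh => by
      have := (l02 c a).2 hh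
      have w1 : P 1 b < P 0 c := lt_of_le_of_ne (not_lt.1 fun q => v2 ((l01 c b).1 q)) n3.symm
      have w2 : P 2 a < P 1 b := lt_of_le_of_ne (not_lt.1 fun q => u2 ((l12 b a).1 q)) n4.symm
      exact absurd this (w2.trans w1).asymm
    exact ⟨by simp [hr, q1], by simp [hr, q2], by simp [hr, v3]⟩

theorem HasT.lin2 {C : Set Permu} {k : ℕ} {T : Ty k} (h : HasT C T) {a b : Fin k}
    (hS : ∀ x y, (x = a ∨ x = b) → (y = a ∨ y = b) → T.S x y)
    (h1 : T.sep a b) : LinSep 2 C := by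
  refine ⟨T.comap ![a, b], h.comap _, ?_, ?_⟩
  · intro x y
    apply hS
    · fin_cases x <;> simp
    · fin_cases y <;> simp
  · intro x y hxy
    fin_cases x <;> fin_cases y <;> simp at hxy
    exact h1

theorem HasT.lin3 {C : Set Permu} {k : ℕ} {T : Ty k} (h : HasT C T) {a b c : Fin k}
    (hS : ∀ x y, (x = a ∨ x = b ∨ x = c) → (y = a ∨ y = b ∨ y = c) → T.S x y)
    (h1 : T.sep a b) (h2 : T.sep b c) : LinSep 3 C := by
  have h3 := h.sep_trans (h.not_E (hS _ _ (by simp) (by simp))) h1 h2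
  refine ⟨T.comap ![a, b, c], h.comap _, ?_, ?_⟩
  · intro x y
    apply hS
    · fin_cases x <;> simp
    · fin_cases y <;> simp
  · intro x y hxy
    fin_cases x <;> fin_cases y <;> simp at hxy
    · exact h1
    · exact h3
    · exact h2

theorem HasT.sep_or' {C : Set Permu} {k : ℕ} {T : Ty k} (h : HasT C T) {a b : Fin k}
    (hE : ∀ x y, (x = a ∨ x = b) → (y = a ∨ y = b) → ¬ T.E x y) :
    T.tog a b ∨ T.sep a b ∨ T.sep b a :=
  h.sep_or (hE _ _ (by simp) (by simp)) (hE _ _ (by simp) (by simp)) (hE _ _ (by simp) (by simp))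
    (hE _ _ (by simp) (by simp))

/-- Building the configuration `K1`; `a` is below `b` in value. -/
theorem HasT.k1 {C : Set Permu} {k : ℕ} {T : Ty k} (h : HasT C T) {a b c : Fin k}
    (hS : ∀ x y, (x = a ∨ x = b ∨ x = c) → (y = a ∨ y = b ∨ y = c) → T.S x y)
    (hB : T.B a b) (hA : T.A a b ↔ ¬ T.R a a) (hA' : T.A b a ↔ T.R a a) (ht : T.tog a b)
    (hs : T.sep a c ∧ T.sep b c ∨ T.sep c a ∧ T.sep c b) : K1 C := by
  refine ⟨T.comap ![a, b, c], h.comap _, ?_, hB, hA, hA', ?_, hs⟩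
  · intro x y
    apply hS
    · fin_cases x <;> simp
    · fin_cases y <;> simp
  · intro x y hx hy
    fin_cases x <;> fin_cases y <;> simp at hx hy
    · exact Iff.rfl
    · exact ht.1
    · exact ht.2.1
    · exact ht.2.2

/-- Monotone on a set of positions. -/
def MonoOn' {n : ℕ} (π : Fin n → Fin n) (p : Fin n → Prop) : Prop :=
  (∀ a b, p a → p b → a < b → π a < π b) ∨ (∀ a b, p a → p b → a < b → π b < π a)

/-- Juxtapositions of two monotone permutations. -/
def Jc : Set Permu := {β | ∃ p : Fin β.1 → Prop, (∀ a b, p a → ¬ p b → a < b) ∧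
  MonoOn' β.2 p ∧ MonoOn' β.2 (fun a => ¬ p a)}

/-- `C` contains all sums of copies of `β`. -/
def InfSum (C : Set Permu) (β : Permu) : Prop := ∀ m, ∃ π ∈ C, ∃ P : ℕ → Fin β.1 → Fin π.1,
  ∀ i < m, Emb β π (P i) ∧ ∀ j < m, i < j → ∀ a b, P i a < P j b ∧ π.2 (P i a) < π.2 (P j b)

theorem key_const {C : Set Permu} {β : Permu} {T : Ty β.1} (h : HasT C T)
    (hT : ∀ a b, (T.A a b ↔ a < b) ∧ (T.B a b ↔ β.2 a < β.2 b) ∧ T.S a b)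
    (ht : ∀ a b, T.tog a b) : InfSum C β ∨ InfSum (crev C) (prev β) := by
  have hE := fun a b => h.not_E (hT a b).2.2
  by_cases hr : ∀ a b, T.R a b
  · left
    intro m
    obtain ⟨π, hπ, P, hP⟩ := h m
    refine ⟨π, hπ, P, fun i hi => ⟨fun a b => ⟨(hP i hi a b).1.trans (hT a b).1,
      (hP i hi a b).2.1.trans (hT a b).2.1⟩, fun j hj hij a b => ⟨(hP.lt hi hj hij a b).2 (hr a b),
      (hP.vlt hi hj hij a b).2 (hT a b).2.2⟩⟩⟩
  · right
    have hr' : ∀ a b, ¬ T.R a b := by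
      push Not at hr
      obtain ⟨c, d, hcd⟩ := hr
      intro a b hab
      have q1 := ht a b
      have q2 := ht c d
      have q3 := ht a c
      unfold Ty.tog at *
      tauto
    intro m
    obtain ⟨π, hπ, P, hP⟩ := h m
    refine ⟨prev π, by simpa [crev, prev_prev] using hπ,
      fun i (a : Fin β.1) => (P i (Fin.rev a)).rev, fun i hi => ⟨fun (a b : Fin β.1) => ⟨?_, ?_⟩,
      fun j hj hij (a b : Fin β.1) => ⟨?_, ?_⟩⟩⟩
    · show (P i (Fin.rev a)).rev < (P i (Fin.rev b)).rev ↔ a < b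
      rw [Fin.rev_lt_rev, (hP i hi _ _).1, (hT _ _).1, Fin.rev_lt_rev]
    · show π.2 (Fin.rev (P i (Fin.rev a)).rev) < π.2 (Fin.rev (P i (Fin.rev b)).rev) ↔ β.2 (Fin.rev a) < β.2 (Fin.rev b)
      rw [Fin.rev_rev, Fin.rev_rev, (hP i hi _ _).2.1, (hT _ _).2.1]
    · show (P i (Fin.rev a)).rev < (P j (Fin.rev b)).rev
      rw [Fin.rev_lt_rev]
      exact lt_of_le_of_ne (not_lt.1 fun q => hr' _ _ ((hP.lt hi hj hij _ _).1 q)) (hP.ne hi hj hij (hE _ _)).symm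
    · show π.2 (Fin.rev (P i (Fin.rev a)).rev) < π.2 (Fin.rev (P j (Fin.rev b)).rev)
      rw [Fin.rev_rev, Fin.rev_rev]
      exact (hP.vlt hi hj hij _ _).2 (hT _ _).2.2

theorem key_noflag {C : Set Permu} {β : Permu} {T : Ty β.1} (h : HasT C T)
    (hT : ∀ a b, (T.A a b ↔ a < b) ∧ (T.B a b ↔ β.2 a < β.2 b) ∧ T.S a b) (n2 : ¬ LinSep 2 C) :
    InfSum C β ∨ InfSum (crev C) (prev β) := by
  have hE := fun a b => h.not_E (hT a b).2.2
  refine key_const h hT fun a b => ?_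
  rcases h.sep_or' (a := a) (b := b) (fun _ _ _ _ => hE _ _) with q | q | q
  · exact q
  · exact absurd (h.lin2 (fun _ _ _ _ => (hT _ _).2.2) q) n2
  · exact absurd (h.lin2 (fun _ _ _ _ => (hT _ _).2.2) q) n2

theorem key_flag {C : Set Permu} {β : Permu} {T : Ty β.1} (h : HasT C T)
    (hT : ∀ a b, (T.A a b ↔ a < b) ∧ (T.B a b ↔ β.2 a < β.2 b) ∧ T.S a b) (n3 : ¬ LinSep 3 C)
    (n1 : ¬ K1 C) : β ∈ Jc ∨ InfSum C β ∨ InfSum (crev C) (prev β) := by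
  have hS := fun a b => (hT a b).2.2
  have hE := fun a b => h.not_E (hT a b).2.2
  have so := fun a b => h.sep_or' (a := a) (b := b) (fun _ _ _ _ => hE _ _)
  have tt := fun {a b c} => h.tog_trans (hE a b) (hE b c) (hE b a) (hE c b)
  have l3 : ∀ {a b c}, T.sep a b → T.sep b c → False := fun h1 h2 => n3 (h.lin3 (fun _ _ _ _ => hS _ _) h1 h2)
  by_cases hs : ∃ l r, T.sep l r
  · left
    obtain ⟨l, r, hlr⟩ := hs
    have c1 : ∀ a, ¬ T.tog a l → T.tog a r := by
      intro a ha
      rcases so a l with q | q | q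
      · exact absurd q ha
      · exact (l3 q hlr).elim
      · rcases so a r with q' | q' | q'
        · exact q'
        · exact (l3 q q').elim
        · exact (l3 hlr q').elim
    have c2 : ∀ a b, T.tog a l → ¬ T.tog b l → T.sep a b := by
      intro a b ha hb
      rcases so a b with q | q | q
      · exact absurd (tt q.symm ha) hb
      · exact q
      · rcases so a r with q' | q' | q'
        · exact absurd hlr (tt ha.symm q').not_sep
        · exact (l3 q q').elim
        · exact (l3 hlr q').elim
    have mono : ∀ (p : Fin β.1 → Prop) (z w : Fin β.1), (∀ a, p a → T.tog a z) → (∀ a, p a → T.sep a w) ∨ (∀ a, p a → T.sep w a) → MonoOn' β.2 p := by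
      intro p z w hp hw
      have hne : ∀ {a b : Fin β.1}, a < b → β.2 a ≠ β.2 b := fun h e => h.ne (β.2.injective e)
      have hsw : ∀ a b, p a → p b → T.sep a w ∧ T.sep b w ∨ T.sep w a ∧ T.sep w b := fun a b ha hb => by
        rcases hw with hw | hw
        · exact Or.inl ⟨hw a ha, hw b hb⟩
        · exact Or.inr ⟨hw a ha, hw b hb⟩
      by_cases hr : T.R z z
      · left
        intro a b ha hb hab
        by_contra hc
        have hlt : β.2 b < β.2 a := lt_of_le_of_ne (not_lt.1 hc) (hne hab).symm
        have hb' : T.R b b := by have := (hp b hb).2.2; tauto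
        exact n1 (h.k1 (a := b) (b := a) (c := w) (fun _ _ _ _ => hS _ _) ((hT _ _).2.1.2 hlt)
          (by rw [(hT _ _).1]; simp [hb', hab.le]) (by rw [(hT _ _).1]; simp [hb', hab]) (tt (hp b hb) (hp a ha).symm) (hsw _ _ hb ha))
      · right
        intro a b ha hb hab
        by_contra hc
        have hlt : β.2 a < β.2 b := lt_of_le_of_ne (not_lt.1 hc) (hne hab)
        have hb' : ¬ T.R a a := by have := (hp a ha).2.2; tauto
        exact n1 (h.k1 (a := a) (b := b) (c := w) (fun _ _ _ _ => hS _ _) ((hT _ _).2.1.2 hlt)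
          (by rw [(hT _ _).1]; simp [hb', hab]) (by rw [(hT _ _).1]; simp [hb', hab.le]) (tt (hp a ha) (hp b hb).symm) (hsw _ _ ha hb))
    have hrl : ¬ T.tog r l := fun q => q.symm.not_sep hlr
    have hll : T.tog l l := by unfold Ty.tog; tauto
    exact ⟨fun a => T.tog a l, fun a b ha hb => (hT a b).1.1 (c2 a b ha hb).2.2,
      mono _ l r (fun a ha => ha) (Or.inl fun a ha => c2 a r ha hrl),
      mono _ r l c1 (Or.inr fun a ha => c2 l a hll ha)⟩
  · right
    push Not at hs
    refine key_const h hT fun a b => ?_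
    rcases so a b with q | q | q
    · exact q
    · exact absurd q (hs _ _)
    · exact absurd q (hs _ _)


/-- Some gadget with a given type has its rows in `[c, d)`. -/
def VBad {k h : ℕ} (Rw : Fin k → Prop)
    (Φ : (Fin k → Fin k → Prop) → (Fin k → Fin k → Prop) → (Fin k → Fin h) → Prop)
    (ρ : Permu) (s : Fin ρ.1 → Fin h) (c d : ℕ) : Prop :=
  ∃ P : Fin k → Fin ρ.1, (∀ a, Rw a → c ≤ (ρ.2 (P a) : ℕ) ∧ (ρ.2 (P a) : ℕ) < d) ∧
    Φ (fun a b => P a < P b) (fun a b => ρ.2 (P a) < ρ.2 (P b)) (fun a => s (P a))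

theorem vstep {C : Set Permu} {k h : ℕ} (Rw : Fin k → Prop)
    (Φ : (Fin k → Fin k → Prop) → (Fin k → Fin k → Prop) → (Fin k → Fin h) → Prop)
    (key : ∀ (T : Ty k) l, HasT C T → Φ T.A T.B l → (∀ a b, Rw a → Rw b → T.S a b) →
      (∀ a b, l a < l b → T.sep a b) → (∀ a b, l a ≠ l b → ¬ T.E a b) → False) :
    ∃ m, ∀ ρ ∈ C, ∀ s : Fin ρ.1 → Fin h, Monotone s → ¬ Chain (VBad Rw Φ ρ s) 0 m := by
  classical
  by_contra hch
  push Not at hch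
  obtain ⟨T, l, hT⟩ := hom (k := k) (κ := Fin k → Fin h) (C := C) (fun π P l P' l' =>
      Φ (fun a b => P a < P b) (fun a b => π.2 (P a) < π.2 (P b)) l ∧
      (∀ a b, Rw a → Rw b → π.2 (P a) < π.2 (P' b)) ∧
      (l = l' → ∀ a b, l a < l b → P a < P' b ∧ P' a < P b ∧ P a < P b)) (fun m => by
    obtain ⟨π, hπ, s, hs, c, d, h1, h2⟩ := hch (m + 1)
    obtain ⟨P, hP⟩ := pick (m := m) (fun i hi => (h1 i hi).2)
    refine ⟨π, hπ, P, fun i a => s (P i a), fun i j hij hj => ⟨(hP i (by omega)).2, fun a b ha hb => ?_,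
      fun he a b hab => ⟨?_, ?_, ?_⟩⟩⟩
    · have a1 := (hP i (by omega)).1 a ha
      have a2 := (hP j (by omega)).1 b hb
      have a3 := h2 i j hij (by omega)
      rw [Fin.lt_def]; omega
    · refine hs.reflect_lt ?_
      rw [← show s (P i b) = s (P j b) from congrFun he b]; exact hab
    · refine hs.reflect_lt ?_
      rw [← show s (P i a) = s (P j a) from congrFun he a]; exact hab
    · exact hs.reflect_lt hab)
  obtain ⟨π, hπ, P, hP, hh⟩ := hT 2
  have h01 := hh 0 1 (by norm_num) (by norm_num)
  refine key T l (fun m => ?_) ?_ ?_ ?_ ?_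
  · obtain ⟨π, hπ, P, hP, -⟩ := hT m
    exact ⟨π, hπ, P, hP⟩
  · convert h01.1 using 1
    · funext a b; exact propext (hP 0 (by norm_num) a b).1.symm
    · funext a b; exact propext (hP 0 (by norm_num) a b).2.1.symm
  · intro a b ha hb
    exact ((hP 0 (by norm_num) a b).2.2 1 (by norm_num) (by norm_num)).2.1.1 (h01.2.1 a b ha hb)
  · intro a b hab
    have q := h01.2.2 rfl a b hab
    refine ⟨((hP 0 (by norm_num) a b).2.2 1 (by norm_num) (by norm_num)).1.1 q.1, fun hh => ?_,
      (hP 0 (by norm_num) a b).1.1 q.2.2⟩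
    exact absurd (((hP 0 (by norm_num) b a).2.2 1 (by norm_num) (by norm_num)).1.2 hh) q.2.1.asymm
  · intro a b hab he
    have e := ((hP 0 (by norm_num) a b).2.2 1 (by norm_num) (by norm_num)).2.2.2 he
    rcases lt_or_gt_of_ne hab with q | q
    · exact ((h01.2.2 rfl a b q).1).ne e
    · exact ((h01.2.2 rfl b a q).2.1).ne e.symm

theorem HasT.S_trans {C : Set Permu} {k : ℕ} {T : Ty k} (h : HasT C T) {a b c : Fin k}
    (h1 : T.S a b) (h2 : T.S b c) : T.S a c := by
  obtain ⟨π, -, P, hP⟩ := h 3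
  exact (hP.vlt (i := 0) (j := 2) (by norm_num) (by norm_num) (by norm_num) a c).1
    (((hP.vlt (i := 0) (j := 1) (by norm_num) (by norm_num) (by norm_num) a b).2 h1).trans
    ((hP.vlt (i := 1) (j := 2) (by norm_num) (by norm_num) (by norm_num) b c).2 h2))

theorem HasT.A_asymm {C : Set Permu} {k : ℕ} {T : Ty k} (h : HasT C T) {a b : Fin k}
    (h1 : T.A a b) : ¬ T.A b a := fun h2 => by
  obtain ⟨π, -, P, hP⟩ := h 1
  have := (hP 0 (by norm_num) a b).1.2 h1
  exact absurd ((hP 0 (by norm_num) b a).1.2 h2) this.asymm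

theorem HasT.B_asymm {C : Set Permu} {k : ℕ} {T : Ty k} (h : HasT C T) {a b : Fin k}
    (h1 : T.B a b) : ¬ T.B b a := fun h2 => by
  obtain ⟨π, -, P, hP⟩ := h 1
  have := (hP 0 (by norm_num) a b).2.1.2 h1
  exact absurd ((hP 0 (by norm_num) b a).2.1.2 h2) this.asymm

/-- A role squeezed between two roles that move together. -/
theorem HasT.squeeze {C : Set Permu} {k : ℕ} {T : Ty k} (h : HasT C T) {a b x : Fin k}
    (hS : ∀ y z, (y = a ∨ y = b) → (z = a ∨ z = b) → T.S y z) (ht : T.tog a b)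
    (h1 : T.A a x) (h2 : T.A x b) : T.tog a x ∧ T.tog b x ∧ ¬ T.E x x ∧ ¬ T.E a x ∧ ¬ T.E x a ∧
      ¬ T.E b x ∧ ¬ T.E x b := by
  obtain ⟨π, -, P, hP⟩ := h 2
  have l := fun a b => hP.lt (i := 0) (j := 1) (by norm_num) (by norm_num) (by norm_num) a b
  have e := fun a b => ((hP 0 (by norm_num) a b).2.2 1 (by norm_num) (by norm_num)).2.2
  have hne := fun a b hE => hP.ne (i := 0) (j := 1) (by norm_num) (by norm_num) (by norm_num) (a := a) (b := b) hE
  have n1 := hne a a (h.not_E (hS _ _ (by simp) (by simp)))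
  have n2 := hne a b (h.not_E (hS _ _ (by simp) (by simp)))
  have n3 := hne b a (h.not_E (hS _ _ (by simp) (by simp)))
  have n4 := hne b b (h.not_E (hS _ _ (by simp) (by simp)))
  have q1 := (hP 0 (by norm_num) a x).1.2 h1
  have q2 := (hP 0 (by norm_num) x b).1.2 h2
  have q3 := (hP 1 (by norm_num) a x).1.2 h1
  have q4 := (hP 1 (by norm_num) x b).1.2 h2
  unfold Ty.tog at *
  obtain ⟨u1, u2, u3⟩ := ht
  simp only [← l, ← e, Fin.lt_def, ne_eq, Fin.ext_iff] at *
  by_cases hr : (P 0 a : ℕ) < P 1 a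
  · simp only [hr, iff_true] at *
    omega
  · simp only [hr, iff_false] at *
    omega

/-- The forbidden gadgets. -/
def VPhi (flag : Prop) (h : ℕ) (A B : Fin 6 → Fin 6 → Prop) (l : Fin 6 → Fin h) : Prop :=
  (¬ flag ∧ l 0 < l 1) ∨ (flag ∧ ((l 0 < l 1 ∧ l 1 < l 2) ∨
    (l 0 ≠ l 4 ∧ l 1 = l 0 ∧ l 2 = l 0 ∧ l 3 = l 0 ∧ A 0 1 ∧ B 0 1 ∧ A 2 3 ∧ B 3 2) ∨
    (l 0 ≠ l 2 ∧ l 1 = l 0 ∧ l 5 = l 0 ∧ A 0 5 ∧ A 5 1 ∧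
      ((B 5 0 ∧ B 5 1 ∧ B 5 2) ∨ (B 0 5 ∧ B 1 5 ∧ B 2 5)))))

theorem vkey {C : Set Permu} {flag : Prop} {h : ℕ} (n2 : ¬ flag → ¬ LinSep 2 C)
    (n3 : flag → ¬ LinSep 3 C ∧ ¬ K1 C ∧ ¬ K3 C) (T : Ty 6) (l : Fin 6 → Fin h) (hT : HasT C T)
    (hΦ : VPhi flag h T.A T.B l) (hS : ∀ a b, a ≠ 5 → b ≠ 5 → T.S a b)
    (hl : ∀ a b, l a < l b → T.sep a b) (hE : ∀ a b, l a ≠ l b → ¬ T.E a b) : False := by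
  rcases hΦ with ⟨hf, h1⟩ | ⟨hf, h1⟩
  · exact n2 hf (hT.lin2 (a := 0) (b := 1) (fun x y hx hy => hS _ _ (by rintro rfl; simp at hx)
      (by rintro rfl; simp at hy)) (hl _ _ h1))
  obtain ⟨n3, n1, nk⟩ := n3 hf
  have l3 : ∀ a b c, a ≠ 5 → b ≠ 5 → c ≠ 5 → T.sep a b → T.sep b c → False := fun a b c ha hb hc q1 q2 =>
    n3 (hT.lin3 (fun x y hx hy => hS _ _ (by rcases hx with rfl | rfl | rfl <;> assumption)
      (by rcases hy with rfl | rfl | rfl <;> assumption)) q1 q2)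
  have tg : ∀ a b z, a ≠ 5 → b ≠ 5 → z ≠ 5 → l a = l b → l a ≠ l z → T.tog a b := by
    intro a b z ha hb hz hab haz
    rcases hT.sep_or' (a := a) (b := b) (fun x y hx hy => hT.not_E (hS _ _
      (by rcases hx with rfl | rfl <;> assumption) (by rcases hy with rfl | rfl <;> assumption))) with q | q | q
    · exact q
    · rcases lt_or_gt_of_ne haz with w | w
      · exact (l3 a b z ha hb hz q (hl _ _ (hab ▸ w))).elim
      · exact (l3 z a b hz ha hb (hl _ _ w) q).elim
    · rcases lt_or_gt_of_ne haz with w | w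
      · exact (l3 b a z hb ha hz q (hl _ _ w)).elim
      · exact (l3 z b a hz hb ha (hl _ _ (hab ▸ w)) q).elim
  have sp : ∀ a b z, l a = l b → l a ≠ l z → T.sep a z ∧ T.sep b z ∨ T.sep z a ∧ T.sep z b := by
    intro a b z hab haz
    rcases lt_or_gt_of_ne haz with w | w
    · exact Or.inl ⟨hl _ _ w, hl _ _ (hab ▸ w)⟩
    · exact Or.inr ⟨hl _ _ w, hl _ _ (hab ▸ w)⟩
  rcases h1 with h1 | ⟨h4, e1, e2, e3, a1, b1, a2, b2⟩ | ⟨h2, e1, e5, a1, a2, hb⟩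
  · exact l3 0 1 2 (by decide) (by decide) (by decide) (hl _ _ h1.1) (hl _ _ h1.2)
  · have t02 := tg 0 2 4 (by decide) (by decide) (by decide) e2.symm h4
    have t01 := tg 0 1 4 (by decide) (by decide) (by decide) e1.symm h4
    have t32 := tg 3 2 4 (by decide) (by decide) (by decide) (e3.trans e2.symm) (e3 ▸ h4)
    by_cases hr : T.R 0 0
    · have hr' : T.R 3 3 := t32.2.2.1 (t02.2.2.2 hr)
      refine n1 (hT.k1 (a := 3) (b := 2) (c := 4) (fun x y hx hy => hS _ _
        (by rcases hx with rfl | rfl | rfl <;> decide) (by rcases hy with rfl | rfl | rfl <;> decide))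
        b2 ?_ ?_ t32 (sp _ _ _ (e3.trans e2.symm) (e3 ▸ h4)))
      · simp [hr', hT.A_asymm a2]
      · simp [hr', a2]
    · refine n1 (hT.k1 (a := 0) (b := 1) (c := 4) (fun x y hx hy => hS _ _
        (by rcases hx with rfl | rfl | rfl <;> decide) (by rcases hy with rfl | rfl | rfl <;> decide))
        b1 ?_ ?_ t01 (sp _ _ _ e1.symm h4))
      · simp [hr, a1]
      · simp [hr, hT.A_asymm a1]
  · have t01 := tg 0 1 2 (by decide) (by decide) (by decide) e1.symm h2
    obtain ⟨t05, t15, x1, x2, x3, x4, x5⟩ := hT.squeeze (a := 0) (b := 1) (x := 5) (fun x y hx hy => hS _ _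
        (by rcases hx with rfl | rfl <;> decide) (by rcases hy with rfl | rfl <;> decide)) t01 a1 a2
    have S00 := hS 0 0 (by decide) (by decide)
    have S02 := hS 0 2 (by decide) (by decide)
    have S20 := hS 2 0 (by decide) (by decide)
    have S22 := hS 2 2 (by decide) (by decide)
    have S01 := hS 0 1 (by decide) (by decide)
    have S10 := hS 1 0 (by decide) (by decide)
    have S11 := hS 1 1 (by decide) (by decide)
    have S12 := hS 1 2 (by decide) (by decide)
    have S21 := hS 2 1 (by decide) (by decide)
    have k3 : (T.vsep 0 5 ∧ T.vsep 2 5 ∨ T.vsep 5 0 ∧ T.vsep 5 2) → False := by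
      intro hv
      refine nk ⟨T.comap ![0, 2, 5], hT.comap _, ?_, ?_, ?_, sp _ _ _ e5.symm h2, hv⟩
      · have y1 := hE 0 2 h2
        have y2 := hE 2 0 h2.symm
        have y3 := hE 5 2 (e5 ▸ h2)
        have y4 := hE 2 5 (e5 ▸ h2.symm)
        intro x y
        fin_cases x <;> fin_cases y <;> first | assumption | exact hT.not_E S00 | exact hT.not_E S22
      · intro x y hx hy
        fin_cases x <;> fin_cases y <;> simp at hx hy <;> assumption
      · intro x y hx hy
        obtain ⟨z1, z2, z3⟩ := t05
        fin_cases x <;> fin_cases y <;> simp at hx hy <;> first | exact Iff.rfl | assumption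
    have st := fun {a b c : Fin 6} => hT.S_trans (a := a) (b := b) (c := c)
    have k1 : T.S 5 0 → T.S 0 5 → False := by
      intro s1 s2
      have s3 := st s1 s2
      have s4 := st s1 S02
      have s5 := st S20 s2
      have s6 := st s1 S01
      have s7 := st S10 s2
      by_cases hr : T.R 0 0
      · have r1 : T.R 1 1 := t01.2.2.2 hr
        have r5 : T.R 5 5 := t05.2.2.2 hr
        rcases hb with hb | hb
        · exact n1 (hT.k1 (a := 5) (b := 0) (c := 2)
            (fun x y hx hy => by rcases hx with rfl | rfl | rfl <;> rcases hy with rfl | rfl | rfl <;> assumption)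
            hb.1 (by simp [r5, hT.A_asymm a1]) (by simp [r5, a1]) t05.symm (sp _ _ _ e5 (e5 ▸ h2)))
        · exact n1 (hT.k1 (a := 1) (b := 5) (c := 2)
            (fun x y hx hy => by rcases hx with rfl | rfl | rfl <;> rcases hy with rfl | rfl | rfl <;> assumption)
            hb.2.1 (by simp [r1, hT.A_asymm a2]) (by simp [r1, a2]) t15 (sp _ _ _ (e1.trans e5.symm) (e1 ▸ h2)))
      · have r5 : ¬ T.R 5 5 := fun w => hr (t05.2.2.1 w)
        rcases hb with hb | hb
        · exact n1 (hT.k1 (a := 5) (b := 1) (c := 2)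
            (fun x y hx hy => by rcases hx with rfl | rfl | rfl <;> rcases hy with rfl | rfl | rfl <;> assumption)
            hb.2.1 (by simp [r5, a2]) (by simp [r5, hT.A_asymm a2]) t15.symm (sp _ _ _ (e5.trans e1.symm) (e5 ▸ h2)))
        · exact n1 (hT.k1 (a := 0) (b := 5) (c := 2)
            (fun x y hx hy => by rcases hx with rfl | rfl | rfl <;> rcases hy with rfl | rfl | rfl <;> assumption)
            hb.1 (by simp [hr, a1]) (by simp [hr, hT.A_asymm a1]) t05 (sp _ _ _ e5.symm h2))
    rcases hT.vsep_or (a := 0) (b := 5) (hT.not_E S00) x2 x3 x1 with q | q | q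
    · exact k1 (q.2.1.2 S00) (q.1.2 S00)
    · refine k3 (Or.inl ⟨q, st S20 q.1, fun w => q.2.1 (st w S20), ?_⟩)
      rcases hb with hb | hb
      · exact absurd hb.1 (hT.B_asymm q.2.2)
      · exact hb.2.2
    · refine k3 (Or.inr ⟨q, st q.1 S02, fun w => q.2.1 (st S02 w), ?_⟩)
      rcases hb with hb | hb
      · exact hb.2.2
      · exact absurd hb.1 (hT.B_asymm q.2.2)


theorem mono_card {α : Type*} [LinearOrder α] [Fintype α] [DecidableEq α] (n : ℕ) :
    Nat.card {f : Fin n → α // Monotone f} ≤ (n + 1) ^ Fintype.card α := by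
  classical
  have : Nat.card (α → Fin (n + 1)) = (n + 1) ^ Fintype.card α := by simp
  rw [← this]
  have card_le : ∀ (p : Fin n → Prop) [DecidablePred p], (Finset.univ.filter p).card < n + 1 := fun p _ => by
    have := Finset.card_filter_le Finset.univ p
    simp at this; omega
  have main : ∀ f f' : Fin n → α, Monotone f → Monotone f' → ∀ v, f v < f' v →
      (Finset.univ.filter fun w => f w < f' v).card ≠ (Finset.univ.filter fun w => f' w < f' v).card := by
    intro f f' hf hf' v hv
    have h1 : (Finset.univ.filter fun w => f' w < f' v) ⊆ Finset.Iio v := fun w hw => by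
      simp at hw ⊢
      exact hf'.reflect_lt hw
    have h2 : Finset.Iic v ⊆ (Finset.univ.filter fun w => f w < f' v) := fun w hw => by
      simp at hw ⊢
      exact (hf hw).trans_lt hv
    have := Finset.card_le_card h1
    have := Finset.card_le_card h2
    simp at *
    omega
  refine Nat.card_le_card_of_injective (fun f a => ⟨(Finset.univ.filter fun w => f.1 w < a).card, card_le _⟩) ?_
  rintro ⟨f, hf⟩ ⟨f', hf'⟩ he
  have he' := fun a => congrArg Fin.val (congrFun he a)
  simp only at he'
  refine Subtype.ext (funext fun v => ?_)
  by_contra hc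
  rcases lt_or_gt_of_ne hc with q | q
  · exact main f f' hf hf' v q (he' _)
  · exact main f' f hf' hf v q (he' _).symm

/-- Slicing data for a permutation. -/
structure SlD (flag : Prop) (G : Set Permu) {h b n : ℕ} (s : Fin n → Fin h) (q : Fin n → Fin b)
    (act : Fin b → Bool) (st : Fin b → Fin h × Fin h) (lo hi : Fin b → Fin h → Fin n → Prop)
    (π : Equiv.Perm (Fin n)) : Prop where
  h1 : ∀ r, pat π (Finset.univ.filter fun i => s (π i) = r) ∈ G
  h2 : ∀ i, act (q i) = false → s (π i) = (st (q i)).1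
  h3 : ∀ i, act (q i) = true → s (π i) = (st (q i)).1 ∨ s (π i) = (st (q i)).2
  h4 : ∀ j, act j = true → ∀ r, MonoOn' π (fun i => q i = j ∧ s (π i) = r)
  h5 : ∀ j, act j = true → ∀ v, q (π.symm v) = j ↔ lo j (s v) v ∧ ¬ hi j (s v) v
  h6 : ∀ j, act j = true → flag

theorem fiber_count {flag : Prop} {G : Set Permu} (hG : IsPermClass G) {h b n : ℕ} {s : Fin n → Fin h}
    {q : Fin n → Fin b} {act : Fin b → Bool} {st : Fin b → Fin h × Fin h}
    {lo hi : Fin b → Fin h → Fin n → Prop} (X : Finset (Equiv.Perm (Fin n)))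
    (hX : ∀ π ∈ X, SlD flag G s q act st lo hi π) {K g : ℝ} (hK : 0 ≤ K) (hg : 1 ≤ g)
    (hfl : flag → 2 ≤ g) (hc : ∀ m, (pcount G m : ℝ) ≤ K * g ^ m) :
    (X.card : ℝ) ≤ 2 ^ (b * h) * K ^ h * g ^ n := by
  classical
  rcases X.eq_empty_or_nonempty with rfl | ⟨π0, hπ0⟩
  · simp; positivity
  let Av : Fin n → Prop := fun v => ∃ j, act j = true ∧ lo j (s v) v ∧ ¬ hi j (s v) v
  have hAv : ∀ π ∈ X, ∀ i, act (q i) = true ↔ Av (π i) := fun π hπ i => by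
    constructor
    · intro hi
      refine ⟨q i, hi, ((hX π hπ).h5 _ hi _).1 (by simp)⟩
    · rintro ⟨j, hj, hh⟩
      have := ((hX π hπ).h5 j hj (π i)).2 hh
      simp at this
      rw [this]; exact hj
  let N : Fin h → ℕ := fun r => (Finset.univ.filter fun v => s v = r ∧ ¬ Av v).card
  let Ap := Finset.univ.filter fun i => act (q i) = true
  have hsz : ∀ π ∈ X, ∀ r, (Finset.univ.filter fun i => s (π i) = r ∧ act (q i) = false).card = N r :=
    fun π hπ r => by
      refine Finset.card_equiv π fun i => ?_
      simp [← hAv π hπ i]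
  have hAp : Ap.card + ∑ r, N r = n := by
    have e1 : Ap.card = (Finset.univ.filter Av).card :=
      Finset.card_equiv π0 fun i => by simp [Ap, hAv π0 hπ0 i]
    have e2 : ∑ r, N r = (Finset.univ.filter fun v => ¬ Av v).card := by
      rw [Finset.card_eq_sum_card_fiberwise (f := s) (t := Finset.univ) (by simp)]
      refine Finset.sum_congr rfl fun r _ => ?_
      rw [Finset.filter_filter]
      exact congrArg Finset.card (by ext v; simp [and_comm])
    rw [e1, e2, Finset.card_filter_add_card_filter_not]; simp
  let F : Equiv.Perm (Fin n) → (Ap → Bool) × (Fin b × Fin h → Bool) × (Fin h → Permu) := fun π =>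
    (fun i => decide (s (π i) = (st (q i)).1),
     fun x => decide (∀ a c, (q a = x.1 ∧ s (π a) = x.2) → (q c = x.1 ∧ s (π c) = x.2) → a < c → π a < π c),
     fun r => pat π (Finset.univ.filter fun i => s (π i) = r ∧ act (q i) = false))
  have hcard : X.card ≤ ((Finset.univ : Finset (Ap → Bool)) ×ˢ (Finset.univ : Finset (Fin b × Fin h → Bool)) ×ˢ
      Fintype.piFinset (fun r => PS G (N r))).card := by
    refine Finset.card_le_card_of_injOn F (fun π hπ => ?_) ?_
    · simp only [Finset.coe_product, Finset.coe_univ, Set.mem_prod, Set.mem_univ, true_and, F, Finset.mem_coe,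
        Fintype.mem_piFinset, mem_PS]
      intro r
      refine ⟨hG _ _ (pat_mono _ ?_) ((hX π hπ).h1 r), ?_⟩
      · intro i; simp +contextual
      · rw [pat_card, hsz π hπ r]
    · intro π hπ π' hπ' he
      simp only [F, Prod.mk.injEq] at he
      obtain ⟨he1, he2, he3⟩ := he
      have D := hX π hπ
      have D' := hX π' hπ'
      have hstrip : ∀ i, s (π i) = s (π' i) := fun i => by
        by_cases ha : act (q i) = true
        · have := congrFun he1 ⟨i, by simp [Ap, ha]⟩
          simp only [decide_eq_decide] at this
          have a1 := D.h3 i ha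
          have a2 := D'.h3 i ha
          by_cases hh : s (π i) = (st (q i)).1
          · rw [hh, this.1 hh]
          · have hh' := fun w => hh (this.2 w)
            rw [a1.resolve_left hh, a2.resolve_left hh']
        · simp only [Bool.not_eq_true] at ha
          rw [D.h2 i ha, D'.h2 i ha]
      refine color_eq π π' (fun i => (if act (q i) = true then some (q i) else none, s (π i))) (fun v => ?_)
        fun i j hij => ?_
      · have e1 : s (π (π'.symm v)) = s v := by rw [hstrip]; simp
        have : act (q (π.symm v)) = true ∨ act (q (π'.symm v)) = true → q (π.symm v) = q (π'.symm v) := by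
          rintro (w | w)
          · exact (((D'.h5 _ w v).2 ((D.h5 _ w v).1 rfl))).symm
          · exact (((D.h5 _ w v).2 ((D'.h5 _ w v).1 rfl)))
        simp only [e1, Equiv.apply_symm_apply, Prod.mk.injEq, and_true]
        by_cases w : act (q (π.symm v)) = true
        · rw [← this (Or.inl w)]
        · by_cases w' : act (q (π'.symm v)) = true
          · rw [← this (Or.inr w')]
          · simp [w, w']
      · simp only [Prod.mk.injEq] at hij
        obtain ⟨hij, hr⟩ := hij
        by_cases w : act (q i) = true
        · by_cases w' : act (q j) = true
          · simp only [w, w', if_true, Option.some.injEq] at hij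
            have dd := congrFun he2 (q i, s (π i))
            simp only [decide_eq_decide, ← hstrip] at dd
            have m1 := D.h4 (q i) w (s (π i))
            have m2 := D'.h4 (q i) w (s (π i))
            simp only [← hstrip, MonoOn'] at m1 m2
            rcases lt_trichotomy i j with o | rfl | o
            · by_cases dn : ∀ a c, (q a = q i ∧ s (π a) = s (π i)) → (q c = q i ∧ s (π c) = s (π i)) → a < c → π a < π c
              · have u1 := dn i j ⟨rfl, rfl⟩ ⟨hij.symm, hr.symm⟩ o
                have u2 := dd.1 dn i j ⟨rfl, rfl⟩ ⟨hij.symm, hr.symm⟩ o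
                simp [u1, u2]
              · have u1 := m1.resolve_left dn i j ⟨rfl, rfl⟩ ⟨hij.symm, hr.symm⟩ o
                have u2 := m2.resolve_left (fun z => dn (dd.2 z)) i j ⟨rfl, rfl⟩ ⟨hij.symm, hr.symm⟩ o
                simp [u1.not_gt, u2.not_gt]
            · simp
            · by_cases dn : ∀ a c, (q a = q i ∧ s (π a) = s (π i)) → (q c = q i ∧ s (π c) = s (π i)) → a < c → π a < π c
              · have u1 := dn j i ⟨hij.symm, hr.symm⟩ ⟨rfl, rfl⟩ o
                have u2 := dd.1 dn j i ⟨hij.symm, hr.symm⟩ ⟨rfl, rfl⟩ o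
                simp [u1.not_gt, u2.not_gt]
              · have u1 := m1.resolve_left dn j i ⟨hij.symm, hr.symm⟩ ⟨rfl, rfl⟩ o
                have u2 := m2.resolve_left (fun z => dn (dd.2 z)) j i ⟨hij.symm, hr.symm⟩ ⟨rfl, rfl⟩ o
                simp [u1, u2]
          · simp [w, w'] at hij
        · by_cases w' : act (q j) = true
          · simp [w, w'] at hij
          · have := congrFun he3 (s (π i))
            simp only [← hstrip] at this
            exact pat_eq_iff this (by simp [w]) (by simp [w', hr])
  have hprod : ((∏ r, (PS G (N r)).card : ℕ) : ℝ) ≤ K ^ h * g ^ (∑ r, N r) := by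
    push_cast
    calc ∏ r, ((PS G (N r)).card : ℝ) ≤ ∏ r, (K * g ^ N r) :=
          Finset.prod_le_prod (fun _ _ => by positivity) fun r _ => by rw [card_PS]; exact hc _
      _ = _ := by rw [Finset.prod_mul_distrib, Finset.prod_pow_eq_pow_sum, Finset.prod_const, Finset.card_univ, Fintype.card_fin]
  have h2 : (2 : ℝ) ^ Ap.card ≤ g ^ Ap.card := by
    rcases Ap.eq_empty_or_nonempty with e | ⟨i, hi⟩
    · simp [e]
    · exact pow_le_pow_left₀ (by norm_num) (hfl ((hX π0 hπ0).h6 _ (Finset.mem_filter.1 hi).2)) _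
  have hcard' : (X.card : ℝ) ≤ 2 ^ Ap.card * (2 ^ (b * h) * ((∏ r, (PS G (N r)).card : ℕ) : ℝ)) := by
    rw [Finset.card_product, Finset.card_product] at hcard
    simp only [Finset.card_univ, Fintype.card_fun, Fintype.card_coe, Fintype.card_bool, Fintype.card_prod,
      Fintype.card_fin, Fintype.card_piFinset] at hcard
    exact_mod_cast hcard
  generalize (∏ r, (PS G (N r)).card : ℕ) = M at hprod hcard'
  have hgn : g ^ n = g ^ (Ap.card + ∑ r, N r) := by rw [hAp]
  rw [hgn]
  generalize ∑ r, N r = t at hprod ⊢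
  generalize Ap.card = u at hcard' h2 ⊢
  calc (X.card : ℝ) ≤ _ := hcard'
    _ ≤ g ^ u * (2 ^ (b * h) * (K ^ h * g ^ t)) := by
        refine mul_le_mul h2 (mul_le_mul_of_nonneg_left hprod (by positivity)) (by positivity) (by positivity)
    _ = 2 ^ (b * h) * K ^ h * g ^ (u + t) := by rw [pow_add]; ring

/-- The slicing skeleta. -/
abbrev Sk (n h b : ℕ) : Type := {s : Fin n → Fin h // Monotone s} × {q : Fin n → Fin b // Monotone q} ×
  (Fin b → Bool) × (Fin b → Fin h × Fin h) × (Fin b → Fin h → {p : Fin n → Prop // Monotone p}) ×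
  (Fin b → Fin h → {p : Fin n → Prop // Monotone p})

/-- The permutation has the given skeleton. -/
def SkD (flag : Prop) (G : Set Permu) {n h b : ℕ} (w : Sk n h b) (π : Equiv.Perm (Fin n)) : Prop :=
  SlD flag G w.1.1 w.2.1.1 w.2.2.1 w.2.2.2.1 (fun j r => (w.2.2.2.2.1 j r).1)
    (fun j r => (w.2.2.2.2.2 j r).1) π

theorem Sk_card (n h b : ℕ) : Nat.card (Sk n h b) ≤ (2 ^ b * (h * h) ^ b) * (n + 1) ^ (h + b + 2 * (2 * h * b)) := by
  classical
  have e1 := mono_card (α := Fin h) n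
  have e2 := mono_card (α := Fin b) n
  have e3 := mono_card (α := Prop) n
  rw [Fintype.card_fin] at e1 e2
  rw [show Fintype.card Prop = 2 by simp] at e3
  simp only [Nat.card_prod, Nat.card_fun, Nat.card_eq_fintype_card (α := Fin _), Fintype.card_fin,
    Nat.card_eq_fintype_card (α := Bool), Fintype.card_bool]
  calc _ ≤ (n + 1) ^ h * ((n + 1) ^ b * (2 ^ b * ((h * h) ^ b * ((((n + 1) ^ 2) ^ h) ^ b * (((n + 1) ^ 2) ^ h) ^ b)))) := by
        gcongr
    _ = _ := by
      simp only [← pow_mul]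
      ring

theorem sk_count {flag : Prop} {C G : Set Permu} (hG : IsPermClass G) {h b : ℕ}
    (hs : ∀ π ∈ C, ∃ w : Sk π.1 h b, SkD flag G w π.2) {K g : ℝ} (hK : 0 ≤ K) (hg : 1 ≤ g)
    (hfl : flag → 2 ≤ g) (hc : ∀ m, (pcount G m : ℝ) ≤ K * g ^ m) :
    ∃ K' : ℝ, ∃ d : ℕ, 0 ≤ K' ∧ ∀ n, (pcount C n : ℝ) ≤ K' * (n + 1) ^ d * g ^ n := by
  classical
  refine ⟨(2 ^ b * (h * h) ^ b) * (2 ^ (b * h) * K ^ h), h + b + 2 * (2 * h * b), by positivity, fun n => ?_⟩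
  have : ∀ p : {p // p ∈ PC C n}, ∃ w : Sk n h b, SkD flag G w p.1 := fun p => hs ⟨n, p.1⟩ (mem_PC.1 p.2)
  choose f hf using this
  haveI : Fintype (Sk n h b) := Fintype.ofFinite _
  rw [pcount_eq, ← Finset.card_attach,
    Finset.card_eq_sum_card_fiberwise (f := f) (t := Finset.univ) (by simp)]
  push_cast
  have hcard : (Fintype.card (Sk n h b) : ℝ) ≤ (2 ^ b * (h * h) ^ b) * (n + 1) ^ (h + b + 2 * (2 * h * b)) := by
    have := Sk_card n h b
    rw [Nat.card_eq_fintype_card] at this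
    exact_mod_cast this
  calc _ ≤ ∑ w : Sk n h b, 2 ^ (b * h) * K ^ h * g ^ n := by
        refine Finset.sum_le_sum fun w _ => ?_
        have := fiber_count hG (s := w.1.1) (q := w.2.1.1) (act := w.2.2.1) (st := w.2.2.2.1)
          (lo := fun j r => (w.2.2.2.2.1 j r).1) (hi := fun j r => (w.2.2.2.2.2 j r).1)
          (((PC C n).attach.filter fun p => f p = w).map ⟨Subtype.val, Subtype.val_injective⟩) (by
            intro π hπ
            rw [Finset.mem_map] at hπ
            obtain ⟨p, hp, rfl⟩ := hπ
            rw [Finset.mem_filter] at hp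
            have := hf p
            rw [hp.2] at this
            exact this) hK hg hfl hc
        rwa [Finset.card_map] at this
    _ = Fintype.card (Sk n h b) * (2 ^ (b * h) * K ^ h * g ^ n) := by
        rw [Finset.sum_const, Finset.card_univ, nsmul_eq_mul]
    _ ≤ (2 ^ b * (h * h) ^ b) * (n + 1) ^ (h + b + 2 * (2 * h * b)) * (2 ^ (b * h) * K ^ h * g ^ n) := by
        gcongr
    _ = _ := by ring


theorem sk_exists {C G : Set Permu} {flag : Prop} {B : ℕ} (hC : IsPermClass C)
    (hG1 : ∀ π : Permu, π.1 ≤ 1 → π ∈ G) (hB : ∀ π ∉ G, ∃ β, PLe β π ∧ β ∉ G ∧ β.1 ≤ B)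
    (n2 : ¬ flag → ¬ LinSep 2 C ∧ ¬ LinSep 2 (cinv C))
    (n3 : flag → (¬ LinSep 3 C ∧ ¬ K1 C) ∧ ¬ LinSep 3 (cinv C) ∧ ¬ K1 (cinv C) ∧ ¬ K3 (cinv C))
    (hI : ∀ β, InfSum C β ∨ InfSum (crev C) (prev β) → β ∈ G) (hJ : flag → Jc ⊆ G) :
    ∃ h b, ∀ π ∈ C, ∃ w : Sk π.1 h b, SkD flag G w π.2 := by
  classical
  obtain ⟨h, h0, hh⟩ := hstep hG1 hB (fun β T hβ hT hTT => by
    by_cases hf : flag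
    · rcases key_flag hT hTT (n3 hf).1.1 (n3 hf).1.2 with q | q
      · exact hβ (hJ hf q)
      · exact hβ (hI β q)
    · exact hβ (hI β (key_noflag hT hTT (n2 hf).1)))
  obtain ⟨m, hm⟩ := vstep (C := cinv C) (h := h) (· ≠ 5) (VPhi flag h)
    (vkey (fun hf => (n2 hf).2) (fun hf => (n3 hf).2))
  refine ⟨h, 2 * m + 1, fun π hπ => ?_⟩
  obtain ⟨s, s1, s2⟩ := hh π hπ
  have hVB := hm (pinv π) (by simpa [cinv, pinv_pinv] using hπ) s s1
  obtain ⟨t, t1, t2, t3⟩ := segmentation (Bad := VBad (· ≠ 5) (VPhi flag h) (pinv π) s) (fun c d hcd => by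
    rintro ⟨P, hP, hΦ⟩
    have e : ∀ a, a ≠ 5 → P a = P 0 := fun a ha => by
      have a1 := hP a ha
      have a2 := hP 0 (by decide)
      exact (pinv π).2.injective (Fin.ext (by omega))
    unfold VPhi at hΦ
    beta_reduce at hΦ
    rw [e 1 (by decide), e 2 (by decide)] at hΦ
    simp at hΦ) π.1 m 0 hVB
  set q : Fin π.1 → Fin (2 * m + 1) := fun i => ⟨t i, t2 i⟩ with hq
  have q1 : Monotone q := fun i j hij => t1 hij
  have cd : ∀ j : Fin (2 * m + 1), ∃ c d : ℕ, (∀ i, q i = j ↔ c ≤ (i : ℕ) ∧ (i : ℕ) < d) ∧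
      ∀ P : Fin 6 → Fin π.1, (∀ a, a ≠ 5 → q (P a) = j) →
      ¬ VPhi flag h (fun a b => π.2 (P a) < π.2 (P b)) (fun a b => P a < P b) (fun a => s (π.2 (P a))) := by
    intro j
    obtain ⟨c, d, -, w1, w2⟩ := t3 j
    have w3 : ∀ i, q i = j ↔ c ≤ (i : ℕ) ∧ (i : ℕ) < d := fun i => by
      rw [← w1 i (by omega) i.2, Fin.ext_iff]
    refine ⟨c, d, w3, fun P hP hΦ => w2 ⟨fun a => π.2 (P a), fun a ha => ?_, ?_⟩⟩
    · have := (w3 _).1 (hP a ha)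
      show c ≤ ((π.2.symm (π.2 (P a)) : Fin π.1) : ℕ) ∧ ((π.2.symm (π.2 (P a)) : Fin π.1) : ℕ) < d
      rwa [Equiv.symm_apply_apply]
    · show VPhi flag h (fun a b => π.2 (P a) < π.2 (P b))
        (fun a b => π.2.symm (π.2 (P a)) < π.2.symm (π.2 (P b))) (fun a => s (π.2 (P a)))
      simp only [Equiv.symm_apply_apply]
      exact hΦ
  clear_value q
  let act : Fin (2 * m + 1) → Bool := fun j => decide (∃ i i', q i = j ∧ q i' = j ∧ s (π.2 i) ≠ s (π.2 i'))
  have hactF : ∀ j, act j = true → flag := by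
    intro j hj
    simp only [act, decide_eq_true_eq] at hj
    obtain ⟨i, i', e1, e2, e3⟩ := hj
    obtain ⟨c, d, w1, w2⟩ := cd j
    by_contra hf
    rcases lt_or_gt_of_ne e3 with w | w
    · exact w2 ![i, i', i, i, i, i] (by intro a ha; fin_cases a <;> simp [e1, e2]) (Or.inl ⟨hf, w⟩)
    · exact w2 ![i', i, i, i, i, i] (by intro a ha; fin_cases a <;> simp [e1, e2]) (Or.inl ⟨hf, w⟩)
  have hst : ∀ j, ∃ z : Fin h × Fin h, (act j = false → ∀ i, q i = j → s (π.2 i) = z.1) ∧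
      (act j = true → ∀ i, q i = j → s (π.2 i) = z.1 ∨ s (π.2 i) = z.2) := by
    intro j
    by_cases hj : act j = true
    · have hf := hactF j hj
      have hj' := hj
      simp only [act, decide_eq_true_eq] at hj'
      obtain ⟨i, i', e1, e2, e3⟩ := hj'
      obtain ⟨c, d, w1, w2⟩ := cd j
      refine ⟨(s (π.2 i), s (π.2 i')), by simp [hj], fun _ k hk => ?_⟩
      by_contra hc
      push Not at hc
      have three : ∀ a b c, q a = j → q b = j → q c = j → s (π.2 a) < s (π.2 b) → s (π.2 b) < s (π.2 c) → False :=
        fun a b c ha hb hc h1 h2 => w2 ![a, b, c, a, a, a] (by intro x hx; fin_cases x <;> simp [ha, hb, hc])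
          (Or.inr ⟨hf, Or.inl ⟨h1, h2⟩⟩)
      rcases lt_or_gt_of_ne e3 with x | x <;> rcases lt_or_gt_of_ne hc.1 with y | y <;>
        rcases lt_or_gt_of_ne hc.2 with z | z
      · exact three k i i' hk e1 e2 y x
      · exact absurd (z.trans y) x.asymm
      · exact three i k i' e1 hk e2 y z
      · exact three i i' k e1 e2 hk x z
      · exact three k i' i hk e2 e1 z x
      · exact three i' k i e2 hk e1 z y
      · exact absurd (y.trans z) x.asymm
      · exact three i' i k e2 e1 hk x y
    · by_cases hn : ∃ i, q i = j
      · obtain ⟨i, hi⟩ := hn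
        refine ⟨(s (π.2 i), s (π.2 i)), fun _ k hk => ?_, fun w => absurd w hj⟩
        simp only [act, decide_eq_true_eq] at hj
        push Not at hj
        exact hj k i hk hi
      · refine ⟨(⟨0, h0⟩, ⟨0, h0⟩), fun _ k hk => absurd ⟨k, hk⟩ hn, fun w => absurd w hj⟩
  choose st st1 st2 using hst
  have hz : ∀ j, act j = true → ∀ r, ∃ z, q z = j ∧ r ≠ s (π.2 z) := by
    intro j hj r
    simp only [act, decide_eq_true_eq] at hj
    obtain ⟨i, i', e1, e2, e3⟩ := hj
    by_cases hr : r = s (π.2 i)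
    · exact ⟨i', e2, hr ▸ e3⟩
    · exact ⟨i, e1, hr⟩
  refine ⟨(⟨s, s1⟩, ⟨q, q1⟩, act, st,
    fun j r => ⟨fun v => ∃ v' ≤ v, q (π.2.symm v') = j ∧ s v' = r, fun v w hvw ⟨v', a, b⟩ => ⟨v', a.trans hvw, b⟩⟩,
    fun j r => ⟨fun v => ∀ v', q (π.2.symm v') = j → s v' = r → v' < v,
      fun v w hvw hh v' a b => (hh v' a b).trans_le hvw⟩), ?_⟩
  refine ⟨s2, fun i hi => st1 _ hi _ rfl, fun i hi => st2 _ hi _ rfl, fun j hj r => ?_, fun j hj v => ?_, hactF⟩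
  · obtain ⟨c, d, w1, w2⟩ := cd j
    obtain ⟨z, z1, z2⟩ := hz j hj r
    by_contra hc
    unfold MonoOn' at hc
    push Not at hc
    obtain ⟨⟨a, b, ⟨ha, ha'⟩, ⟨hb, hb'⟩, hab, hd⟩, ⟨a2, b2, ⟨ha2, ha2'⟩, ⟨hb2, hb2'⟩, hab2, hd2⟩⟩ := hc
    have ne1 := hd.lt_of_ne fun e => hab.ne (π.2.injective e).symm
    have ne2 := hd2.lt_of_ne fun e => hab2.ne (π.2.injective e)
    refine w2 ![a2, b2, b, a, z, a] (by
        intro x hx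
        fin_cases x
        exacts [ha2, hb2, hb, ha, z1, ha])
      (Or.inr ⟨hactF j hj, Or.inr (Or.inl ⟨?_, ?_, ?_, ?_, ?_, ?_, ?_, ?_⟩)⟩)
    · show s (π.2 a2) ≠ s (π.2 z)
      rw [show s (π.2 a2) = r from ha2']; exact z2
    · exact hb2'.trans ha2'.symm
    · exact hb'.trans ha2'.symm
    · exact ha'.trans ha2'.symm
    · exact ne2
    · exact hab2
    · exact ne1
    · exact hab
  · obtain ⟨c, d, w1, w2⟩ := cd j
    obtain ⟨z, z1, z2⟩ := hz j hj (s v)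
    constructor
    · intro hv
      exact ⟨⟨v, le_rfl, hv, rfl⟩, fun hh => lt_irrefl _ (hh v hv rfl)⟩
    · rintro ⟨⟨v', g1, g2, g3⟩, hn⟩
      simp only at hn
      push Not at hn
      obtain ⟨v'', f1, f2, f3⟩ := hn
      rcases eq_or_lt_of_le g1 with rfl | g1
      · exact g2
      rcases eq_or_lt_of_le f3 with rfl | f3
      · exact f1
      by_contra hv
      refine w2 ![π.2.symm v', π.2.symm v'', z, z, z, π.2.symm v] (by
          intro x hx
          fin_cases x
          exacts [g2, f1, z1, z1, z1, absurd rfl hx])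
        (Or.inr ⟨hactF j hj, Or.inr (Or.inr ⟨?_, ?_, ?_, ?_, ?_, ?_⟩)⟩)
      · show s (π.2 (π.2.symm v')) ≠ s (π.2 z)
        simpa [g3] using z2
      · show s (π.2 (π.2.symm v'')) = s (π.2 (π.2.symm v'))
        simp [f2, g3]
      · show s (π.2 (π.2.symm v)) = s (π.2 (π.2.symm v'))
        simp [g3]
      · show π.2 (π.2.symm v') < π.2 (π.2.symm v)
        simpa using g1
      · show π.2 (π.2.symm v) < π.2 (π.2.symm v'')
        simpa using f3
      · show (π.2.symm v < π.2.symm v' ∧ π.2.symm v < π.2.symm v'' ∧ π.2.symm v < z) ∨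
          (π.2.symm v' < π.2.symm v ∧ π.2.symm v'' < π.2.symm v ∧ z < π.2.symm v)
        rw [w1] at hv g2 f1 z1
        simp only [Fin.lt_def]
        omega

theorem slicing {C G : Set Permu} {flag : Prop} {B : ℕ} (hC : IsPermClass C) (hG : IsPermClass G)
    (hG1 : ∀ π : Permu, π.1 ≤ 1 → π ∈ G) (hB : ∀ π ∉ G, ∃ β, PLe β π ∧ β ∉ G ∧ β.1 ≤ B)
    (n2 : ¬ flag → ¬ LinSep 2 C ∧ ¬ LinSep 2 (cinv C))
    (n3 : flag → (¬ LinSep 3 C ∧ ¬ K1 C) ∧ ¬ LinSep 3 (cinv C) ∧ ¬ K1 (cinv C) ∧ ¬ K3 (cinv C))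
    (hI : ∀ β, InfSum C β ∨ InfSum (crev C) (prev β) → β ∈ G) (hJ : flag → Jc ⊆ G)
    {K g : ℝ} (hK : 0 ≤ K) (hg : 1 ≤ g)
    (hfl : flag → 2 ≤ g) (hc : ∀ m, (pcount G m : ℝ) ≤ K * g ^ m) :
    ∃ K' : ℝ, ∃ d : ℕ, 0 ≤ K' ∧ ∀ n, (pcount C n : ℝ) ≤ K' * (n + 1) ^ d * g ^ n := by
  obtain ⟨h, b, hw⟩ := sk_exists hC hG1 hB n2 n3 hI hJ
  exact sk_count hG hw hK hg hfl hc


theorem pat_emb {n : ℕ} (π : Equiv.Perm (Fin n)) (S : Finset (Fin n)) :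
    ∃ Q : Fin (pat π S).1 → Fin n, Emb (pat π S) ⟨n, π⟩ Q ∧ ∀ i ∈ S, ∃ a, Q a = i := by
  obtain ⟨e, h1, h2⟩ := pat_std π S
  exact ⟨fun a => (e a).1, fun a b => ⟨(h1 a b).symm, (h2 a b).symm⟩, fun i hi => ⟨e.symm ⟨i, hi⟩, by simp⟩⟩

theorem Jc_class : IsPermClass Jc := by
  rintro σ π ⟨f, hf, h⟩ ⟨p, hp, h1, h2⟩
  refine ⟨fun a => p (f a), fun a b ha hb => hf.lt_iff_lt.1 (hp _ _ ha hb), ?_, ?_⟩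
  · rcases h1 with h1 | h1
    · exact Or.inl fun a b ha hb hab => (h _ _).2 (h1 _ _ ha hb (hf hab))
    · exact Or.inr fun a b ha hb hab => (h _ _).2 (h1 _ _ ha hb (hf hab))
  · rcases h2 with h1 | h1
    · exact Or.inl fun a b ha hb hab => (h _ _).2 (h1 _ _ ha hb (hf hab))
    · exact Or.inr fun a b ha hb hab => (h _ _).2 (h1 _ _ ha hb (hf hab))

theorem not_mono {n : ℕ} (π : Equiv.Perm (Fin n)) {p : Fin n → Prop} (h : ¬ MonoOn' π p) :
    ∃ a b c d, p a ∧ p b ∧ p c ∧ p d ∧ a < b ∧ π b < π a ∧ c < d ∧ π c < π d := by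
  unfold MonoOn' at h
  push Not at h
  obtain ⟨⟨a, b, ha, hb, hab, h1⟩, ⟨c, d, hc, hd, hcd, h2⟩⟩ := h
  exact ⟨a, b, c, d, ha, hb, hc, hd, hab, lt_of_le_of_ne h1 (by simp [hab.ne']), hcd,
    lt_of_le_of_ne h2 (by simp [hcd.ne])⟩

theorem mono_absurd {n : ℕ} {π : Equiv.Perm (Fin n)} {p : Fin n → Prop} (h : MonoOn' π p) {a b c d : Fin n}
    (ha : p a) (hb : p b) (hc : p c) (hd : p d) (h1 : a < b) (h2 : π b < π a) (h3 : c < d)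
    (h4 : π c < π d) : False := by
  rcases h with h | h
  · exact (h _ _ ha hb h1).asymm h2
  · exact (h _ _ hc hd h3).asymm h4

theorem card8 {α : Type*} [DecidableEq α] (a b c d a' b' c' d' : α) :
    ({a, b, c, d, a', b', c', d'} : Finset α).card ≤ 8 := by
  repeat' refine (Finset.card_insert_le _ _).trans (Nat.succ_le_succ ?_)
  simp

theorem Jc_basis (π : Permu) (h : π ∉ Jc) : ∃ β, PLe β π ∧ β ∉ Jc ∧ β.1 ≤ 8 := by
  classical
  obtain ⟨n, π⟩ := π
  have ex : ∃ t, ¬ MonoOn' π (fun i : Fin n => i.1 < t) := ⟨n, fun hm => h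
    ⟨fun _ => True, by simp, by simpa using hm, Or.inl (by simp)⟩⟩
  obtain ⟨t, ht⟩ : ∃ t, Nat.find ex = t + 1 := by
    refine Nat.exists_eq_succ_of_ne_zero fun h0 => ?_
    have := Nat.find_spec ex
    rw [h0] at this
    exact this (Or.inl (by simp))
  have h1 : ¬ MonoOn' π (fun i : Fin n => i.1 < t + 1) := ht ▸ Nat.find_spec ex
  have h2 : MonoOn' π (fun i : Fin n => i.1 < t) := not_not.1 (Nat.find_min ex (by omega))
  have h3 : ¬ MonoOn' π (fun i : Fin n => ¬ i.1 < t) := fun hm => h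
    ⟨_, fun a b ha hb => Fin.lt_def.2 (by omega), h2, hm⟩
  obtain ⟨a, b, c, d, ha, hb, hc, hd, e1, e2, e3, e4⟩ := not_mono π h1
  obtain ⟨a', b', c', d', ha', hb', hc', hd', e1', e2', e3', e4'⟩ := not_mono π h3
  obtain ⟨S, hS0, hS8⟩ : ∃ S : Finset (Fin n), S = {a, b, c, d, a', b', c', d'} ∧ S.card ≤ 8 :=
    ⟨_, rfl, card8 _ _ _ _ _ _ _ _⟩
  have hSa : a ∈ S ∧ b ∈ S ∧ c ∈ S ∧ d ∈ S ∧ a' ∈ S ∧ b' ∈ S ∧ c' ∈ S ∧ d' ∈ S := by simp [hS0]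
  clear hS0
  obtain ⟨s1, s2, s3, s4, s5, s6, s7, s8⟩ := hSa
  refine ⟨pat π S, pat_ple π S, ?_, ?_⟩
  · rintro ⟨p, hp, m1, m2⟩
    obtain ⟨Q, hQ, hS⟩ := pat_emb π S
    obtain ⟨A, rfl⟩ := hS a s1
    obtain ⟨B, rfl⟩ := hS b s2
    obtain ⟨C, rfl⟩ := hS c s3
    obtain ⟨D, rfl⟩ := hS d s4
    obtain ⟨A', rfl⟩ := hS a' s5
    obtain ⟨B', rfl⟩ := hS b' s6
    obtain ⟨C', rfl⟩ := hS c' s7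
    obtain ⟨D', rfl⟩ := hS d' s8
    by_cases hal : p A ∧ p B ∧ p C ∧ p D
    · exact mono_absurd m1 hal.1 hal.2.1 hal.2.2.1 hal.2.2.2 ((hQ _ _).1.1 e1) ((hQ _ _).2.1 e2)
        ((hQ _ _).1.1 e3) ((hQ _ _).2.1 e4)
    · obtain ⟨x, hx, hx'⟩ : ∃ x, ¬ p x ∧ (Q x).1 < t + 1 := by
        by_contra hcon
        push Not at hcon
        refine hal ⟨?_, ?_, ?_, ?_⟩ <;> by_contra hz
        · have := hcon _ hz; omega
        · have := hcon _ hz; omega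
        · have := hcon _ hz; omega
        · have := hcon _ hz; omega
      have key : ∀ y, ¬ (Q y).1 < t → ¬ p y := fun y hy hpy => by
        have := (hQ _ _).1.2 (hp _ _ hpy hx)
        rw [Fin.lt_def] at this
        omega
      exact mono_absurd m2 (key _ ha') (key _ hb') (key _ hc') (key _ hd') ((hQ _ _).1.1 e1')
        ((hQ _ _).2.1 e2') ((hQ _ _).1.1 e3') ((hQ _ _).2.1 e4')
  · rw [pat_card]
    exact hS8

theorem Jc_count (n : ℕ) : (pcount Jc n : ℝ) ≤ 4 * (n + 1) ^ 2 * 2 ^ n := by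
  classical
  have h0 : ∀ π : PC Jc n, ∃ p : Fin n → Prop, (∀ a b, p a → ¬ p b → a < b) ∧
    MonoOn' π.1 p ∧ MonoOn' π.1 (fun a => ¬ p a) := fun π => mem_PC.1 π.2
  choose p hp1 hp2 hp3 using h0
  let F : PC Jc n → {f : Fin n → Prop // Monotone f} × (Fin n → Prop) × Prop × Prop := fun π =>
    (⟨fun i => ¬ p π i, fun i j hij hi hj => by
      rcases hij.eq_or_lt with rfl | hl
      · exact hi hj
      · exact (hp1 π _ _ hj hi).asymm hl⟩, fun v => p π (π.1.symm v),
      (∀ a b, p π a → p π b → a < b → π.1 a < π.1 b), (∀ a b, ¬ p π a → ¬ p π b → a < b → π.1 a < π.1 b))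
  have inj : Function.Injective F := by
    intro π π' h
    simp only [F, Prod.mk.injEq] at h
    obtain ⟨q1, q2, q3, q4⟩ := h
    have q1' : p π = p π' := by
      funext i
      have := congrFun (congrArg Subtype.val q1) i
      exact propext (not_iff_not.1 (iff_of_eq this))
    have aux : ∀ (σ σ' : Equiv.Perm (Fin n)) (q : Fin n → Prop), MonoOn' σ q → MonoOn' σ' q →
        ((∀ a b, q a → q b → a < b → σ a < σ b) = (∀ a b, q a → q b → a < b → σ' a < σ' b)) →
        ∀ i j, q i → q j → i < j → (σ i < σ j ↔ σ' i < σ' j) := by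
      intro σ σ' q h h' e i j hi hj hij
      by_cases hh : ∀ a b, q a → q b → a < b → σ a < σ b
      · exact iff_of_true (hh _ _ hi hj hij) ((e ▸ hh : ∀ a b, q a → q b → a < b → σ' a < σ' b) _ _ hi hj hij)
      · have h1 := h.resolve_left hh
        have h2 := h'.resolve_left (e ▸ hh)
        exact iff_of_false (h1 _ _ hi hj hij).asymm (h2 _ _ hi hj hij).asymm
    have aux2 : ∀ (σ σ' : Equiv.Perm (Fin n)) (q : Fin n → Prop), MonoOn' σ q → MonoOn' σ' q →
        ((∀ a b, q a → q b → a < b → σ a < σ b) = (∀ a b, q a → q b → a < b → σ' a < σ' b)) →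
        ∀ i j, q i → q j → (σ i < σ j ↔ σ' i < σ' j) := by
      intro σ σ' q h h' e i j hi hj
      rcases lt_trichotomy i j with hl | rfl | hl
      · exact aux σ σ' q h h' e i j hi hj hl
      · simp
      · have := aux σ σ' q h h' e j i hj hi hl
        rw [← not_iff_not, not_lt, not_lt, le_iff_lt_or_eq, le_iff_lt_or_eq, this]
        simp [hl.ne]
    refine Subtype.ext (color_eq π.1 π'.1 (p π) (fun v => ?_) fun i j hij => ?_)
    · rw [congrFun q2 v, q1']
    · by_cases hi : p π i
      · exact aux2 _ _ (p π) (hp2 π) (q1' ▸ hp2 π') (by rw [q3, q1']) i j hi (hij ▸ hi)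
      · exact aux2 _ _ (fun a => ¬ p π a) (hp3 π) (q1' ▸ hp3 π') (by rw [q4, q1']) i j hi (hij ▸ hi)
  have h1 := Nat.card_le_card_of_injective F inj
  have h2 := mono_card (α := Prop) n
  simp only [Nat.card_prod, Nat.card_fun, Nat.card_eq_fintype_card (α := Prop), Fintype.card_prop, Nat.card_eq_fintype_card (α := Fin n), Fintype.card_fin] at h1
  rw [Nat.card_eq_fintype_card, Fintype.card_coe, ← pcount_eq] at h1
  rw [Fintype.card_prop] at h2
  have h3 : pcount Jc n ≤ (n + 1) ^ 2 * (2 ^ n * (2 * 2)) := h1.trans (Nat.mul_le_mul_right _ h2)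
  have h4 : (pcount Jc n : ℝ) ≤ (n + 1) ^ 2 * (2 ^ n * (2 * 2)) := by exact_mod_cast h3
  linarith

/-- Patterns of infinite sums of copies of `β`. -/
def OSum (β : Permu) : Set Permu :=
  {σ | Rz σ (fun z : ℕ × Fin β.1 => toLex (z.1, z.2)) (fun z => toLex (z.1, β.2 z.2))}

theorem OSum_class (β : Permu) : IsPermClass (OSum β) := by
  intro σ π h h'
  rw [OSum, Set.mem_setOf_eq] at *
  exact PLe.rz h h'

theorem sub_OSum (β : Permu) : SubCl β ⊆ OSum β := by
  rintro σ ⟨f, hf, h⟩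
  exact ⟨fun i => (0, f i), fun i j => by simp [Prod.Lex.toLex_lt_toLex, hf.lt_iff_lt], fun i j => by
    simp [Prod.Lex.toLex_lt_toLex, h]⟩

theorem OSum_sub {C : Set Permu} (hC : IsPermClass C) {β : Permu} (h : InfSum C β) : OSum β ⊆ C := by
  rintro σ ⟨f, h1, h2⟩
  obtain ⟨m, hm⟩ : ∃ m, ∀ i, (f i).1 < m :=
    ⟨Finset.univ.sup (fun i => (f i).1) + 1, fun i => Nat.lt_succ_of_le (Finset.le_sup (f := fun i => (f i).1) (Finset.mem_univ i))⟩
  obtain ⟨π, hπ, P, hP⟩ := h m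
  have key : ∀ z w : ℕ × Fin β.1, z.1 < m → w.1 < m →
      (toLex (z.1, z.2) < toLex (w.1, w.2) ↔ P z.1 z.2 < P w.1 w.2) ∧
      (toLex (z.1, β.2 z.2) < toLex (w.1, β.2 w.2) ↔ π.2 (P z.1 z.2) < π.2 (P w.1 w.2)) := by
    rintro ⟨i, a⟩ ⟨j, b⟩ hi hj
    simp only [Prod.Lex.toLex_lt_toLex]
    rcases lt_trichotomy i j with hl | rfl | hl
    · have := (hP i hi).2 j hj hl a b
      simp [hl, this]
    · have := (hP i hi).1 a b
      simp [this]
    · have := (hP j hj).2 i hi hl b a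
      simp [hl.not_gt, hl.ne', this.1.le, this.2.le]
  refine hC σ π (PLe_iff.2 ⟨fun i => P (f i).1 (f i).2, fun i j => ?_, fun i j => ?_⟩) hπ
  · rw [h1, (key _ _ (hm i) (hm j)).1]
  · rw [h2, (key _ _ (hm i) (hm j)).2]

theorem OSum_sum (β : Permu) : SumClosed (OSum β) := by
  rintro ⟨s, σ⟩ ⟨t, τ⟩ ⟨f, h1, h2⟩ ⟨g, h3, h4⟩
  obtain ⟨m, hm⟩ : ∃ m, ∀ i, (f i).1 < m :=
    ⟨Finset.univ.sup (fun i => (f i).1) + 1, fun i => Nat.lt_succ_of_le (Finset.le_sup (f := fun i => (f i).1) (Finset.mem_univ i))⟩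
  change Fin s → _ at f
  change Fin t → _ at g
  let F : Fin (s + t) → ℕ × Fin β.1 := Fin.append f (fun j => (m + (g j).1, (g j).2))
  have hl : ∀ i, F (Fin.castAdd t i) = f i := Fin.append_left _ _
  have hr : ∀ i, F (Fin.natAdd s i) = (m + (g i).1, (g i).2) := Fin.append_right _ _
  have vl : ∀ i, permSum σ τ (Fin.castAdd t i) = Fin.castAdd t (σ i) := fun i => by simp [permSum]
  have vr : ∀ i, permSum σ τ (Fin.natAdd s i) = Fin.natAdd s (τ i) := fun i => by simp [permSum]
  clear_value F
  have key : ∀ i j : Fin (s + t), (i < j ↔ toLex ((F i).1, (F i).2) < toLex ((F j).1, (F j).2)) ∧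
    (permSum σ τ i < permSum σ τ j ↔ toLex ((F i).1, β.2 (F i).2) < toLex ((F j).1, β.2 (F j).2)) := by
    intro i j
    simp only [Prod.Lex.toLex_lt_toLex] at h1 h2 h3 h4 ⊢
    refine Fin.addCases (fun i => ?_) (fun i => ?_) i <;> refine Fin.addCases (fun j => ?_) (fun j => ?_) j
    · simp only [hl, vl]
      exact ⟨h1 i j, h2 i j⟩
    · simp only [hl, hr, vl, vr]
      have := hm i
      simp only [Fin.lt_def, Fin.val_castAdd, Fin.val_natAdd]
      omega
    · simp only [hl, hr, vl, vr]
      have := hm j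
      simp only [Fin.lt_def, Fin.val_castAdd, Fin.val_natAdd]
      omega
    · simp only [hr, vr]
      have q1 := h3 i j
      have q2 := h4 i j
      simp only [Fin.lt_def, Fin.val_natAdd, Nat.add_lt_add_iff_left, Nat.add_left_cancel_iff] at q1 q2 ⊢
      exact ⟨q1, q2⟩
  exact ⟨F, fun i j => (key i j).1, fun i j => (key i j).2⟩


/-- Sublists of bounded length. -/
def subs : List ℕ → ℕ → List (List ℕ)
  | [], _ => [[]]
  | a :: l, k => (match k with
      | 0 => []
      | k + 1 => (subs l k).map (a :: ·)) ++ subs l k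

theorem subs_sub : ∀ (l : List ℕ) (k : ℕ) (w : List ℕ), w ∈ subs l k → w.Sublist l ∧ w.length ≤ k
  | [], k, w, h => by simp [subs] at h; simp [h]
  | a :: l, 0, w, h => by
    simp [subs] at h
    have := subs_sub l 0 w h
    exact ⟨this.1.cons _, this.2⟩
  | a :: l, k + 1, w, h => by
    simp only [subs, List.mem_append, List.mem_map] at h
    rcases h with ⟨v, hv, rfl⟩ | h
    · have := subs_sub l k v hv
      exact ⟨this.1.cons_cons _, by simpa using this.2⟩
    · have := subs_sub l (k + 1) w h
      exact ⟨this.1.cons _, this.2⟩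

/-- Rank pattern of a list. -/
def code (y : ℕ → ℕ) (w : List ℕ) : List ℕ :=
  w.map fun a => (w.filter fun b => Nat.blt (y b) (y a)).length

/-- Boolean sum indecomposability. -/
def sib (c : List ℕ) : Bool :=
  (List.range' 1 (c.length - 1)).all fun m => (c.take m).any fun v => Nat.ble m v

/-- The list of indecomposable patterns. -/
def codes (y : ℕ → ℕ) (L : List ℕ) : List (List ℕ) :=
  (((subs L 7).map (code y)).filter fun c => (Nat.blt 0 c.length) && sib c).dedup

/-- Heaviness check. -/
def hv (x y : ℕ → ℕ) (L : List ℕ) : Bool :=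
  decide (L.Pairwise fun a b => x a < x b) && decide (L.Pairwise fun a b => y a ≠ y b) &&
  Nat.blt (23053 ^ 7) (((codes y L).map fun c => 10000 ^ c.length * 23053 ^ (7 - c.length)).sum)

theorem code_spec {y : ℕ → ℕ} {w : List ℕ} (hw : w.Pairwise fun a b => y a ≠ y b) :
    (code y w).length = w.length ∧ (∀ i (h : i < w.length), (code y w).getD i 0 < w.length) ∧
    ∀ i j (hi : i < w.length) (hj : j < w.length),
      ((code y w).getD i 0 < (code y w).getD j 0 ↔ y w[i] < y w[j]) := by
  have hnd : w.Nodup := hw.imp (fun {a b} (h : y a ≠ y b) (e : a = b) => h (congrArg y e))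
  have hr : ∀ i (h : i < w.length), (code y w).getD i 0 = (w.toFinset.filter fun b => y b < y w[i]).card := by
    intro i h
    rw [List.getD_eq_getElem _ _ (by simpa [code] using h)]
    simp only [code, List.getElem_map]
    rw [← List.toFinset_card_of_nodup (hnd.filter _), List.toFinset_filter]
    simp
  have hlt : ∀ i j (hi : i < w.length) (hj : j < w.length), y w[i] < y w[j] →
      (code y w).getD i 0 < (code y w).getD j 0 := by
    intro i j hi hj h
    rw [hr i hi, hr j hj]
    refine Finset.card_lt_card ((Finset.ssubset_iff_of_subset ?_).2 ⟨w[i], ?_, ?_⟩)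
    · intro b hb
      simp at hb ⊢
      exact ⟨hb.1, hb.2.trans h⟩
    · simp [h]
    · simp
  refine ⟨by simp [code], fun i h => ?_, fun i j hi hj => ⟨fun h => ?_, hlt i j hi hj⟩⟩
  · rw [hr i h, ← List.toFinset_card_of_nodup hnd]
    refine Finset.card_lt_card ((Finset.ssubset_iff_of_subset (Finset.filter_subset _ _)).2 ⟨w[i], by simp, by simp⟩)
  · by_contra hc
    rcases (not_lt.1 hc).lt_or_eq with h' | h'
    · exact (hlt j i hj hi h').asymm h
    · rw [hr i hi, hr j hj, h'] at h
      exact lt_irrefl _ h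

theorem heavy {x y : ℕ → ℕ} {L : List ℕ} (hL : hv x y L = true) {π : Permu} (P : ℕ → ℕ)
    (hP : ∀ a ∈ L, P a < π.1) (hx : ∀ a ∈ L, ∀ b ∈ L, x a < x b → P a < P b)
    (hy : ∀ a ∈ L, ∀ b ∈ L, y a < y b → ev π (P a) < ev π (P b)) {g : ℝ} (hg : 0 < g)
    (hg2 : g ≤ 2.3053) : 1 < Wt (SubCl π) g 7 := by
  classical
  unfold hv at hL
  rw [Bool.and_eq_true, Bool.and_eq_true, decide_eq_true_iff, decide_eq_true_iff] at hL
  obtain ⟨⟨hLx, hLy⟩, hsum⟩ := hL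
  have hsum' : 23053 ^ 7 < ((codes y L).map fun c => 10000 ^ c.length * 23053 ^ (7 - c.length)).sum := by
    exact Nat.le_of_ble_eq_true hsum
  have hc : ∀ c ∈ codes y L, ∃ σ : Permu, σ.1 = c.length ∧ (∀ i < c.length, ev σ i = c.getD i 0) ∧ SI σ ∧
      PLe σ π ∧ 1 ≤ c.length ∧ c.length ≤ 7 := by
    intro c hc
    rw [codes, List.mem_dedup, List.mem_filter, List.mem_map] at hc
    obtain ⟨⟨w, hw, rfl⟩, hc2⟩ := hc
    obtain ⟨hws, hwl⟩ := subs_sub _ _ _ hw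
    obtain ⟨s1, s2, s3⟩ := code_spec (hLy.sublist hws)
    rw [Bool.and_eq_true] at hc2
    have hpos : 0 < (code y w).length := Nat.le_of_ble_eq_true hc2.1
    have hyi : ∀ i j (hi : i < w.length) (hj : j < w.length), y w[i] < y w[j] ↔ ev π (P w[i]) < ev π (P w[j]) := by
      intro i j hi hj
      refine ⟨hy _ (hws.subset (by simp)) _ (hws.subset (by simp)), fun h => ?_⟩
      by_contra hc
      rcases (not_lt.1 hc).lt_or_eq with h' | h'
      · exact (hy _ (hws.subset (by simp)) _ (hws.subset (by simp)) h').asymm h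
      · have : i = j := by
          by_contra hij
          rcases Nat.lt_or_gt_of_ne hij with hij | hij
          · exact List.pairwise_iff_getElem.1 (hLy.sublist hws) i j hi hj hij h'.symm
          · exact List.pairwise_iff_getElem.1 (hLy.sublist hws) j i hj hi hij h'
        subst this
        exact lt_irrefl _ h
    obtain ⟨σ, e1, e2⟩ := exists_ev w.length (fun i => (code y w).getD i 0) s2 (fun i j hi hj h => by
      by_contra hij
      have a1 := s3 i j hi hj
      have a2 := s3 j i hj hi
      beta_reduce at h
      rw [h] at a1 a2
      simp only [lt_irrefl, false_iff] at a1 a2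
      have : y w[i] = y w[j] := by omega
      rcases Nat.lt_or_gt_of_ne hij with hij | hij
      · exact List.pairwise_iff_getElem.1 (hLy.sublist hws) i j hi hj hij this
      · exact List.pairwise_iff_getElem.1 (hLy.sublist hws) j i hj hi hij this.symm)
    refine ⟨σ, by rw [e1, s1], by rw [s1]; exact e2, ⟨by omega, fun m hm hm' => ?_⟩, ?_, by omega, by omega⟩
    · have := hc2.2
      rw [sib, List.all_eq_true] at this
      have := this m (by rw [List.mem_range']; exact ⟨m - 1, by omega, by omega⟩)
      rw [List.any_eq_true] at this
      obtain ⟨v, hv, hmv⟩ := this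
      obtain ⟨i, hi, rfl⟩ := List.mem_take_iff_getElem.1 hv
      have hi' : i < m ∧ i < w.length := by omega
      refine ⟨i, hi'.1, ?_⟩
      rw [e2 i hi'.2, List.getD_eq_getElem _ _ (by omega)]
      simpa using hmv
    · refine ple_ev (fun i => if h : i < w.length then P w[i] else 0) (fun i hi => ?_) (fun i j hij hj => ?_)
        fun i j hi hj => ?_
      · rw [e1] at hi
        simp only [hi, dif_pos]
        exact hP _ (hws.subset (by simp))
      · rw [e1] at hj
        have hi := hij.trans hj
        simp only [hi, hj, dif_pos]
        exact hx _ (hws.subset (by simp)) _ (hws.subset (by simp))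
          (List.pairwise_iff_getElem.1 (hLx.sublist hws) i j hi hj hij)
      · rw [e1] at hi hj
        simp only [hi, hj, dif_pos]
        rw [e2 i hi, e2 j hj, s3 i j hi hj, hyi]
  choose! σ q1 q2 q3 q4 q5 q6 using hc
  have hnd : (codes y L).Nodup := List.nodup_dedup _
  have hW : ∑ c ∈ (codes y L).toFinset, 1 / g ^ c.length ≤ Wt (SubCl π) g 7 := by
    rw [Wt, ← Finset.sum_fiberwise_of_maps_to (t := Finset.Icc 1 7) (g := List.length)
      (fun c hc => Finset.mem_Icc.2 ⟨q5 c (by simpa using hc), q6 c (by simpa using hc)⟩)]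
    refine Finset.sum_le_sum fun k _ => ?_
    rw [Finset.sum_congr rfl (fun (c : List ℕ) hc => by rw [(Finset.mem_filter.1 hc).2] :
      ∀ c ∈ (codes y L).toFinset.filter (fun c => c.length = k), 1 / g ^ c.length = 1 / g ^ k),
      Finset.sum_const, nsmul_eq_mul, mul_one_div]
    refine div_le_div_of_nonneg_right ?_ (pow_pos hg k).le
    rw [sic, ← card_PS]
    exact_mod_cast Finset.card_le_card_of_injOn σ (fun c hc => by
      simp only [Finset.coe_filter, List.mem_toFinset, Set.mem_setOf_eq] at hc
      rw [SetLike.mem_coe, mem_PS]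
      exact ⟨⟨q4 c hc.1, q3 c hc.1⟩, (q1 c hc.1).trans hc.2⟩) (fun c hc c' hc' h => by
      simp only [Finset.coe_filter, List.mem_toFinset, Set.mem_setOf_eq] at hc hc'
      refine List.ext_getElem (hc.2.trans hc'.2.symm) fun i hi hi' => ?_
      have a1 := q2 c hc.1 i hi
      have a2 := q2 c' hc'.1 i hi'
      rw [h, a2, List.getD_eq_getElem _ _ hi, List.getD_eq_getElem _ _ hi'] at a1
      exact a1.symm)
  refine lt_of_lt_of_le ?_ hW
  have h3 : ((23053 ^ 7 : ℕ) : ℝ) < ((∑ c ∈ (codes y L).toFinset, 10000 ^ c.length * 23053 ^ (7 - c.length) : ℕ) : ℝ) := by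
    rw [List.sum_toFinset _ hnd]
    exact_mod_cast hsum'
  push_cast at h3
  have h4 : ∀ c ∈ (codes y L).toFinset, ((10000 : ℝ) ^ c.length * 23053 ^ (7 - c.length)) ≤ 23053 ^ 7 * (1 / g ^ c.length) := by
    intro c hc
    have l7 := q6 c (by simpa using hc)
    have e : (23053 : ℝ) ^ 7 = 23053 ^ c.length * 23053 ^ (7 - c.length) := by
      rw [← pow_add]; congr 1; omega
    rw [e, mul_one_div, le_div_iff₀ (pow_pos hg _)]
    have : (10000 : ℝ) ^ c.length * g ^ c.length ≤ 23053 ^ c.length := by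
      rw [← mul_pow]
      exact pow_le_pow_left₀ (by positivity) (by linarith) _
    have p : (0 : ℝ) ≤ 23053 ^ (7 - c.length) := by positivity
    nlinarith [mul_le_mul_of_nonneg_right this p]
  have h5 := h3.trans_le (Finset.sum_le_sum h4)
  rw [← Finset.mul_sum] at h5
  exact lt_of_mul_lt_mul_left (by linarith) (by positivity : (0:ℝ) ≤ 23053 ^ 7)

/-- Keys. -/
def kq (q r : ℕ) : ℕ := if r % 2 = q then 3 * r + 8 else 3 * r + 3

/-- Extended keys -/
def xk (q e : ℕ) (r : ℕ) : ℕ := if r = 100 then e else kq q r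

theorem hvw6 (e f : ℕ) (he : e = 20 ∨ e = 22) (hf : f = 23 ∨ f = 25) :
    ∃ L, hv (xk 1 e) (xk 0 f) L = true ∧ ∀ r ∈ L, r = 100 ∨ r ≤ 8 := by
  rcases he with rfl | rfl <;> rcases hf with rfl | rfl
  · exact ⟨[2, 1, 4, 3, 100, 6, 5, 8, 7], by decide +kernel, by decide⟩
  · exact ⟨[2, 4, 3, 100, 6, 5, 7], by decide +kernel, by decide⟩
  · exact ⟨[2, 4, 3, 6, 100, 5], by decide +kernel, by decide⟩
  · exact ⟨[2, 4, 3, 6, 100, 5], by decide +kernel, by decide⟩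

theorem hvw5 (e f : ℕ) (he : e = 20 ∨ e = 22) (hf : f = 17 ∨ f = 19) :
    ∃ L, hv (xk 1 e) (xk 0 f) L = true ∧ ∀ r ∈ L, r = 100 ∨ r ≤ 8 := by
  rcases he with rfl | rfl <;> rcases hf with rfl | rfl
  · exact ⟨[0, 2, 1, 4, 3, 100, 6, 5, 7], by decide +kernel, by decide⟩
  · exact ⟨[2, 1, 4, 3, 100, 5], by decide +kernel, by decide⟩
  · exact ⟨[2, 1, 4, 3, 6, 100, 5], by decide +kernel, by decide⟩
  · exact ⟨[2, 1, 4, 3, 100, 5], by decide +kernel, by decide⟩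

/-- Keys of juxtapositions. -/
def jk (a b : Bool) (i : ℕ) : ℕ :=
  if i % 2 = 0 then (if a then i else 9 - i) else 100 + (if b then i else 9 - i)

/-- Sorted juxtapositions. -/
def jl : Bool → Bool → List ℕ
  | true, true => [0, 2, 4, 6, 8, 1, 3, 5, 7]
  | true, false => [0, 2, 4, 6, 7, 5, 3, 1]
  | false, true => [6, 4, 2, 0, 1, 3, 5]
  | false, false => [4, 2, 0, 3, 1]

/-- Rank tables. -/
def jt : Bool → Bool → List ℕ
  | true, true => [0, 5, 1, 6, 2, 7, 3, 8, 4]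
  | true, false => [0, 7, 1, 6, 2, 5, 3, 4]
  | false, true => [3, 4, 2, 5, 1, 6, 0]
  | false, false => [2, 4, 1, 3, 0]

theorem hvj : ∀ a b : Bool, hv (jk a b) id (jl a b) = true ∧ (∀ i ∈ jl a b, i < 9) ∧
    hv id (fun i => (jt a b).getD i 0) (List.range (jt a b).length) = true ∧ (jt a b).length ≤ 9 ∧
    ∀ i < (jt a b).length, ∀ j < (jt a b).length,
      (jt a b).getD i 0 < (jt a b).getD j 0 → jk a b i < jk a b j := by
  decide +kernel

theorem hv1 : hv (fun i => if i = 100 then 0 else i + 1) (fun i => if i = 100 then 100 else i + 1 - 2 * (i % 2))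
    [100, 0, 1, 2, 3, 4, 5, 6, 7] = true := by decide +kernel

theorem hv2 : hv (fun i => i) (fun i => if i = 100 then 0 else i + 2 - 2 * (i % 2))
    [0, 1, 2, 3, 4, 5, 6, 7, 100] = true := by decide +kernel

theorem hv3 : hv (fun i => 5 - i) (fun i => i + 2 - 2 * (i % 2)) [5, 4, 3, 2, 1, 0] = true := by
  decide +kernel

/-- The light permutations. -/
def Dst : Set Permu := {π | Wt (SubCl π) 2.3053 7 ≤ 1}

theorem Dst_class : IsPermClass Dst := fun σ π h hπ =>
  (Wt_mono (fun _ h' => PLe.trans h' h) (by norm_num) 7).trans hπ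

theorem Dst_not {x y : ℕ → ℕ} {L : List ℕ} (hL : hv x y L = true) {π : Permu} (hπ : π ∈ Dst) (P : ℕ → ℕ)
    (hP : ∀ a ∈ L, P a < π.1) (hx : ∀ a ∈ L, ∀ b ∈ L, x a < x b → P a < P b)
    (hy : ∀ a ∈ L, ∀ b ∈ L, y a < y b → ev π (P a) < ev π (P b)) : False :=
  absurd (heavy hL P hP hx hy (by norm_num) le_rfl) (not_lt.2 hπ)

theorem LinSep.jux {C : Set Permu} (h : LinSep 2 C) : ∃ π ∈ C, ∃ P : Fin 9 → Fin π.1, ∃ a b : Bool,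
    (∀ i j : Fin 9, jk a b i < jk a b j → P i < P j) ∧ ∀ i j : Fin 9, i < j → π.2 (P i) < π.2 (P j) := by
  classical
  obtain ⟨T, hT, hS, hsep⟩ := h
  obtain ⟨π, hπ, Q, -, hQ⟩ := hT.word (n := 9) (fun i => if i.1 % 2 = 0 then 0 else 1)
    fun i j _ => hT.not_E (hS _ _)
  refine ⟨π, hπ, Q, decide (T.R 0 0), decide (T.R 1 1), fun i j hij => ?_, fun i j hij => ?_⟩
  · refine (hQ i j).1.2 ?_
    have hne : i ≠ j := fun h => by simp [h] at hij
    by_cases hi : i.1 % 2 = 0 <;> by_cases hj : j.1 % 2 = 0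
    · simp only [jk, hi, hj, if_true] at hij
      simp only [Xw, hi, hj, if_true]
      by_cases hR : T.R 0 0
      · simp [hR] at hij
        simp [hR, hij]
      · simp [hR] at hij
        simp [hR]
        omega
    · exact Xw_sep (by simp only [hi, hj, if_true, if_false]; exact hsep 0 1 (by decide)) hne
    · exfalso
      simp only [jk, hi, hj, if_true, if_false] at hij
      split_ifs at hij <;> omega
    · simp only [jk, hi, hj, if_false] at hij
      simp only [Xw, hi, hj, if_false]
      by_cases hR : T.R 1 1
      · simp [hR] at hij
        simp [hR, hij]
      · simp [hR] at hij
        simp [hR]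
        omega
  · exact (hQ i j).2.2 (Or.inl ⟨hij, hS _ _⟩)

/-- Extension by zero. -/
def nx {n m : ℕ} (P : Fin n → Fin m) (i : ℕ) : ℕ := if h : i < n then (P ⟨i, h⟩ : ℕ) else 0

theorem Dst_lin : ¬ LinSep 2 Dst ∧ ¬ LinSep 2 (cinv Dst) := by
  constructor
  · intro h
    obtain ⟨π, hπ, P, a, b, h1, h2⟩ := h.jux
    have hl := (hvj a b).2.1
    refine Dst_not (hvj a b).1 hπ (nx P) (fun i hi => ?_) (fun i hi j hj hij => ?_) fun i hi j hj hij => ?_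
    · simp [nx, hl i hi]
    · simpa [nx, hl i hi, hl j hj] using h1 ⟨i, hl i hi⟩ ⟨j, hl j hj⟩ hij
    · simp only [nx, hl i hi, hl j hj, dif_pos, ev_fin]
      exact h2 ⟨i, hl i hi⟩ ⟨j, hl j hj⟩ hij
  · intro h
    obtain ⟨π, hπ, P, a, b, h1, h2⟩ := h.jux
    obtain ⟨-, -, hh, h9, hk⟩ := hvj a b
    have hl : ∀ i ∈ List.range (jt a b).length, i < 9 := fun i hi => (List.mem_range.1 hi).trans_le h9
    change pinv π ∈ Dst at hπ
    refine Dst_not hh hπ (nx fun i => π.2 (P i)) (fun i hi => ?_) (fun i hi j hj hij => ?_) fun i hi j hj hij => ?_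
    · simp only [nx, hl i hi, dif_pos]
      exact (π.2 (P ⟨i, _⟩)).2
    · simpa [nx, hl i hi, hl j hj] using h2 ⟨i, hl i hi⟩ ⟨j, hl j hj⟩ hij
    · simp only [nx, hl i hi, hl j hj, dif_pos]
      have e : ∀ k : Fin π.1, ev (pinv π) (π.2 k) = k := fun k => by
        exact (ev_fin (pinv π) (π.2 k)).trans (congrArg Fin.val (π.2.symm_apply_apply k))
      rw [e, e]
      exact h1 ⟨i, hl i hi⟩ ⟨j, hl j hj⟩ (hk i (List.mem_range.1 hi) j (List.mem_range.1 hj) hij)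


/-- The two coordinates: odd index is the position, even index is the value. -/
def cX (τ : Permu) (j p : ℕ) : ℕ := if j % 2 = 1 then p else ev τ p

/-- The staircase. -/
noncomputable def cs (τ : Permu) : ℕ → ℕ
  | 0 => 0
  | j + 1 => max 1 (((Finset.range τ.1).filter fun p => cX τ j p < cs τ j).sup fun p => cX τ (j + 1) p + 1)

theorem cX_add (τ : Permu) (j p : ℕ) : cX τ (j + 2) p = cX τ j p := by simp [cX]

theorem cX_par (τ : Permu) {j q : ℕ} (h : j % 2 = q % 2) (p : ℕ) : cX τ j p = cX τ q p := by
  simp [cX, h]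

theorem cX_inj (τ : Permu) (j : ℕ) {p q : ℕ} (h : cX τ j p = cX τ j q) : p = q := by
  unfold cX at h
  split_ifs at h
  · exact h
  · exact ev_inj τ h

theorem cX_lt (τ : Permu) (j : ℕ) {p : ℕ} (h : p < τ.1) : cX τ j p < τ.1 := by
  unfold cX
  split_ifs
  · exact h
  · exact ev_lt h

theorem cX_surj (τ : Permu) (j : ℕ) {v : ℕ} (h : v < τ.1) : ∃ p < τ.1, cX τ j p = v := by
  unfold cX
  split_ifs
  · exact ⟨v, h, rfl⟩
  · exact ⟨τ.2.symm ⟨v, h⟩, (τ.2.symm ⟨v, h⟩).2, by rw [ev_fin]; simp⟩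

theorem cX_count (τ : Permu) (j m : ℕ) (h : m ≤ τ.1) :
    ((Finset.range τ.1).filter fun p => cX τ j p < m).card = m := by
  have : ((Finset.range τ.1).filter fun p => cX τ j p < m).image (cX τ j) = Finset.range m := by
    ext v
    simp only [Finset.mem_image, Finset.mem_filter, Finset.mem_range]
    constructor
    · rintro ⟨p, hp, rfl⟩
      exact hp.2
    · intro hv
      obtain ⟨p, hp, rfl⟩ := cX_surj τ j (hv.trans_le h)
      exact ⟨p, ⟨hp, hv⟩, rfl⟩
  rw [← Finset.card_image_of_injective _ (fun p q h => cX_inj τ j h : Function.Injective (cX τ j)), this,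
    Finset.card_range]

section
variable {τ : Permu} (hτ : SI τ)

theorem cs_le (hτ : SI τ) (j : ℕ) : cs τ j ≤ τ.1 := by
  have := hτ.1
  cases j with
  | zero => simp [cs]
  | succ j =>
    rw [cs]
    refine max_le this (Finset.sup_le fun p hp => ?_)
    simp at hp
    exact cX_lt τ _ hp.1

theorem cs_step {j p : ℕ} (hp : p < τ.1) (h : cX τ j p < cs τ j) : cX τ (j + 1) p < cs τ (j + 1) := by
  rw [cs]
  refine lt_max_of_lt_right (Nat.lt_of_succ_le ?_)
  exact Finset.le_sup (f := fun p => cX τ (j + 1) p + 1) (by simp [hp, h])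

theorem cs_lt (hτ : SI τ) {j : ℕ} (h : cs τ j < τ.1) : cs τ j < cs τ (j + 1) := by
  rcases Nat.eq_zero_or_pos (cs τ j) with h0 | h0
  · rw [h0, cs]
    simp
  · suffices ∃ p < τ.1, cX τ j p < cs τ j ∧ cs τ j ≤ cX τ (j + 1) p by
      obtain ⟨p, hp, h1, h2⟩ := this
      exact h2.trans_lt (cs_step hp h1)
    set m := cs τ j
    by_contra hcon
    push Not at hcon
    have hsub : ((Finset.range τ.1).filter fun p => cX τ j p < m) ⊆
        ((Finset.range τ.1).filter fun p => cX τ (j + 1) p < m) := fun p hp => by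
      simp only [Finset.mem_filter, Finset.mem_range] at hp ⊢
      exact ⟨hp.1, hcon p hp.1 hp.2⟩
    have heq := Finset.eq_of_subset_of_card_le hsub (by rw [cX_count τ _ m h.le, cX_count τ _ m h.le])
    obtain ⟨i, hi, hi'⟩ := hτ.2 m h0 h
    have e := Finset.ext_iff.1 heq i
    have hin : i < τ.1 := hi.trans h
    simp only [Finset.mem_filter, Finset.mem_range, hin, true_and] at e
    unfold cX at e
    rcases Nat.mod_two_eq_zero_or_one j with hj | hj
    · have h2 : (j + 1) % 2 = 1 := by omega
      rw [if_neg (by omega), if_pos h2] at e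
      omega
    · have h2 : ¬ (j + 1) % 2 = 1 := by omega
      rw [if_pos hj, if_neg h2] at e
      omega

theorem cs_mono (hτ : SI τ) : Monotone (cs τ) := monotone_nat_of_le_succ fun j => by
  rcases (cs_le hτ j).lt_or_eq with h | h
  · exact (cs_lt hτ h).le
  · rw [cs]
    refine le_max_of_le_right ?_
    obtain ⟨p, hp, h2⟩ := cX_surj τ (j + 1) (v := τ.1 - 1) (by have := hτ.1; omega)
    refine le_trans ?_ (Finset.le_sup (f := fun p => cX τ (j + 1) p + 1) (b := p) (by
      simp only [Finset.mem_filter, Finset.mem_range]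
      exact ⟨hp, h ▸ cX_lt τ j hp⟩))
    simp only [h2, h]
    omega

theorem cs_big (hτ : SI τ) (j : ℕ) : min j τ.1 ≤ cs τ j := by
  induction j with
  | zero => simp
  | succ j ih =>
    rcases (cs_le hτ j).lt_or_eq with h | h
    · have := cs_lt hτ h
      omega
    · have := cs_mono hτ (show j ≤ j + 1 by omega)
      omega

/-- Being in layer at least `j`. -/
def Ge (τ : Permu) (j p : ℕ) : Prop := cs τ j ≤ cX τ j p

theorem Ge.succ {j p : ℕ} (hp : p < τ.1) (h : Ge τ (j + 1) p) : Ge τ j p := by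
  by_contra hc
  exact absurd (cs_step hp (not_le.1 hc)) (not_lt.2 h)

theorem Ge.anti {i j p : ℕ} (hp : p < τ.1) (hij : i ≤ j) (h : Ge τ j p) : Ge τ i p := by
  induction j, hij using Nat.le_induction with
  | base => exact h
  | succ j _ ih => exact ih (Ge.succ hp h)

theorem not_Ge (hτ : SI τ) {j p : ℕ} (hp : p < τ.1) (h : τ.1 ≤ j) : ¬ Ge τ j p := by
  have := cs_big hτ j
  have := cX_lt τ j hp
  unfold Ge
  omega

/-- The layer of a point. -/
noncomputable def lay (τ : Permu) (p : ℕ) : ℕ := by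
  classical exact Nat.findGreatest (fun j => Ge τ j p) τ.1

theorem le_lay (hτ : SI τ) {j p : ℕ} (hp : p < τ.1) : j ≤ lay τ p ↔ Ge τ j p := by
  classical
  constructor
  · intro h
    refine Ge.anti hp h ?_
    unfold lay
    exact Nat.findGreatest_spec (P := fun j => Ge τ j p) (Nat.zero_le _) (by simp [Ge, cs])
  · intro h
    refine Nat.le_findGreatest ?_ h
    by_contra hc
    exact not_Ge hτ hp (not_le.1 hc).le h

theorem lay_own (hτ : SI τ) {p : ℕ} (hp : p < τ.1) : cs τ (lay τ p) ≤ cX τ (lay τ p) p ∧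
    cX τ (lay τ p) p < cs τ (lay τ p + 2) := by
  refine ⟨(le_lay hτ hp).1 le_rfl, not_le.1 fun h => ?_⟩
  rw [← cX_add] at h
  have := (le_lay hτ (j := lay τ p + 2) hp).2 h
  omega

theorem lay_oth (hτ : SI τ) {p : ℕ} (hp : p < τ.1) : cs τ (lay τ p - 1) ≤ cX τ (lay τ p + 1) p ∧
    cX τ (lay τ p + 1) p < cs τ (lay τ p + 1) := by
  constructor
  · rcases Nat.eq_zero_or_pos (lay τ p) with h | h
    · rw [h]; simp [cs]
    · have := (le_lay hτ (j := lay τ p - 1) hp).1 (by omega)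
      unfold Ge at this
      rwa [cX_par τ (q := lay τ p + 1) (by omega)] at this
  · refine not_le.1 fun h => ?_
    have := (le_lay hτ (j := lay τ p + 1) hp).2 h
    omega

/-- Upper bound index of the block of layer `a` in coordinate `q`. -/
def eb (q a : ℕ) : ℕ := if a % 2 = q then a + 2 else a + 1

theorem blk (hτ : SI τ) {q p : ℕ} (hq : q < 2) (hp : p < τ.1) : cs τ (eb q (lay τ p) - 2) ≤ cX τ q p ∧
    cX τ q p < cs τ (eb q (lay τ p)) := by
  unfold eb
  split_ifs with h
  · rw [← cX_par τ (j := lay τ p) (by omega)]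
    exact lay_own hτ hp
  · rw [← cX_par τ (j := lay τ p + 1) (by omega)]
    exact lay_oth hτ hp

theorem blk_lt (hτ : SI τ) {q p r : ℕ} (hq : q < 2) (hp : p < τ.1) (hr : r < τ.1)
    (h : eb q (lay τ p) < eb q (lay τ r)) : cX τ q p < cX τ q r := by
  refine (blk hτ hq hp).2.trans_le (le_trans (cs_mono hτ ?_) (blk hτ hq hr).1)
  unfold eb at *
  split_ifs at * <;> omega

theorem exists_u (hτ : SI τ) {j : ℕ} (hj : cs τ j < τ.1) : ∃ p < τ.1, cX τ j p + 1 = cs τ (j + 2) ∧ lay τ p = j := by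
  have h1 : 1 ≤ cs τ (j + 1) := by rw [cs]; exact le_max_left _ _
  have hne : ((Finset.range τ.1).filter fun p => cX τ (j + 1) p < cs τ (j + 1)).Nonempty := by
    rw [← Finset.card_pos, cX_count τ _ _ (cs_le hτ _)]
    exact h1
  obtain ⟨p, hp, he⟩ := Finset.exists_mem_eq_sup _ hne (fun p => cX τ (j + 2) p + 1)
  simp only [Finset.mem_filter, Finset.mem_range] at hp
  have e : cX τ j p + 1 = cs τ (j + 2) := by
    rw [show j + 2 = (j + 1) + 1 from rfl, cs, he, cX_add]
    simp
  refine ⟨p, hp.1, e, le_antisymm ?_ ?_⟩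
  · by_contra hc
    exact absurd ((le_lay hτ (j := j + 1) hp.1).1 (by omega)) (not_le.2 hp.2)
  · rw [le_lay hτ hp.1, Ge]
    have := cs_lt hτ hj
    have := cs_mono hτ (show j + 1 ≤ j + 2 by omega)
    omega

/-- The extreme point of layer `j`. -/
noncomputable def us (τ : Permu) (j : ℕ) : ℕ := by
  classical exact if h : ∃ p < τ.1, cX τ j p + 1 = cs τ (j + 2) ∧ lay τ p = j then h.choose else 0

theorem us_spec (hτ : SI τ) {j : ℕ} (hj : cs τ j < τ.1) : us τ j < τ.1 ∧ cX τ j (us τ j) + 1 = cs τ (j + 2) ∧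
    lay τ (us τ j) = j := by
  have h := exists_u hτ hj
  unfold us
  rw [dif_pos h]
  exact h.choose_spec

theorem us_lt (hτ : SI τ) {q a b : ℕ} (hq : q < 2) (ha : cs τ a < τ.1) (hb : cs τ b < τ.1)
    (h : kq q a < kq q b) : cX τ q (us τ a) < cX τ q (us τ b) := by
  obtain ⟨a1, a2, a3⟩ := us_spec hτ ha
  obtain ⟨b1, b2, b3⟩ := us_spec hτ hb
  rcases lt_or_ge (eb q a) (eb q b) with hlt | hge
  · exact blk_lt hτ hq a1 b1 (by rwa [a3, b3])
  · have hab : b % 2 = q ∧ a = b + 1 := by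
      unfold kq eb at *
      split_ifs at * <;> omega
    obtain ⟨hb2, rfl⟩ := hab
    have h1 := (blk hτ hq a1).2
    rw [a3, eb, if_neg (by omega), show b + 1 + 1 = b + 2 from rfl] at h1
    rw [cX_par τ (q := q) (by omega)] at b2
    refine lt_of_le_of_ne (by omega) fun he => ?_
    have := cX_inj τ q he
    rw [this, b3] at a3
    omega

theorem ex_lt (hτ : SI τ) {q p : ℕ} (hq : q < 2) (hp : p < τ.1) (hj : cs τ (lay τ p) < τ.1)
    (hpu : p ≠ us τ (lay τ p)) {e : ℕ}
    (he : lay τ p % 2 = q ∧ (e = 3 * lay τ p + 5 ∧ cX τ q p < cX τ q (us τ (lay τ p + 1)) ∨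
        e = 3 * lay τ p + 7 ∧ cX τ q (us τ (lay τ p + 1)) < cX τ q p) ∨
      lay τ p % 2 ≠ q ∧ (e = 3 * lay τ p + 2 ∧ cX τ q p < cX τ q (us τ (lay τ p)) ∨
        e = 3 * lay τ p + 4 ∧ cX τ q (us τ (lay τ p)) < cX τ q p)) {b : ℕ} (hb : cs τ b < τ.1) :
    (kq q b < e → cX τ q (us τ b) < cX τ q p) ∧ (e < kq q b → cX τ q p < cX τ q (us τ b)) := by
  obtain ⟨b1, b2, b3⟩ := us_spec hτ hb
  have hbl := blk_lt hτ hq b1 hp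
  have hbr := blk_lt hτ hq hp b1
  rw [b3] at hbl hbr
  have htop : eb q b = eb q (lay τ p) → b % 2 = q → cX τ q p < cX τ q (us τ b) := by
    intro h1 h2
    have h3 := (blk hτ hq hp).2
    rw [← h1, eb, if_pos h2] at h3
    rw [cX_par τ (q := q) (by omega)] at b2
    refine lt_of_le_of_ne (by omega) fun he => ?_
    have := cX_inj τ q he
    refine hpu ?_
    rw [this, b3]
  generalize lay τ p = j at *
  constructor
  · intro h
    rcases he with ⟨h0, ⟨rfl, h1⟩ | ⟨rfl, h1⟩⟩ | ⟨h0, ⟨rfl, h1⟩ | ⟨rfl, h1⟩⟩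
    · refine hbl ?_
      unfold kq eb at *
      split_ifs at * <;> omega
    · by_cases hbj : b = j + 1
      · rw [hbj]; exact h1
      refine hbl ?_
      unfold kq eb at *
      split_ifs at * <;> omega
    · refine hbl ?_
      unfold kq eb at *
      split_ifs at * <;> omega
    · by_cases hbj : b = j
      · rw [hbj]; exact h1
      refine hbl ?_
      unfold kq eb at *
      split_ifs at * <;> omega
  · intro h
    by_cases hT : eb q b = eb q j ∧ b % 2 = q
    · exact htop hT.1 hT.2
    rcases he with ⟨h0, ⟨rfl, h1⟩ | ⟨rfl, h1⟩⟩ | ⟨h0, ⟨rfl, h1⟩ | ⟨rfl, h1⟩⟩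
    · by_cases hbj : b = j + 1
      · rw [hbj]; exact h1
      refine hbr ?_
      unfold kq eb at *
      split_ifs at * <;> omega
    · refine hbr ?_
      unfold kq eb at *
      split_ifs at * <;> omega
    · by_cases hbj : b = j
      · rw [hbj]; exact h1
      refine hbr ?_
      unfold kq eb at *
      split_ifs at * <;> omega
    · refine hbr ?_
      unfold kq eb at *
      split_ifs at * <;> omega

/-- Middle layers are singletons. -/
theorem mid_single (hτ : SI τ) (hD : τ ∈ Dst) {p : ℕ} (hp : p < τ.1) (h6 : 6 ≤ lay τ p)
    (hj : cs τ (lay τ p + 3) < τ.1) : p = us τ (lay τ p) := by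
  by_contra hpu
  set j := lay τ p with hjd
  have hm := cs_mono hτ
  have hjj : cs τ j < τ.1 := (hm (by omega)).trans_lt hj
  have hj1 : cs τ (j + 1) < τ.1 := (hm (by omega)).trans_lt hj
  have ex : ∀ q < 2, ∃ e : ℕ, (j % 2 = q ∧ (e = 3 * j + 5 ∧ cX τ q p < cX τ q (us τ (j + 1)) ∨
        e = 3 * j + 7 ∧ cX τ q (us τ (j + 1)) < cX τ q p) ∨
      j % 2 ≠ q ∧ (e = 3 * j + 2 ∧ cX τ q p < cX τ q (us τ j) ∨
        e = 3 * j + 4 ∧ cX τ q (us τ j) < cX τ q p)) := by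
    intro q hq
    have n1 : cX τ q p ≠ cX τ q (us τ (j + 1)) := fun h => by
      have h1 := (us_spec hτ hj1).2.2
      rw [← cX_inj τ q h] at h1
      omega
    have n2 : cX τ q p ≠ cX τ q (us τ j) := fun h => hpu (cX_inj τ q h)
    by_cases h : j % 2 = q
    · rcases lt_or_gt_of_ne n1 with h1 | h1
      · exact ⟨_, Or.inl ⟨h, Or.inl ⟨rfl, h1⟩⟩⟩
      · exact ⟨_, Or.inl ⟨h, Or.inr ⟨rfl, h1⟩⟩⟩
    · rcases lt_or_gt_of_ne n2 with h1 | h1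
      · exact ⟨_, Or.inr ⟨h, Or.inl ⟨rfl, h1⟩⟩⟩
      · exact ⟨_, Or.inr ⟨h, Or.inr ⟨rfl, h1⟩⟩⟩
  obtain ⟨e, he⟩ := ex 1 (by norm_num)
  obtain ⟨f, hf⟩ := ex 0 (by norm_num)
  obtain ⟨j0, hj0, hj6⟩ : ∃ j0, j0 % 2 = 0 ∧ (j = j0 + 6 ∨ j = j0 + 5) := by
    rcases Nat.mod_two_eq_zero_or_one j with h | h
    · exact ⟨j - 6, by omega, by omega⟩
    · exact ⟨j - 5, by omega, by omega⟩
  have hL : ∃ L, hv (xk 1 (e - 3 * j0)) (xk 0 (f - 3 * j0)) L = true ∧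
      ∀ r ∈ L, r = 100 ∨ r ≤ 8 ∧ cs τ (j0 + r) < τ.1 := by
    rcases hj6 with h | h
    · obtain ⟨L, h1, h2⟩ := hvw6 (e - 3 * j0) (f - 3 * j0) (by omega) (by omega)
      exact ⟨L, h1, fun r hr => (h2 r hr).imp id fun h => ⟨h, (hm (by omega)).trans_lt hj⟩⟩
    · obtain ⟨L, h1, h2⟩ := hvw5 (e - 3 * j0) (f - 3 * j0) (by omega) (by omega)
      exact ⟨L, h1, fun r hr => (h2 r hr).imp id fun h => ⟨h, (hm (by omega)).trans_lt hj⟩⟩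
  obtain ⟨L, hL1, hL2⟩ := hL
  have kk : ∀ q r, kq q (j0 + r) = 3 * j0 + kq q r := by
    intro q r
    unfold kq
    split_ifs <;> omega
  let P : ℕ → ℕ := fun r => if r = 100 then p else us τ (j0 + r)
  have hP : ∀ r, (r = 100 ∧ P r = p) ∨ (r ≠ 100 ∧ P r = us τ (j0 + r)) := fun r => by
    by_cases h : r = 100 <;> simp [P, h]
  clear_value P
  have key : ∀ q e, q < 2 → (j % 2 = q ∧ (e = 3 * j + 5 ∧ cX τ q p < cX τ q (us τ (j + 1)) ∨
        e = 3 * j + 7 ∧ cX τ q (us τ (j + 1)) < cX τ q p) ∨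
      j % 2 ≠ q ∧ (e = 3 * j + 2 ∧ cX τ q p < cX τ q (us τ j) ∨
        e = 3 * j + 4 ∧ cX τ q (us τ j) < cX τ q p)) → ∀ a ∈ L, ∀ b ∈ L,
        xk q (e - 3 * j0) a < xk q (e - 3 * j0) b → cX τ q (P a) < cX τ q (P b) := by
    intro q e hq he a ha b hb hab
    have hej : 3 * j0 ≤ e := by omega
    rcases hP a with ⟨a1, a2⟩ | ⟨a1, a2⟩ <;> rcases hP b with ⟨b1, b2⟩ | ⟨b1, b2⟩ <;> rw [a2, b2] <;>
      simp only [xk, a1, b1, if_true, if_false] at hab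
    · omega
    · have hb' := ((hL2 b hb).resolve_left b1).2
      refine (ex_lt hτ hq hp hjj hpu he hb').2 ?_
      rw [kk]; omega
    · have ha' := ((hL2 a ha).resolve_left a1).2
      refine (ex_lt hτ hq hp hjj hpu he ha').1 ?_
      rw [kk]; omega
    · refine us_lt hτ hq ((hL2 a ha).resolve_left a1).2 ((hL2 b hb).resolve_left b1).2 ?_
      rw [kk, kk]; omega
  refine Dst_not hL1 hD P (fun a ha => ?_) (fun a ha b hb hab => ?_) fun a ha b hb hab => ?_
  · rcases hP a with ⟨a1, a2⟩ | ⟨a1, a2⟩ <;> rw [a2]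
    · exact hp
    · exact (us_spec hτ ((hL2 a ha).resolve_left a1).2).1
  · simpa [cX] using key 1 e (by norm_num) he a ha b hb hab
  · simpa [cX] using key 0 f (by norm_num) hf a ha b hb hab

end


/-- Monotone permutations. -/
def MonoC : Set Permu := {π | MonoOn' π.2 (fun _ => True)}

theorem MonoC_class : IsPermClass MonoC := by
  rintro σ π ⟨f, hf, h⟩ h1
  rcases h1 with h1 | h1
  · exact Or.inl fun a b ha hb hab => (h _ _).2 (h1 _ _ trivial trivial (hf hab))
  · exact Or.inr fun a b ha hb hab => (h _ _).2 (h1 _ _ trivial trivial (hf hab))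

theorem MonoC_basis (π : Permu) (h : π ∉ MonoC) : ∃ β, PLe β π ∧ β ∉ MonoC ∧ β.1 ≤ 4 := by
  classical
  obtain ⟨n, π⟩ := π
  obtain ⟨a, b, c, d, -, -, -, -, hab, h1, hcd, h2⟩ := not_mono π h
  refine ⟨pat π {a, b, c, d}, pat_ple _ _, fun hm => ?_, ?_⟩
  · obtain ⟨Q, hQ, hs⟩ := pat_emb π {a, b, c, d}
    obtain ⟨a', ha⟩ := hs a (by simp)
    obtain ⟨b', hb⟩ := hs b (by simp)
    obtain ⟨c', hc⟩ := hs c (by simp)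
    obtain ⟨d', hd⟩ := hs d (by simp)
    rw [← ha, ← hb] at hab h1
    rw [← hc, ← hd] at hcd h2
    exact mono_absurd hm (a := a') (b := b') (c := c') (d := d') trivial trivial trivial trivial
      ((hQ _ _).1.1 hab) ((hQ _ _).2.1 h1) ((hQ _ _).1.1 hcd) ((hQ _ _).2.1 h2)
  · rw [pat_card]
    exact Finset.card_le_four

theorem MonoC_count (n : ℕ) : pcount MonoC n ≤ 2 := by
  classical
  rw [pcount_eq]
  have : Set.InjOn (fun π : Equiv.Perm (Fin n) => decide (∀ a b, a < b → π a < π b)) (PC MonoC n) := by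
    intro π hπ π' hπ' he
    have h1 : MonoOn' π (fun _ => True) := mem_PC.1 hπ
    have h2 : MonoOn' π' (fun _ => True) := mem_PC.1 hπ'
    refine color_eq π π' (fun _ => ()) (fun _ => rfl) fun i j _ => ?_
    simp only [decide_eq_decide] at he
    by_cases hi : ∀ a b, a < b → π a < π b
    · have m1 : StrictMono π := fun a b => hi a b
      have m2 : StrictMono π' := fun a b => he.1 hi a b
      rw [m1.lt_iff_lt, m2.lt_iff_lt]
    · have hi' := mt he.2 hi
      have m1 : StrictAnti π := fun a b => (h1.resolve_left fun h => hi fun a b => h a b trivial trivial) a b trivial trivial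
      have m2 : StrictAnti π' := fun a b => (h2.resolve_left fun h => hi' fun a b => h a b trivial trivial) a b trivial trivial
      rw [m1.lt_iff_gt, m2.lt_iff_gt]
  simpa using Finset.card_le_card_of_injOn (t := (Finset.univ : Finset Bool)) _ (fun _ _ => Finset.mem_univ _) this

theorem no_chain4 {τ : Permu} (hτ : SI τ) (hD : τ ∈ Dst) {A B : ℕ → ℕ} {a b : ℕ}
    (hB : ∀ i < 4, B i < τ.1) (hAB : ∀ i < 4, A i < B i ∧ ev τ (B i) < ev τ (A i))
    (hlt : ∀ i j, i < j → j < 4 → A i < A j ∧ A i < B j ∧ B i < A j ∧ B i < B j ∧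
      ev τ (A i) < ev τ (A j) ∧ ev τ (A i) < ev τ (B j) ∧ ev τ (B i) < ev τ (A j) ∧ ev τ (B i) < ev τ (B j))
    (ha : ∀ i < 4, lay τ (A i) = a) (hb : ∀ i < 4, lay τ (B i) = b) : False := by
  have hA : ∀ i < 4, A i < τ.1 := fun i hi => (hAB i hi).1.trans (hB i hi)
  have key : ∀ q < 2, eb q a < eb q b → ∀ i < 4, ∀ j < 4, cX τ q (A i) < cX τ q (B j) := fun q hq h i hi j hj =>
    blk_lt hτ hq (hA i hi) (hB j hj) (by rwa [ha i hi, hb j hj])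
  have key' : ∀ q < 2, eb q b < eb q a → ∀ i < 4, ∀ j < 4, cX τ q (B i) < cX τ q (A j) := fun q hq h i hi j hj =>
    blk_lt hτ hq (hB i hi) (hA j hj) (by rwa [ha j hj, hb i hi])
  have h01 := hlt 0 1 (by norm_num) (by norm_num)
  have hh0 := hAB 0 (by norm_num)
  have q0 : ∀ p, cX τ 0 p = ev τ p := fun p => by simp [cX]
  have q1 : ∀ p, cX τ 1 p = p := fun p => by simp [cX]
  rcases lt_trichotomy a b with hl | rfl | hl
  · rcases Nat.mod_two_eq_zero_or_one a with h | h
    · have := key 1 (by norm_num) (by unfold eb; split_ifs <;> omega) 1 (by norm_num) 0 (by norm_num)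
      rw [q1, q1] at this
      omega
    · have := key 0 (by norm_num) (by unfold eb; split_ifs <;> omega) 1 (by norm_num) 0 (by norm_num)
      rw [q0, q0] at this
      omega
  · obtain _ | j := a
    · have := (le_lay hτ (j := 1) (hB 0 (by norm_num))).2 (by
        rw [Ge, q1]
        have : cs τ 1 = 1 := by simp [cs]
        omega)
      rw [hb 0 (by norm_num)] at this
      omega
    have hjn : cs τ j < τ.1 := by
      have h1 := (lay_own hτ (hA 0 (by norm_num))).1
      have h2 := cX_lt τ (lay τ (A 0)) (hA 0 (by norm_num))
      rw [ha 0 (by norm_num)] at h1 h2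
      exact (cs_mono hτ (Nat.le_succ j)).trans_lt (h1.trans_lt h2)
    obtain ⟨u1, u2, u3⟩ := us_spec hτ hjn
    have ku : ∀ p < τ.1, lay τ p = j + 1 → cX τ (j + 1) (us τ j) < cX τ (j + 1) p ∧
        cX τ j p < cX τ j (us τ j) := by
      intro p hp hl
      have h1 := (lay_own hτ hp).1
      have h2 := (lay_oth hτ hp).2
      have h3 := (lay_oth hτ u1).2
      rw [hl] at h1 h2
      rw [u3] at h3
      refine ⟨h3.trans_le h1, ?_⟩
      rw [cX_add, show j + 1 + 1 = j + 2 from rfl, ← u2] at h2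
      refine lt_of_le_of_ne (by omega) fun he => ?_
      have := cX_inj τ _ he
      rw [this] at hl
      omega
    let P : ℕ → ℕ := fun i => if i = 100 then us τ j else if i % 2 = 0 then A (i / 2) else B (i / 2)
    have P0 : P 100 = us τ j := by simp [P]
    have PP : ∀ i, i ≠ 100 → i % 2 = 0 ∧ P i = A (i / 2) ∨ i % 2 = 1 ∧ P i = B (i / 2) := fun i hi => by
      rcases Nat.mod_two_eq_zero_or_one i with h | h <;> simp [P, hi, h]
    clear_value P
    have Pl : ∀ i < 8, P i < τ.1 ∧ lay τ (P i) = j + 1 := fun i hi => by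
      rcases PP i (by omega) with ⟨_, h⟩ | ⟨_, h⟩ <;> rw [h]
      · exact ⟨hA _ (by omega), ha _ (by omega)⟩
      · exact ⟨hB _ (by omega), hb _ (by omega)⟩
    have Px : ∀ i < 8, ∀ k < 8, i < k → P i < P k := fun i hi k hk hik => by
      rcases (show i / 2 ≤ k / 2 by omega).eq_or_lt with h | h
      · have := (hAB (k / 2) (by omega)).1
        rcases PP i (by omega) with ⟨_, h1⟩ | ⟨_, h1⟩ <;> rcases PP k (by omega) with ⟨_, h2⟩ | ⟨_, h2⟩ <;> 
          rw [h1, h2] <;> first | omega | (rw [h]; exact this)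
      · have := hlt _ _ h (by omega)
        rcases PP i (by omega) with ⟨_, h1⟩ | ⟨_, h1⟩ <;> rcases PP k (by omega) with ⟨_, h2⟩ | ⟨_, h2⟩ <;> 
          rw [h1, h2] <;> omega
    have Py : ∀ i < 8, ∀ k < 8, i + 2 - 2 * (i % 2) < k + 2 - 2 * (k % 2) → ev τ (P i) < ev τ (P k) := fun i hi k hk hik => by
      rcases (show i / 2 ≤ k / 2 by omega).eq_or_lt with h | h
      · have := (hAB (k / 2) (by omega)).2
        rcases PP i (by omega) with ⟨_, h1⟩ | ⟨_, h1⟩ <;> rcases PP k (by omega) with ⟨_, h2⟩ | ⟨_, h2⟩ <;> 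
          rw [h1, h2] <;> first | omega | (rw [h]; exact this)
      · have := hlt _ _ h (by omega)
        rcases PP i (by omega) with ⟨_, h1⟩ | ⟨_, h1⟩ <;> rcases PP k (by omega) with ⟨_, h2⟩ | ⟨_, h2⟩ <;> 
          rw [h1, h2] <;> omega
    rcases Nat.mod_two_eq_zero_or_one j with h | h
    · have e1 : ∀ p, cX τ (j + 1) p = p := fun p => by rw [cX, if_pos (by omega)]
      have e2 : ∀ p, cX τ j p = ev τ p := fun p => by rw [cX, if_neg (by omega)]
      simp only [e1, e2] at ku
      have mem : ∀ i ∈ [100, 0, 1, 2, 3, 4, 5, 6, 7], i = 100 ∨ i < 8 := by decide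
      refine Dst_not hv1 hD P (fun i hi => ?_) (fun i hi k hk hik => ?_) fun i hi k hk hik => ?_
      · rcases mem i hi with rfl | h
        · rwa [P0]
        · exact (Pl i h).1
      · rcases mem i hi with rfl | h <;> rcases mem k hk with rfl | h'
        · omega
        · rw [P0]; exact (ku _ (Pl k h').1 (Pl k h').2).1
        · simp at hik
        · rw [if_neg (by omega), if_neg (by omega)] at hik
          exact Px i h k h' (by omega)
      · rcases mem i hi with rfl | h <;> rcases mem k hk with rfl | h'
        · omega
        · rw [if_pos rfl, if_neg (by omega)] at hik
          omega
        · rw [P0]; exact (ku _ (Pl i h).1 (Pl i h).2).2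
        · rw [if_neg (by omega), if_neg (by omega)] at hik
          exact Py i h k h' (by omega)
    · have e1 : ∀ p, cX τ (j + 1) p = ev τ p := fun p => by rw [cX, if_neg (by omega)]
      have e2 : ∀ p, cX τ j p = p := fun p => by rw [cX, if_pos (by omega)]
      simp only [e1, e2] at ku
      have mem : ∀ i ∈ [0, 1, 2, 3, 4, 5, 6, 7, 100], i = 100 ∨ i < 8 := by decide
      refine Dst_not hv2 hD P (fun i hi => ?_) (fun i hi k hk hik => ?_) fun i hi k hk hik => ?_
      · rcases mem i hi with rfl | h
        · rwa [P0]
        · exact (Pl i h).1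
      · rcases mem i hi with rfl | h <;> rcases mem k hk with rfl | h'
        · omega
        · omega
        · rw [P0]; exact (ku _ (Pl i h).1 (Pl i h).2).2
        · exact Px i h k h' (by omega)
      · rcases mem i hi with rfl | h <;> rcases mem k hk with rfl | h'
        · omega
        · rw [P0]; exact (ku _ (Pl k h').1 (Pl k h').2).1
        · rw [if_pos rfl] at hik
          omega
        · rw [if_neg (by omega), if_neg (by omega)] at hik
          exact Py i h k h' (by omega)
  · rcases Nat.mod_two_eq_zero_or_one b with h | h
    · have := key' 1 (by norm_num) (by unfold eb; split_ifs <;> omega) 1 (by norm_num) 0 (by norm_num)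
      rw [q1, q1] at this
      omega
    · have := key' 0 (by norm_num) (by unfold eb; split_ifs <;> omega) 1 (by norm_num) 0 (by norm_num)
      rw [q0, q0] at this
      omega

theorem no_chain {τ : Permu} (hτ : SI τ) (hD : τ ∈ Dst) {A B : ℕ → ℕ} {s T m : ℕ} (hm : m = 3 * T ^ 2 + 1)
    (hB : ∀ i < m, B i < τ.1) (hAB : ∀ i < m, A i < B i ∧ ev τ (B i) < ev τ (A i))
    (hlt : ∀ i j, i < j → j < m → A i < A j ∧ A i < B j ∧ B i < A j ∧ B i < B j ∧
      ev τ (A i) < ev τ (A j) ∧ ev τ (A i) < ev τ (B j) ∧ ev τ (B i) < ev τ (A j) ∧ ev τ (B i) < ev τ (B j))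
    (ha : ∀ i < m, s ≤ lay τ (A i) ∧ lay τ (A i) < s + T)
    (hb : ∀ i < m, s ≤ lay τ (B i) ∧ lay τ (B i) < s + T) : False := by
  classical
  obtain ⟨y, hy, hc⟩ := Finset.exists_lt_card_fiber_of_mul_lt_card_of_maps_to
    (s := Finset.range m) (t := Finset.Ico s (s + T) ×ˢ Finset.Ico s (s + T))
    (f := fun i => (lay τ (A i), lay τ (B i))) (n := 3)
    (fun i hi => by
      have := ha i (Finset.mem_range.1 hi)
      have := hb i (Finset.mem_range.1 hi)
      simp; omega) (by simp [hm]; nlinarith)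
  obtain ⟨t, ht, hcard⟩ := Finset.exists_subset_card_eq (Nat.succ_le_of_lt hc)
  let g := t.orderEmbOfFin hcard
  have hg : ∀ i, g i < m ∧ lay τ (A (g i)) = y.1 ∧ lay τ (B (g i)) = y.2 := fun i => by
    have := ht (t.orderEmbOfFin_mem hcard i)
    simp only [Finset.mem_filter, Finset.mem_range] at this
    exact ⟨this.1, by rw [← this.2], by rw [← this.2]⟩
  let G : ℕ → ℕ := fun i => if h : i < 4 then g ⟨i, h⟩ else 0
  have hG : ∀ i, (h : i < 4) → G i = g ⟨i, h⟩ := fun i h => by simp [G, h]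
  have hGm : ∀ i < 4, G i < m ∧ lay τ (A (G i)) = y.1 ∧ lay τ (B (G i)) = y.2 := fun i h => by
    rw [hG i h]; exact hg _
  have hGl : ∀ i j, i < j → j < 4 → G i < G j := fun i j h h4 => by
    rw [hG i (by omega), hG j h4]
    exact g.strictMono h
  exact no_chain4 hτ hD (A := fun i => A (G i)) (B := fun i => B (G i)) (fun i h => hB _ (hGm i h).1)
    (fun i h => hAB _ (hGm i h).1) (fun i j h h4 => hlt _ _ (hGl i j h h4) (hGm j h4).1)
    (fun i h => (hGm i h).2.1) (fun i h => (hGm i h).2.2)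

/-- Patterns spanning at most `T` layers. -/
def Fl (T : ℕ) : Set Permu := {σ | ∃ τ, SI τ ∧ τ ∈ Dst ∧ ∃ f : Fin σ.1 → Fin τ.1, Emb σ τ f ∧
  ∃ s, ∀ i, s ≤ lay τ (f i) ∧ lay τ (f i) < s + T}

theorem Fl_class (T : ℕ) : IsPermClass (Fl T) := by
  rintro σ π ⟨g, hg, h⟩ ⟨τ, h1, h2, f, hf, s, hs⟩
  refine ⟨τ, h1, h2, fun i => f (g i), fun a b => ⟨?_, ?_⟩, s, fun i => hs _⟩
  · rw [(hf _ _).1, hg.lt_iff_lt]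
  · rw [(hf _ _).2, h]

theorem Fl_Dst (T : ℕ) : Fl T ⊆ Dst := by
  rintro σ ⟨τ, h1, h2, f, hf, s, hs⟩
  exact Dst_class σ τ ⟨f, fun a b h => (hf a b).1.2 h, fun i j => (hf i j).2.symm⟩ h2

theorem LinSep.mono {k : ℕ} {C D : Set Permu} (h : C ⊆ D) (hl : LinSep k C) : LinSep k D := by
  obtain ⟨T, h1, h2⟩ := hl
  refine ⟨T, fun m => ?_, h2⟩
  obtain ⟨π, hπ, r⟩ := h1 m
  exact ⟨π, h hπ, r⟩

theorem Fl_inf {T : ℕ} {β : Permu} (h : InfSum (Fl T) β) : β ∈ MonoC := by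
  by_contra hm
  obtain ⟨a, b, c, d, -, -, -, -, hab, h1, hcd, h2⟩ := not_mono β.2 hm
  obtain ⟨π, ⟨τ, hτ, hD, f, hf, s, hs⟩, P, hP⟩ := h (3 * T ^ 2 + 1)
  refine no_chain hτ hD (A := fun i => f (P i a)) (B := fun i => f (P i b)) (s := s) (T := T) rfl
    (fun i hi => (f _).2) (fun i hi => ⟨?_, ?_⟩) (fun i j hij hj => ?_) (fun i hi => hs _) (fun i hi => hs _)
  · have := (hf (P i a) (P i b)).1.2 (((hP i hi).1 a b).1.2 hab)
    exact this
  · rw [ev_fin, ev_fin]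
    exact (hf (P i b) (P i a)).2.2 (((hP i hi).1 b a).2.2 h1)
  · have k1 := (hP i (by omega)).2 j hj hij
    have k2 : ∀ x y, (f (P i x) : ℕ) < f (P j y) ∧ ev τ (f (P i x)) < ev τ (f (P j y)) := fun x y => by
      rw [ev_fin, ev_fin]
      exact ⟨(hf _ _).1.2 (k1 x y).1, (hf _ _).2.2 (k1 x y).2⟩
    exact ⟨(k2 _ _).1, (k2 _ _).1, (k2 _ _).1, (k2 _ _).1, (k2 _ _).2, (k2 _ _).2, (k2 _ _).2, (k2 _ _).2⟩

theorem ev_prev (π : Permu) {p : ℕ} (hp : p < π.1) : ev (prev π) (π.1 - 1 - p) = ev π p := by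
  obtain ⟨n, π⟩ := π
  simp only at hp ⊢
  have h : n - 1 - p < n := by omega
  have : Fin.rev (⟨n - 1 - p, h⟩ : Fin n) = ⟨p, hp⟩ := by
    ext
    simp only [Fin.rev]
    omega
  refine (dif_pos h).trans ?_
  refine Eq.trans ?_ (dif_pos hp).symm
  exact congrArg (fun x => (π x : ℕ)) this

theorem Dst_inf {β : Permu} (h : InfSum (crev Dst) (prev β)) : β ∈ MonoC := by
  by_contra hm
  obtain ⟨a, b, c, d, -, -, -, -, hab, h1, hcd, h2⟩ := not_mono β.2 hm
  obtain ⟨π, hπ, P, hP⟩ := h 3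
  have hc : (prev β).2 (Fin.rev c) = β.2 c := congrArg β.2 (Fin.rev_rev c)
  have hd : (prev β).2 (Fin.rev d) = β.2 d := congrArg β.2 (Fin.rev_rev d)
  have hcd' : Fin.rev d < Fin.rev c := Fin.rev_lt_rev.2 hcd
  set c' : Fin (prev β).1 := Fin.rev c
  set d' : Fin (prev β).1 := Fin.rev d
  let Q : ℕ → Fin π.1 := fun i => if i % 2 = 0 then P (i / 2) d' else P (i / 2) c'
  have PP : ∀ i, i % 2 = 0 ∧ Q i = P (i / 2) d' ∨ i % 2 = 1 ∧ Q i = P (i / 2) c' := fun i => by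
    rcases Nat.mod_two_eq_zero_or_one i with h | h <;> simp [Q, h]
  clear_value Q
  have hP1 : ∀ i < 3, P i d' < P i c' ∧ π.2 (P i c') < π.2 (P i d') := fun i hi =>
    ⟨((hP i hi).1 _ _).1.2 hcd', ((hP i hi).1 _ _).2.2 (by rw [hc, hd]; exact h2)⟩
  have Px : ∀ i < 6, ∀ k < 6, i < k → Q i < Q k := fun i hi k hk hik => by
    rcases (show i / 2 ≤ k / 2 by omega).eq_or_lt with h | h
    · have := (hP1 (k / 2) (by omega)).1
      rcases PP i with ⟨_, h1⟩ | ⟨_, h1⟩ <;> rcases PP k with ⟨_, h2⟩ | ⟨_, h2⟩ <;> 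
        rw [h1, h2] <;> first | omega | (rw [h]; exact this)
    · have := (hP _ (by omega)).2 _ (by omega) h
      rcases PP i with ⟨_, h1⟩ | ⟨_, h1⟩ <;> rcases PP k with ⟨_, h2⟩ | ⟨_, h2⟩ <;> 
        rw [h1, h2] <;> exact (this _ _).1
  have Py : ∀ i < 6, ∀ k < 6, i + 2 - 2 * (i % 2) < k + 2 - 2 * (k % 2) → π.2 (Q i) < π.2 (Q k) := fun i hi k hk hik => by
    rcases (show i / 2 ≤ k / 2 by omega).eq_or_lt with h | h
    · have := (hP1 (k / 2) (by omega)).2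
      rcases PP i with ⟨_, h1⟩ | ⟨_, h1⟩ <;> rcases PP k with ⟨_, h2⟩ | ⟨_, h2⟩ <;> 
        rw [h1, h2] <;> first | omega | (rw [h]; exact this)
    · have := (hP _ (by omega)).2 _ (by omega) h
      rcases PP i with ⟨_, h1⟩ | ⟨_, h1⟩ <;> rcases PP k with ⟨_, h2⟩ | ⟨_, h2⟩ <;> 
        rw [h1, h2] <;> exact (this _ _).2
  have mem : ∀ i ∈ [5, 4, 3, 2, 1, 0], i < 6 := by decide
  refine Dst_not hv3 (π := prev π) hπ (fun i => π.1 - 1 - Q i) (fun i hi => ?_) (fun i hi k hk hik => ?_)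
    fun i hi k hk hik => ?_
  · have := (Q i).2
    show _ < π.1
    omega
  · have := Px k (mem k hk) i (mem i hi) (by omega)
    have h1 := (Q i).2
    rw [Fin.lt_def] at this
    show π.1 - 1 - _ < π.1 - 1 - _
    omega
  · rw [ev_prev π (Q i).2, ev_prev π (Q k).2, ev_fin, ev_fin]
    exact Py i (mem i hi) k (mem k hk) hik

theorem Fl_count (T : ℕ) : ∃ (K : ℝ) (d : ℕ), 0 ≤ K ∧ ∀ n, (pcount (Fl T) n : ℝ) ≤ K * (n + 1) ^ d := by
  have hinf : ∀ {β}, InfSum (crev (Fl T)) (prev β) → InfSum (crev Dst) (prev β) := fun h m => by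
    obtain ⟨π, hπ, r⟩ := h m
    exact ⟨π, Fl_Dst T hπ, r⟩
  obtain ⟨K, d, hK, h⟩ := slicing (C := Fl T) (G := MonoC) (flag := False) (B := 4) (Fl_class T) MonoC_class
    (fun π h => Or.inl fun a b _ _ hab => by omega) (fun π h => MonoC_basis π h)
    (fun _ => ⟨fun h => Dst_lin.1 (h.mono (Fl_Dst T)), fun h => Dst_lin.2 (h.mono fun π hπ => Fl_Dst T hπ)⟩)
    (fun h => h.elim) (fun β h => h.elim Fl_inf fun h => Dst_inf (hinf h)) (fun h => h.elim) (K := 2) (g := 1)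
    (by norm_num) le_rfl (fun h => h.elim) (fun m => by
      have := MonoC_count m
      simp
      exact_mod_cast this)
  exact ⟨K, d, hK, fun n => by simpa using h n⟩


/-- The data determining a long sum indecomposable member of `Dst`. -/
structure DtS {n : ℕ} (p : Equiv.Perm (Fin n)) (c1 d1 e1 c2 d2 e2 : ℕ) : Prop where
  h1 : ∀ i : Fin n, c1 ≤ (i : ℕ) ↔ d1 ≤ (p i : ℕ) ∨ (p i : ℕ) = e1
  h2 : ∀ i : Fin n, c2 ≤ (i : ℕ) ↔ d2 ≤ (p i : ℕ) ∨ (p i : ℕ) = e2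
  lo : pat p (Finset.univ.filter fun i : Fin n => (i : ℕ) < c1) ∈ Fl 12
  hi : pat p (Finset.univ.filter fun i : Fin n => c2 ≤ (i : ℕ)) ∈ Fl 12
  mid : ∃ L, IsStd (pat p (Finset.univ.filter fun i : Fin n => c1 ≤ (i : ℕ) ∧ (i : ℕ) < c2))
    (fun a : Fin L => kq 1 (a + 7)) (fun a : Fin L => kq 0 (a + 7))

theorem kq_inj {q a b : ℕ} (h : kq q a = kq q b) : a = b := by
  unfold kq at h
  split_ifs at h <;> omega

theorem Fl_pat {n : ℕ} {p : Equiv.Perm (Fin n)} (hτ : SI ⟨n, p⟩) (hD : (⟨n, p⟩ : Permu) ∈ Dst) {T : ℕ}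
    (S : Finset (Fin n)) (s : ℕ) (h : ∀ i ∈ S, s ≤ lay ⟨n, p⟩ i ∧ lay ⟨n, p⟩ i < s + T) : pat p S ∈ Fl T := by
  obtain ⟨Q, hQ, hS⟩ := ple_pat p (PLe.refl (pat p S))
  exact ⟨⟨n, p⟩, hτ, hD, Q, hQ, s, fun i => h _ (hS i)⟩

theorem us_iff {τ : Permu} (hτ : SI τ) {q a b : ℕ} (hq : q < 2) (ha : cs τ a < τ.1) (hb : cs τ b < τ.1) :
    cX τ q (us τ a) < cX τ q (us τ b) ↔ kq q a < kq q b := by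
  refine ⟨fun h => ?_, us_lt hτ hq ha hb⟩
  by_contra hc
  rcases (not_lt.1 hc).eq_or_lt with h1 | h1
  · rw [kq_inj h1] at h
    omega
  · have := us_lt hτ hq hb ha h1
    omega

theorem exists_dt {n : ℕ} {p : Equiv.Perm (Fin n)} (hτ : SI ⟨n, p⟩) (hD : (⟨n, p⟩ : Permu) ∈ Dst)
    (hF : (⟨n, p⟩ : Permu) ∉ Fl 12) : ∃ c1 d1 e1 c2 d2 e2 : Fin (n + 1), DtS p c1 d1 e1 c2 d2 e2 := by
  classical
  obtain ⟨τ, hτe⟩ : ∃ τ : Permu, τ = ⟨n, p⟩ := ⟨_, rfl⟩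
  have hn : τ.1 = n := by rw [hτe]
  rw [← hτe] at hτ hD
  have hm := cs_mono hτ
  have evp : ∀ i : Fin n, ev τ i = p i := fun i => by rw [hτe]; exact ev_fin ⟨n, p⟩ i
  have hex : ∃ j, cs τ j = n := ⟨n, by
    have h1 := cs_big hτ n
    have h2 := cs_le hτ n
    omega⟩
  obtain ⟨M, hM, hMm⟩ : ∃ M, cs τ M = n ∧ ∀ j < M, cs τ j < n := ⟨Nat.find hex, Nat.find_spec hex, fun j hj => by
    have h1 := Nat.find_min hex hj
    have h2 := cs_le hτ j
    omega⟩
  have hlay : ∀ i < n, lay τ i < M := fun i hi => by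
    by_contra hc
    have h1 := (le_lay hτ (j := M) (hn.symm ▸ hi)).1 (by omega)
    have h2 := cX_lt τ M (p := i) (hn.symm ▸ hi)
    rw [Ge] at h1
    omega
  have hM13 : 13 ≤ M := by
    by_contra hc
    refine hF ⟨⟨n, p⟩, hτe ▸ hτ, hτe ▸ hD, id, fun a b => ⟨Iff.rfl, Iff.rfl⟩, 0, fun i => ⟨by omega, ?_⟩⟩
    have := hlay i i.2
    rw [hτe] at this
    show lay ⟨n, p⟩ (i : ℕ) < 0 + 12
    omega
  obtain ⟨J, hJ1, hJ2, hJ3⟩ : ∃ J, J % 2 = 1 ∧ J + 4 ≤ M ∧ M ≤ J + 5 := by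
    rcases Nat.mod_two_eq_zero_or_one M with h | h
    · exact ⟨M - 5, by omega, by omega, by omega⟩
    · exact ⟨M - 4, by omega, by omega, by omega⟩
  have hcs : ∀ j, j ≤ J + 3 → cs τ j < τ.1 := fun j hj => by rw [hn]; exact hMm j (by omega)
  have single : ∀ i < n, 6 ≤ lay τ i → lay τ i ≤ J → i = us τ (lay τ i) := fun i hi h6 h =>
    mid_single hτ hD (by rwa [hn]) h6 (hcs _ (by omega))
  have key : ∀ j, j % 2 = 1 → 7 ≤ j → j ≤ J → (∀ i : Fin n, cs τ j ≤ i ↔ j ≤ lay τ i) ∧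
      ∀ i : Fin n, cs τ j ≤ (i : ℕ) ↔ cs τ (j + 1) ≤ (p i : ℕ) ∨ (p i : ℕ) = ev τ (us τ j) := by
    intro j h1 h7 hj
    have k1 : ∀ i : Fin n, cs τ j ≤ i ↔ j ≤ lay τ i := fun i => by
      rw [le_lay hτ (by rw [hn]; exact i.2), Ge, cX, if_pos h1]
    refine ⟨k1, fun i => ?_⟩
    have hi : (i : ℕ) < τ.1 := by rw [hn]; exact i.2
    have k2 : cs τ (j + 1) ≤ (p i : ℕ) ↔ j + 1 ≤ lay τ i := by
      rw [le_lay hτ hi, Ge, cX, if_neg (by omega), evp]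
    rw [k1, k2, ← evp]
    constructor
    · intro h
      rcases h.eq_or_lt with h | h
      · right
        have := single i i.2 (by omega) (by omega)
        rw [← h] at this
        rw [← this]
      · exact Or.inl h
    · rintro (h | h)
      · omega
      · rw [ev_inj τ h, (us_spec hτ (hcs j (by omega))).2.2]
  obtain ⟨a1, a2⟩ := key 7 (by norm_num) le_rfl (by omega)
  obtain ⟨b1, b2⟩ := key J hJ1 (by omega) le_rfl
  have lt1 : ∀ j, cs τ j < n + 1 := fun j => by have := cs_le hτ j; omega
  have lt2 : ∀ j, j ≤ J → ev τ (us τ j) < n + 1 := fun j hj => by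
    have := ev_lt (us_spec hτ (hcs j (by omega))).1
    omega
  have eqlay : ∀ i, lay τ i = lay ⟨n, p⟩ i := fun i => by rw [hτe]
  refine ⟨⟨_, lt1 7⟩, ⟨_, lt1 8⟩, ⟨_, lt2 7 (by omega)⟩, ⟨_, lt1 J⟩, ⟨_, lt1 (J + 1)⟩, ⟨_, lt2 J le_rfl⟩,
    a2, b2, ?_, ?_, J - 7, ?_⟩
  · refine Fl_pat (hτe ▸ hτ) (hτe ▸ hD) _ 0 fun i hi => ?_
    simp only [Finset.mem_filter, Finset.mem_univ, true_and] at hi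
    rw [← eqlay]
    have := a1 i
    omega
  · refine Fl_pat (hτe ▸ hτ) (hτe ▸ hD) _ J fun i hi => ?_
    simp only [Finset.mem_filter, Finset.mem_univ, true_and] at hi
    rw [← eqlay]
    have := b1 i
    have := hlay i i.2
    omega
  · set S := Finset.univ.filter fun i : Fin n => cs τ 7 ≤ (i : ℕ) ∧ (i : ℕ) < cs τ J with hS
    have hSm : ∀ i : Fin n, i ∈ S ↔ 7 ≤ lay τ i ∧ lay τ i < J := fun i => by
      simp only [hS, Finset.mem_filter, Finset.mem_univ, true_and]
      have := a1 i
      have := b1 i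
      omega
    clear_value S
    have usn : ∀ a : Fin (J - 7), us τ (a + 7) < n ∧ lay τ (us τ (a + 7)) = a + 7 := fun a => by
      have := us_spec hτ (hcs (a + 7) (by omega))
      exact ⟨hn ▸ this.1, this.2.2⟩
    let G : Fin (J - 7) → S := fun a => ⟨⟨us τ (a + 7), (usn a).1⟩, (hSm _).2 (by
      show 7 ≤ lay τ (us τ (a + 7)) ∧ lay τ (us τ (a + 7)) < J
      rw [(usn a).2]
      omega)⟩
    have Gv : ∀ a, ((G a).1 : ℕ) = us τ (a + 7) := fun a => rfl
    have Gb : Function.Bijective G := by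
      constructor
      · intro a b hab
        have h1 := congrArg (fun z : S => lay τ z.1) hab
        simp only [Gv, (usn _).2] at h1
        omega
      · rintro ⟨i, hi⟩
        have h1 := (hSm i).1 hi
        refine ⟨⟨lay τ i - 7, by omega⟩, Subtype.ext (Fin.ext ?_)⟩
        rw [Gv]
        have := single i i.2 (by omega) (by omega)
        simp only [show lay τ i - 7 + 7 = lay τ i by omega]
        exact this.symm
    clear_value G
    obtain ⟨e, h1, h2⟩ := pat_std p S
    let g := Equiv.ofBijective G Gb
    have hg : ∀ i, (e i).1 = (G (g.symm (e i))).1 := fun i => by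
      have := g.apply_symm_apply (e i)
      exact congrArg Subtype.val this.symm
    have q0 : ∀ p, cX τ 0 p = ev τ p := fun p => by simp [cX]
    have q1 : ∀ p, cX τ 1 p = p := fun p => by simp [cX]
    refine ⟨e.trans g.symm, fun i j => ?_, fun i j => ?_⟩
    · rw [h1]
      beta_reduce
      rw [hg i, hg j, Fin.lt_def, Gv, Gv]
      have := us_iff hτ (q := 1) (by norm_num) (hcs (g.symm (e i) + 7) (by omega)) (hcs (g.symm (e j) + 7) (by omega))
      rw [q1, q1] at this
      exact this
    · rw [h2]
      beta_reduce
      rw [hg i, hg j, Fin.lt_def, ← evp, ← evp, Gv, Gv]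
      have := us_iff hτ (q := 0) (by norm_num) (hcs (g.symm (e i) + 7) (by omega)) (hcs (g.symm (e j) + 7) (by omega))
      rw [q0, q0] at this
      exact this

theorem DtS.eq {n : ℕ} {p p' : Equiv.Perm (Fin n)} {c1 d1 e1 c2 d2 e2 : ℕ} (h : DtS p c1 d1 e1 c2 d2 e2)
    (h' : DtS p' c1 d1 e1 c2 d2 e2)
    (hl : pat p (Finset.univ.filter fun i : Fin n => (i : ℕ) < c1) = pat p' (Finset.univ.filter fun i : Fin n => (i : ℕ) < c1))
    (hh : pat p (Finset.univ.filter fun i : Fin n => c2 ≤ (i : ℕ)) = pat p' (Finset.univ.filter fun i : Fin n => c2 ≤ (i : ℕ))) :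
    p = p' := by
  have hmid : pat p (Finset.univ.filter fun i : Fin n => c1 ≤ (i : ℕ) ∧ (i : ℕ) < c2) =
      pat p' (Finset.univ.filter fun i : Fin n => c1 ≤ (i : ℕ) ∧ (i : ℕ) < c2) := by
    obtain ⟨L, h1⟩ := h.mid
    obtain ⟨L', h2⟩ := h'.mid
    have e1 := h1.card
    have e2 := h2.card
    rw [pat_card] at e1 e2
    have : L = L' := by simpa using e1.symm.trans e2
    subst this
    exact h1.unique h2 (Equiv.refl _) (fun _ _ => Iff.rfl) (fun _ _ => Iff.rfl)
  refine color_eq p p' (fun i => (decide (c1 ≤ (i : ℕ)), decide (c2 ≤ (i : ℕ)))) (fun v => ?_) fun i j hij => ?_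
  · have k1 := h.h1 (p.symm v)
    have k2 := h.h2 (p.symm v)
    have k3 := h'.h1 (p'.symm v)
    have k4 := h'.h2 (p'.symm v)
    rw [Equiv.apply_symm_apply] at k1 k2 k3 k4
    simp only [k1, k2, k3, k4]
  · simp only [Prod.mk.injEq, decide_eq_decide] at hij
    by_cases k1 : c2 ≤ (i : ℕ)
    · exact pat_eq_iff hh (by simpa using k1) (by simpa using hij.2.1 k1)
    by_cases k2 : c1 ≤ (i : ℕ)
    · exact pat_eq_iff hmid (by simpa using ⟨k2, by omega⟩) (by simp; omega)
    · exact pat_eq_iff hl (by simp; omega) (by simp; omega)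

theorem Dst_big_count (n : ℕ) : pcount ((Dst ∩ {π | SI π}) \ Fl 12) n ≤
    (n + 1) ^ 6 * (∑ k ∈ Finset.range (n + 1), pcount (Fl 12) k) ^ 2 := by
  classical
  set A := PC ((Dst ∩ {π | SI π}) \ Fl 12) n with hA
  have ex : ∀ p : A, ∃ t : Fin (n + 1) × Fin (n + 1) × Fin (n + 1) × Fin (n + 1) × Fin (n + 1) × Fin (n + 1),
      DtS p.1 t.1 t.2.1 t.2.2.1 t.2.2.2.1 t.2.2.2.2.1 t.2.2.2.2.2 := by
    rintro ⟨p, hp⟩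
    rw [hA, mem_PC] at hp
    obtain ⟨c1, d1, e1, c2, d2, e2, h⟩ := exists_dt hp.1.2 hp.1.1 hp.2
    exact ⟨⟨c1, d1, e1, c2, d2, e2⟩, h⟩
  choose t ht using ex
  let U : Finset Permu := (Finset.range (n + 1)).biUnion (PS (Fl 12))
  have hU : U.card ≤ ∑ k ∈ Finset.range (n + 1), pcount (Fl 12) k :=
    Finset.card_biUnion_le.trans (Finset.sum_le_sum fun k _ => (card_PS _ _).le)
  have mU : ∀ (p : Equiv.Perm (Fin n)) (S : Finset (Fin n)), pat p S ∈ Fl 12 → pat p S ∈ U := fun p S h => by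
    simp only [U, Finset.mem_biUnion, Finset.mem_range, mem_PS]
    exact ⟨S.card, Nat.lt_succ_of_le ((Finset.card_le_univ S).trans (by simp)), h, pat_card p S⟩
  have := Finset.card_le_card_of_injOn (s := A.attach) (t := Finset.univ ×ˢ U ×ˢ U)
    (fun p => (t p, pat p.1 (Finset.univ.filter fun i : Fin n => (i : ℕ) < (t p).1),
      pat p.1 (Finset.univ.filter fun i : Fin n => ((t p).2.2.2.1 : ℕ) ≤ (i : ℕ))))
    (fun p _ => by simp [mU _ _ (ht p).lo, mU _ _ (ht p).hi]) (fun p _ p' _ h => by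
      simp only [Prod.mk.injEq] at h
      obtain ⟨h1, h2, h3⟩ := h
      have hp := ht p
      have hp' := ht p'
      rw [← h1] at hp' h2 h3
      exact Subtype.ext (hp.eq hp' h2 h3))
  rw [pcount_eq, ← hA, ← Finset.card_attach]
  refine this.trans ?_
  rw [Finset.card_product, Finset.card_product, Finset.card_univ]
  simp only [Fintype.card_prod, Fintype.card_fin]
  calc _ = (n + 1) ^ 6 * U.card ^ 2 := by ring
    _ ≤ _ := by gcongr

theorem Dst_count : ∃ (K : ℝ) (d : ℕ), 0 ≤ K ∧ ∀ n, (sic Dst n : ℝ) ≤ K * (n + 1) ^ d := by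
  classical
  obtain ⟨K, d, hK, h⟩ := Fl_count 12
  refine ⟨K + K ^ 2, 2 * d + 8, by positivity, fun n => ?_⟩
  have h1 : sic Dst n ≤ pcount (Fl 12) n + pcount ((Dst ∩ {π | SI π}) \ Fl 12) n := by
    rw [sic, pcount_eq, pcount_eq, pcount_eq]
    refine (Finset.card_le_card fun p hp => ?_).trans (Finset.card_union_le _ _)
    rw [mem_PC] at hp
    rw [Finset.mem_union, mem_PC, mem_PC]
    by_cases hF : (⟨n, p⟩ : Permu) ∈ Fl 12
    · exact Or.inl hF
    · exact Or.inr ⟨hp, hF⟩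
  have h2 := Dst_big_count n
  set Q := ∑ k ∈ Finset.range (n + 1), pcount (Fl 12) k
  have hQ : (Q : ℝ) ≤ K * (n + 1) ^ (d + 1) := by
    simp only [Q, Nat.cast_sum]
    refine (Finset.sum_le_card_nsmul _ _ (K * (n + 1) ^ d) fun k hk => (h k).trans ?_).trans ?_
    · have : (k : ℝ) ≤ n := by exact_mod_cast Nat.lt_succ_iff.1 (Finset.mem_range.1 hk)
      gcongr
    · rw [Finset.card_range, nsmul_eq_mul, pow_succ]
      push_cast
      linarith
  have h3 : (sic Dst n : ℝ) ≤ pcount (Fl 12) n + (n + 1) ^ 6 * (Q : ℝ) ^ 2 := by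
    exact_mod_cast h1.trans (Nat.add_le_add_left h2 _)
  have h4 := h n
  have hn : (1 : ℝ) ≤ n + 1 := by have := n.cast_nonneg (α := ℝ); linarith
  have hQ0 : (0 : ℝ) ≤ Q := Nat.cast_nonneg _
  generalize (n : ℝ) + 1 = y at *
  calc (sic Dst n : ℝ) ≤ K * y ^ d + y ^ 6 * (K * y ^ (d + 1)) ^ 2 := by
        refine h3.trans (add_le_add h4 ?_)
        gcongr
    _ = K * y ^ d + K ^ 2 * y ^ (2 * d + 8) := by ring
    _ ≤ K * y ^ (2 * d + 8) + K ^ 2 * y ^ (2 * d + 8) := by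
        have := pow_le_pow_right₀ hn (show d ≤ 2 * d + 8 by omega)
        gcongr
    _ = _ := by ring


theorem tl_lem {g1 g2 : ℝ} (h1 : 1 ≤ g1) (h12 : g1 < g2) (h3 : g1 ≤ 2.3053) : ∃ N : ℕ, 8 ≤ N ∧
    ∀ D, IsPermClass D → Wt D g1 N ≤ 1 → ∀ N', Wt D g2 N' < 1 := by
  obtain ⟨K, d, hK, hc⟩ := Dst_count
  have g10 : 0 < g1 := by linarith
  have g20 : 0 < g2 := by linarith
  have hr1 : 1 / g2 < 1 := by rw [div_lt_one g20]; linarith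
  have hr0 : 0 < 1 / g2 := by positivity
  have hs : Summable fun k : ℕ => K * (k + 1 : ℝ) ^ d / g2 ^ k := by
    have := summable_pow_mul_geometric_of_norm_lt_one (R := ℝ) d (r := 1 / g2)
      (by rw [Real.norm_of_nonneg hr0.le]; exact hr1)
    have := ((summable_nat_add_iff 1).2 this).mul_left (K * g2)
    refine this.congr fun k => ?_
    push_cast
    rw [div_pow, one_pow, pow_succ]
    field_simp
  have he : 0 < 1 - g1 / g2 := by rw [sub_pos, div_lt_one g20]; exact h12
  obtain ⟨s, hs⟩ := summable_iff_vanishing_norm.1 hs _ he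
  refine ⟨s.sup id + 8, by omega, fun D hD hW N' => ?_⟩
  set N := s.sup id + 8 with hN
  have hsub : D ⊆ Dst := fun π hπ => by
    rw [Dst, Set.mem_setOf_eq]
    calc Wt (SubCl π) 2.3053 7 ≤ Wt (SubCl π) g1 7 := Wt_anti g10 h3 7
      _ ≤ Wt (SubCl π) g1 N := Wt_mono_N g10 (by omega)
      _ ≤ Wt D g1 N := Wt_mono (fun σ h => hD σ π h hπ) g10 N
      _ ≤ 1 := hW
  have e1 : Wt D g2 N ≤ g1 / g2 * Wt D g1 N := by
    rw [Wt, Wt, Finset.mul_sum]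
    refine Finset.sum_le_sum fun k hk => ?_
    have hk1 := (Finset.mem_Icc.1 hk).1
    obtain ⟨j, rfl⟩ : ∃ j, k = j + 1 := ⟨k - 1, by omega⟩
    have hz : (0:ℝ) ≤ sic D (j+1) := Nat.cast_nonneg _
    generalize (sic D (j+1) : ℝ) = z at *
    have h5 : g1 ^ j ≤ g2 ^ j := pow_le_pow_left₀ g10.le h12.le j
    have h6 : 0 < g1 ^ j := by positivity
    have : g1 / g2 * (z / g1 ^ (j+1)) = z / (g2 * g1 ^ j) := by rw [pow_succ]; field_simp
    rw [this, pow_succ']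
    exact div_le_div_of_nonneg_left hz (by positivity) (mul_le_mul_of_nonneg_left h5 g20.le)
  have e2 : Wt D g2 N' ≤ Wt D g2 N + ∑ k ∈ Finset.Icc (N+1) N', K * (k + 1 : ℝ) ^ d / g2 ^ k := by
    refine (Wt_mono_N g20 (le_max_left N' N)).trans ?_
    rw [Wt, Wt]
    have : Finset.Icc 1 (max N' N) ⊆ Finset.Icc 1 N ∪ Finset.Icc (N+1) N' := by
      intro k; simp only [Finset.mem_Icc, Finset.mem_union]; omega
    refine (Finset.sum_le_sum_of_subset_of_nonneg this fun _ _ _ => by positivity).trans ?_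
    rw [Finset.sum_union (by
      rw [Finset.disjoint_left]; intro k; simp only [Finset.mem_Icc]; omega)]
    gcongr with k hk
    exact (Nat.cast_le.2 (sic_mono hsub k)).trans (hc k)
  have e3 := hs (Finset.Icc (N+1) N') (by
    rw [Finset.disjoint_left]; intro k hk hk2
    have := Finset.le_sup (f := id) hk2
    simp only [Finset.mem_Icc, id] at *; omega)
  have e4 := (le_abs_self _).trans_lt e3
  have : g1 / g2 * Wt D g1 N ≤ g1 / g2 := mul_le_of_le_one_right (by positivity) hW
  linarith

theorem lim_lem {u : ℕ → ℝ} (hu : ∀ n, 0 ≤ u n) {g B : ℝ} (hg : 0 ≤ g) (hB : g < B)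
    (hup : ∀ b, g < b → b < B → ∃ (K : ℝ) (d : ℕ), 0 ≤ K ∧ ∀ n, u n ≤ K * (n + 1) ^ d * b ^ n)
    (hlo : ∀ c, 0 < c → c < g → ∃ (K : ℝ) (d : ℕ), 0 < K ∧ ∀ n : ℕ, c ^ n ≤ K * (n + 1) ^ d * u n) :
    Tendsto (fun n : ℕ => u n ^ ((n : ℝ)⁻¹)) atTop (nhds g) := by
  have hn1 : ∀ {n : ℕ} (d : ℕ), 1 ≤ n → (n + 1 : ℝ) ^ d ≤ 2 ^ d * (n : ℝ) ^ d := fun {n} d hn => by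
    rw [← mul_pow]
    have : (1 : ℝ) ≤ n := by exact_mod_cast hn
    exact pow_le_pow_left₀ (by positivity) (by linarith) d
  refine tendsto_order.2 ⟨fun c hc => ?_, fun b hb => ?_⟩
  · rcases lt_or_ge c 0 with h | h
    · exact Eventually.of_forall fun n => h.trans_le (Real.rpow_nonneg (hu n) _)
    obtain ⟨c1, h1, h2⟩ := exists_between hc
    obtain ⟨c2, h3, h4⟩ := exists_between h2
    have p1 : 0 < c1 := by linarith
    obtain ⟨K, d, hK, hk⟩ := hlo c2 (by linarith) h4
    filter_upwards [exp_contra p1 h3 d (K * 2 ^ d), eventually_ge_atTop 1] with n hn hn'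
    have q : c1 ^ n < u n := by
      by_contra hh
      push Not at hh
      refine absurd hn (not_lt.2 ((hk n).trans ?_))
      calc K * (n + 1 : ℝ) ^ d * u n ≤ K * (2 ^ d * (n : ℝ) ^ d) * c1 ^ n :=
            mul_le_mul (mul_le_mul_of_nonneg_left (hn1 d hn') hK.le) hh (hu n) (by positivity)
        _ = _ := by ring
    refine h1.trans_le ?_
    calc c1 = (c1 ^ n) ^ ((n : ℝ)⁻¹) := (Real.pow_rpow_inv_natCast p1.le (by omega)).symm
      _ ≤ _ := Real.rpow_le_rpow (by positivity) q.le (by positivity)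
  · obtain ⟨b2, h1, h2⟩ := exists_between (lt_min hb hB)
    obtain ⟨b1, h3, h4⟩ := exists_between h1
    have h5 := lt_min_iff.1 h2
    obtain ⟨K, d, hK, hk⟩ := hup b1 h3 (by linarith)
    filter_upwards [exp_contra (hg.trans_lt h3) h4 d (K * 2 ^ d), eventually_ge_atTop 1] with n hn hn'
    have p1 : 0 < b1 := by linarith
    have q : u n ≤ b2 ^ n := by
      refine (hk n).trans (le_trans ?_ hn.le)
      calc K * (n + 1 : ℝ) ^ d * b1 ^ n ≤ K * (2 ^ d * (n : ℝ) ^ d) * b1 ^ n :=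
            mul_le_mul_of_nonneg_right (mul_le_mul_of_nonneg_left (hn1 d hn') hK) (by positivity)
        _ = _ := by ring
    refine lt_of_le_of_lt ?_ h5.1
    calc _ ≤ (b2 ^ n) ^ ((n : ℝ)⁻¹) := Real.rpow_le_rpow (hu n) q (by positivity)
      _ = b2 := Real.pow_rpow_inv_natCast (by linarith) (by omega)

/-- All permutations of length at most `N`. -/
def EN (N : ℕ) : Finset Permu := (Finset.range (N + 1)).sigma fun _ => Finset.univ

theorem mem_EN {N : ℕ} {σ : Permu} : σ ∈ EN N ↔ σ.1 ≤ N := by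
  simp [EN, Finset.mem_sigma, Nat.lt_succ_iff]

theorem basis_lem (N : ℕ) (π : Permu) : ∃ β, PLe β π ∧ β.1 ≤ (EN N).card * N ∧
    ∀ σ, PLe σ π → σ.1 ≤ N → PLe σ β := by
  classical
  have : ∀ σ : Permu, ∃ S : Finset (Fin π.1), S.card ≤ σ.1 ∧ (PLe σ π → 
    ∃ f : Fin σ.1 → Fin π.1, (∀ i, f i ∈ S) ∧ StrictMono f ∧
    ∀ i j : Fin σ.1, σ.2 i < σ.2 j ↔ π.2 (f i) < π.2 (f j)) := fun σ => by
    by_cases h : PLe σ π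
    · obtain ⟨f, hf⟩ := h
      refine ⟨Finset.univ.image f, Finset.card_image_le.trans (by simp), fun _ => ⟨f, fun i => ?_, hf⟩⟩
      exact Finset.mem_image_of_mem f (Finset.mem_univ i)
    · exact ⟨∅, by simp, fun h' => absurd h' h⟩
  choose S hS1 hS2 using this
  let T := (EN N).biUnion S
  obtain ⟨Q, hQ, hT⟩ := pat_emb π.2 T
  refine ⟨pat π.2 T, pat_ple _ _, ?_, fun σ h hN => ?_⟩
  · rw [pat_card]
    exact Finset.card_biUnion_le_card_mul _ _ _ fun σ hσ => (hS1 σ).trans (mem_EN.1 hσ)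
  · obtain ⟨f, h1, h2, h3⟩ := hS2 σ h
    choose q hq using fun i => hT (f i) (Finset.mem_biUnion.2 ⟨σ, mem_EN.2 hN, h1 i⟩)
    refine ⟨q, fun i j hij => ?_, fun i j => ?_⟩
    · rw [← (hQ _ _).1, hq, hq]; exact h2 hij
    · rw [h3, ← hq i, ← hq j]; exact (hQ _ _).2

theorem sic_cong {C D : Set Permu} {k : ℕ} (h : ∀ σ : Permu, σ.1 = k → SI σ → (σ ∈ C ↔ σ ∈ D)) : sic C k = sic D k := by
  rw [sic, sic, pcount, pcount]
  congr 1
  ext σ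
  simp only [Set.mem_setOf_eq, Set.mem_inter_iff]
  constructor
  · rintro ⟨⟨a, b⟩, c⟩; exact ⟨⟨(h σ c b).1 a, b⟩, c⟩
  · rintro ⟨⟨a, b⟩, c⟩; exact ⟨⟨(h σ c b).2 a, b⟩, c⟩

theorem Wt_cong {C D : Set Permu} {g : ℝ} {N : ℕ} (h : ∀ σ : Permu, σ.1 ≤ N → SI σ → (σ ∈ C ↔ σ ∈ D)) : Wt C g N = Wt D g N :=
  Finset.sum_congr rfl fun k hk => by
    rw [sic_cong fun σ h1 h2 => h σ (by have := (Finset.mem_Icc.1 hk).2; omega) h2]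

/-- Members of low local weight. -/
def G1 (a : ℝ) (N : ℕ) : Set Permu := {π | Wt (SubCl π) a N ≤ 1}

theorem G1_class {a : ℝ} (ha : 0 < a) (N : ℕ) : IsPermClass (G1 a N) := fun _ _ h hπ =>
  (Wt_mono (fun _ h' => PLe.trans h' h) ha N).trans hπ

theorem G1_basis {a : ℝ} (N : ℕ) {π β : Permu} (hπ : π ∉ G1 a N) (h1 : PLe β π)
    (h2 : ∀ σ, PLe σ π → σ.1 ≤ N → PLe σ β) : β ∉ G1 a N := by
  rw [G1, Set.mem_setOf_eq] at *
  rwa [Wt_cong (C := SubCl β) (D := SubCl π) fun σ hσ _ => ⟨fun h => PLe.trans h h1, fun h => h2 σ h hσ⟩]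

theorem G1_one {a : ℝ} (ha : 1 ≤ a) (N : ℕ) {π : Permu} (hπ : π.1 ≤ 1) : π ∈ G1 a N := by
  have : Wt (SubCl π) a N ≤ Wt (SubCl π) a 1 := by
    rw [Wt, Wt]
    refine (Finset.sum_le_sum_of_subset_of_nonneg (Finset.Icc_subset_Icc_right (le_max_left N 1)) fun _ _ _ => by positivity).trans ?_
    refine (Finset.sum_subset (Finset.Icc_subset_Icc_right (le_max_right N 1)) fun k h1 h2 => ?_).ge
    simp only [Finset.mem_Icc] at h1 h2
    have : sic (SubCl π) k = 0 := by
      rw [sic, ← card_PS, Finset.card_eq_zero, Finset.eq_empty_iff_forall_notMem]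
      intro σ hσ
      obtain ⟨⟨h, -⟩, h'⟩ := mem_PS.1 hσ
      have := PLe.card_le h
      omega
    rw [this]; simp
  refine this.trans ?_
  have h1 : sic (SubCl π) 1 ≤ 1 := by
    rw [sic, pcount_eq]
    exact (Finset.card_le_univ _).trans (by simp [Fintype.card_perm])
  rw [Wt, Finset.Icc_self, Finset.sum_singleton, pow_one, div_le_one (by linarith)]
  exact le_trans (by exact_mod_cast h1) ha

/-- Permutations all of whose short indecomposables lie in `I`. -/
def DI (N : ℕ) (I : Finset Permu) : Set Permu := {σ | ∀ τ, PLe τ σ → SI τ → τ.1 ≤ N → τ ∈ I}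

theorem G1_count {a b : ℝ} (ha : 0 < a) (hb : 0 < b) {N : ℕ}
    (hN : ∀ D, IsPermClass D → Wt D a N ≤ 1 → ∀ N', Wt D b N' < 1) (m : ℕ) :
    (pcount (G1 a N) m : ℝ) ≤ 2 ^ (EN N).card * b ^ m := by
  classical
  let P := (EN N).powerset.filter fun I => Wt (DI N I) a N ≤ 1
  have h1 : PS (G1 a N) m ⊆ P.biUnion fun I => PS (DI N I) m := by
    intro π hπ
    obtain ⟨h1, h2⟩ := mem_PS.1 hπ
    refine Finset.mem_biUnion.2 ⟨(EN N).filter fun τ => PLe τ π, ?_, ?_⟩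
    · refine Finset.mem_filter.2 ⟨Finset.mem_powerset.2 (Finset.filter_subset _ _), ?_⟩
      refine le_trans (le_of_eq (Wt_cong fun σ hσ hs => ⟨fun h => ?_, fun h => ?_⟩)) h1
      · exact (Finset.mem_filter.1 (h σ (PLe.refl σ) hs hσ)).2
      · intro τ h3 _ h5
        exact Finset.mem_filter.2 ⟨mem_EN.2 h5, PLe.trans h3 h⟩
    · exact mem_PS.2 ⟨fun τ h3 _ h5 => Finset.mem_filter.2 ⟨mem_EN.2 h5, h3⟩, h2⟩
  have h2 : ∀ I ∈ P, ((PS (DI N I) m).card : ℝ) ≤ b ^ m := fun I hI => by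
    rw [card_PS]
    have hc : IsPermClass (DI N I) := fun σ π h hπ τ h1 => hπ τ (PLe.trans h1 h)
    exact Wt_upper hc hb (fun N' => (hN _ hc (Finset.mem_filter.1 hI).2 N').le) m
  calc (pcount (G1 a N) m : ℝ) = (PS (G1 a N) m).card := by rw [card_PS]
    _ ≤ ∑ I ∈ P, ((PS (DI N I) m).card : ℝ) := by
        exact_mod_cast (Finset.card_le_card h1).trans Finset.card_biUnion_le
    _ ≤ ∑ I ∈ P, b ^ m := Finset.sum_le_sum h2
    _ = P.card * b ^ m := by rw [Finset.sum_const, nsmul_eq_mul]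
    _ ≤ _ := by
      have : P.card ≤ 2 ^ (EN N).card := (Finset.card_filter_le _ _).trans (Finset.card_powerset _).le
      have : (P.card : ℝ) ≤ 2 ^ (EN N).card := by exact_mod_cast this
      exact mul_le_mul_of_nonneg_right this (by positivity)

theorem exp_bd {a b : ℝ} (ha : 0 < a) (hab : a < b) (d : ℕ) : ∃ K : ℝ, 0 ≤ K ∧ ∀ n : ℕ, (n + 1 : ℝ) ^ d * a ^ n ≤ K * b ^ n := by
  have hb : 0 < b := ha.trans hab
  obtain ⟨N, hN⟩ := eventually_atTop.1 (exp_contra ha hab d (2 ^ d))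
  have h0 : 0 ≤ ∑ k ∈ Finset.range (N + 1), (k + 1 : ℝ) ^ d * a ^ k / b ^ k :=
    Finset.sum_nonneg fun _ _ => by positivity
  refine ⟨1 + ∑ k ∈ Finset.range (N + 1), (k + 1 : ℝ) ^ d * a ^ k / b ^ k, by linarith, fun n => ?_⟩
  rcases lt_or_ge n (N + 1) with h | h
  · have := Finset.single_le_sum (f := fun k : ℕ => (k + 1 : ℝ) ^ d * a ^ k / b ^ k) (fun _ _ => by positivity) (Finset.mem_range.2 h)
    have h2 := (div_le_iff₀ (by positivity)).1 this
    have h3 : 0 < b ^ n := by positivity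
    linarith
  · have h1 : (1 : ℝ) ≤ n := by exact_mod_cast (by omega : 1 ≤ n)
    have h2 : (n + 1 : ℝ) ^ d ≤ 2 ^ d * (n : ℝ) ^ d := by
      rw [← mul_pow]; exact pow_le_pow_left₀ (by positivity) (by linarith) d
    have h3 := hN n (by omega)
    have h4 := mul_le_mul_of_nonneg_right h2 (by positivity : 0 ≤ a ^ n)
    have h5 : 0 < b ^ n := by positivity
    have h6 := mul_nonneg h0 h5.le
    linarith

theorem upper_lem {C : Set Permu} (hC : IsPermClass C) {x : ℝ} (hx : 0 < x) (hx2 : x < 2.3053)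
    (hT : Thin C x) {a b : ℝ} (ha : 1 ≤ a) (hab : a < b) (ha2 : a ≤ 2.3053) (flag : Prop)
    (hf : flag → 2 < b) (n2 : ¬ flag → ¬ LinSep 2 C ∧ ¬ LinSep 2 (cinv C))
    (hno : ∀ D, IsPermClass D → SumClosed D → D ⊆ C ∨ D ⊆ crev C → ∀ N, Wt D a N ≤ 1) :
    ∃ (K : ℝ) (d : ℕ), 0 ≤ K ∧ ∀ n, (pcount C n : ℝ) ≤ K * (n + 1) ^ d * b ^ n := by
  classical
  have a0 : 0 < a := by linarith
  have b0 : 0 < b := by linarith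
  obtain ⟨N, hN8, hN⟩ := tl_lem ha hab ha2
  have hTi : Thin (cinv C) x := by
    refine hT.mono fun n hn => ?_
    rwa [pcount_cinv]
  let G : Set Permu := {π | π ∈ G1 a N ∨ prev π ∈ G1 a N ∨ (flag ∧ π ∈ Jc)}
  have hGc : IsPermClass G := by
    rintro σ π h (h1 | h1 | ⟨h1, h2⟩)
    · exact Or.inl (G1_class a0 N _ _ h h1)
    · exact Or.inr (Or.inl (G1_class a0 N _ _ h.prev h1))
    · exact Or.inr (Or.inr ⟨h1, Jc_class _ _ h h2⟩)
  obtain ⟨K1, hK1, hJ⟩ : ∃ K1 : ℝ, 0 ≤ K1 ∧ (flag → ∀ m, (pcount Jc m : ℝ) ≤ K1 * b ^ m) := by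
    by_cases h : flag
    · obtain ⟨K, hK, h1⟩ := exp_bd two_pos (hf h) 2
      refine ⟨4 * K, by linarith, fun _ m => (Jc_count m).trans ?_⟩
      have := h1 m
      linarith
    · exact ⟨0, le_rfl, fun h' => absurd h' h⟩
  refine slicing (G := G) (flag := flag) (B := (EN N).card * N) hC hGc (fun π h => Or.inl (G1_one ha N h)) ?_ n2
    (fun _ => ⟨⟨K2_false hC hx hx2 hT, K1_false hC hx hx2 hT⟩, K2_false hC.cinv hx hx2 hTi,
      K1_false hC.cinv hx hx2 hTi, K3_false hC.cinv hx hx2 hTi⟩) ?_ (fun h π hπ => Or.inr (Or.inr ⟨h, hπ⟩))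
    (K := 2 ^ (EN N).card + 2 ^ (EN N).card + K1) (by positivity) (ha.trans hab.le) (fun h => (hf h).le) ?_
  · intro π hπ
    obtain ⟨β, h1, h2, h3⟩ := basis_lem N π
    refine ⟨β, h1, ?_, h2⟩
    rintro (h | h | ⟨h, h'⟩)
    · exact G1_basis N (fun h' => hπ (Or.inl h')) h1 h3 h
    · refine G1_basis N (fun h' => hπ (Or.inr (Or.inl h'))) h1.prev (fun σ hs hn => ?_) h
      have := h3 (prev σ) (by simpa [prev_prev] using hs.prev) hn
      simpa [prev_prev] using this.prev
    · obtain ⟨β', k1, k2, k3⟩ := Jc_basis π (fun h' => hπ (Or.inr (Or.inr ⟨h, h'⟩)))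
      exact k2 (Jc_class _ _ (h3 β' k1 (by omega)) h')
  · rintro β (h | h)
    · exact Or.inl ((Wt_mono (sub_OSum β) a0 N).trans (hno _ (OSum_class β) (OSum_sum β) (Or.inl (OSum_sub hC h)) N))
    · exact Or.inr (Or.inl ((Wt_mono (sub_OSum (prev β)) a0 N).trans
        (hno _ (OSum_class _) (OSum_sum _) (Or.inr (OSum_sub hC.crev h)) N)))
  · intro m
    have e1 := G1_count a0 b0 hN m
    have e2 : (pcount (crev (G1 a N)) m : ℝ) ≤ 2 ^ (EN N).card * b ^ m := by rwa [pcount_crev]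
    have e3 : pcount G m ≤ pcount (G1 a N) m + pcount (crev (G1 a N)) m + (if flag then pcount Jc m else 0) := by
      have : (if flag then pcount Jc m else 0) = (if flag then PS Jc m else ∅).card := by
        split_ifs <;> simp [card_PS]
      rw [this, ← card_PS, ← card_PS, ← card_PS]
      refine (Finset.card_le_card ?_).trans ((Finset.card_union_le _ _).trans (Nat.add_le_add_right (Finset.card_union_le _ _) _))
      intro π hπ
      obtain ⟨h1 | h1 | ⟨h1, h3⟩, h2⟩ := mem_PS.1 hπ
      · exact Finset.mem_union_left _ (Finset.mem_union_left _ (mem_PS.2 ⟨h1, h2⟩))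
      · exact Finset.mem_union_left _ (Finset.mem_union_right _ (mem_PS.2 ⟨h1, h2⟩))
      · refine Finset.mem_union_right _ ?_
        rw [if_pos h1]; exact mem_PS.2 ⟨h3, h2⟩
    have e4 : ((if flag then pcount Jc m else 0 : ℕ) : ℝ) ≤ K1 * b ^ m := by
      split_ifs with h
      · exact hJ h m
      · rw [Nat.cast_zero]; positivity
    have e5 : (pcount G m : ℝ) ≤ pcount (G1 a N) m + pcount (crev (G1 a N)) m + ((if flag then pcount Jc m else 0 : ℕ) : ℝ) := by
      exact_mod_cast e3
    rw [add_mul, add_mul]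
    linarith


/-- The point. -/
def pt : Permu := ⟨1, 1⟩

theorem inf_pt {C : Set Permu} (h : ∀ n, pcount C n ≠ 0) : InfSum C pt ∨ InfSum (crev C) pt := by
  by_contra hcon
  rw [not_or, InfSum, InfSum, not_forall, not_forall] at hcon
  obtain ⟨⟨m1, h1⟩, ⟨m2, h2⟩⟩ := hcon
  obtain ⟨M, hM⟩ := ramsey (κ := Prop) (m1 + m2 + 1)
  have hne : (PS C M).Nonempty := by
    rw [← Finset.card_ne_zero, card_PS]; exact h M
  obtain ⟨⟨n, π⟩, hp⟩ := hne
  obtain ⟨hπ, hn⟩ := mem_PS.1 hp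
  obtain rfl : n = M := hn
  obtain ⟨f, k, hf, hk⟩ := hM fun i j => ev ⟨n, π⟩ i < ev ⟨n, π⟩ j
  have hf0 := hf 0 (by omega)
  have hE : ∀ (ρ : Permu) (Q : Fin pt.1 → Fin ρ.1), Emb pt ρ Q := fun ρ Q a b => by
    obtain rfl : a = b := Subsingleton.elim (α := Fin 1) a b
    simp
  by_cases hk' : k
  · refine h1 ⟨⟨n, π⟩, hπ, fun i _ => if h : f i < n then ⟨f i, h⟩ else ⟨f 0, hf0⟩, fun i hi => ⟨hE _ _, fun j hj hij a b => ?_⟩⟩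
    have fi := hf i (by omega)
    have fj := hf j (by omega)
    obtain ⟨k1, k2⟩ := hk i j hij (by omega)
    have k3 : ev ⟨n, π⟩ (f i) < ev ⟨n, π⟩ (f j) := by rw [k2]; exact hk'
    simp only [ev, fi, fj, dif_pos, Fin.lt_def] at k3 ⊢
    exact ⟨k1, k3⟩
  · obtain ⟨F, hF⟩ : ∃ F : ℕ → Fin n, ∀ i (h : f i < n), F i = ⟨f i, h⟩ :=
      ⟨fun i => if h : f i < n then ⟨f i, h⟩ else ⟨f 0, hf0⟩, fun i h => dif_pos h⟩
    refine h2 ⟨prev ⟨n, π⟩, ?_, fun i _ => Fin.rev (F (m1 + m2 - i)), fun i hi => ⟨hE _ _, fun j hj hij a b => ?_⟩⟩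
    · show prev (prev _) ∈ C
      rw [prev_prev]; exact hπ
    have fi := hf (m1 + m2 - i) (by omega)
    have fj := hf (m1 + m2 - j) (by omega)
    obtain ⟨k1, k2⟩ := hk (m1 + m2 - j) (m1 + m2 - i) (by omega) (by omega)
    have k3 : ¬ ev ⟨n, π⟩ (f (m1 + m2 - j)) < ev ⟨n, π⟩ (f (m1 + m2 - i)) := by rw [k2]; exact hk'
    have k4 : ev ⟨n, π⟩ (f (m1 + m2 - j)) ≠ ev ⟨n, π⟩ (f (m1 + m2 - i)) := fun e => by
      have := ev_inj _ e; omega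
    have k5 : ev ⟨n, π⟩ (f (m1 + m2 - i)) < ev ⟨n, π⟩ (f (m1 + m2 - j)) := by omega
    simp only [ev, fi, fj, dif_pos] at k5
    have q : ∀ v : Fin n, (prev ⟨n, π⟩).2 (Fin.rev v) = π v := fun v => by
      show π (Fin.rev (Fin.rev v)) = π v
      rw [Fin.rev_rev]
    refine ⟨?_, ?_⟩
    · show (F (m1 + m2 - i)).rev < (F (m1 + m2 - j)).rev
      rw [Fin.rev_lt_rev, hF _ fi, hF _ fj]; exact k1
    · erw [q, q]; rw [hF _ fi, hF _ fj]; exact k5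

/-- Good rates. -/
def PG (C : Set Permu) : Set ℝ := {g | 1 ≤ g ∧ ∃ D, IsPermClass D ∧ SumClosed D ∧ (D ⊆ C ∨ D ⊆ crev C) ∧ ∃ N, 1 ≤ Wt D g N}

theorem one_PG {C : Set Permu} (hC : IsPermClass C) (h : ∀ n, pcount C n ≠ 0) : (1 : ℝ) ∈ PG C := by
  refine ⟨le_rfl, OSum pt, OSum_class _, OSum_sum _, ?_, 1, ?_⟩
  · exact (inf_pt h).imp (OSum_sub hC) (OSum_sub hC.crev)
  · rw [Wt, Finset.Icc_self, Finset.sum_singleton, pow_one, div_one]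
    have : pt ∈ PS (OSum pt ∩ {π | SI π}) 1 := mem_PS.2 ⟨⟨sub_OSum pt (PLe.refl pt), by
      refine ⟨Nat.one_pos, fun m h1 h2 => ?_⟩
      change m < 1 at h2
      omega⟩, rfl⟩
    have := Finset.card_pos.2 ⟨_, this⟩
    rw [card_PS] at this
    rw [sic]
    exact_mod_cast this

theorem pc_le {C D : Set Permu} (h : D ⊆ C ∨ D ⊆ crev C) (n : ℕ) : pcount D n ≤ pcount C n := by
  rcases h with h | h
  · exact pcount_mono h n
  · rw [← pcount_crev C n]; exact pcount_mono h n

theorem PG_le {C : Set Permu} {x : ℝ} (hx : 0 < x) (hT : Thin C x) {g : ℝ} (hg : g ∈ PG C) : g ≤ x := by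
  obtain ⟨h1, D, hD, hS, hsub, N, hN⟩ := hg
  by_contra hcon
  push Not at hcon
  obtain ⟨n, hn, hn2⟩ := ((exp_contra hx hcon 0 (g ^ N)).and hT).exists
  have h3 := Wt_lower hD hS h1 hN n
  have h4 : (pcount D n : ℝ) ≤ pcount C n := by exact_mod_cast pc_le hsub n
  have h5 : g ^ N * pcount D n ≤ g ^ N * x ^ n := mul_le_mul_of_nonneg_left (h4.trans hn2) (by positivity)
  rw [pow_zero, mul_one] at hn
  linarith

theorem att {C : Set Permu} {u : ℕ → ℝ} {g : ℝ} (hu : Tendsto u atTop (nhds g)) (hP : ∀ i, u i ∈ PG C)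
    (hg : g ≤ 2.3053) : ∃ D, IsPermClass D ∧ SumClosed D ∧ (∀ n, pcount D n ≤ pcount C n) ∧
    ∀ c, 0 < c → c < g → ∃ (K : ℝ) (d : ℕ), 0 < K ∧ ∀ n : ℕ, c ^ n ≤ K * (n + 1) ^ d * (pcount D n : ℝ) := by
  choose hu1 D hD hS hsub N hN using hP
  have hle : (hyperfilter ℕ : Filter ℕ) ≤ atTop := by
    rw [← Nat.cofinite_eq_atTop]; exact hyperfilter_le_cofinite
  let E : Set Permu := {π | ∀ᶠ i in (hyperfilter ℕ : Filter ℕ), π ∈ D i}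
  have hEc : IsPermClass E := fun σ π h hπ => by
    filter_upwards [hπ] with i hi using hD i σ π h hi
  have hEs : SumClosed E := fun σ π h hπ => by
    filter_upwards [h, hπ] with i h1 h2 using hS i σ π h1 h2
  have hpt : pt ∈ E := by
    refine Eventually.of_forall fun i => ?_
    have h1 := Wt_lower (hD i) (hS i) (hu1 i) (hN i) 1
    have h2 : pcount (D i) 1 ≠ 0 := fun h0 => by
      rw [h0, pow_one] at h1
      have := hu1 i
      simp at h1
      linarith
    rw [← card_PS, Finset.card_ne_zero] at h2
    obtain ⟨⟨n, p⟩, hp⟩ := h2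
    obtain ⟨hp, hn⟩ := mem_PS.1 hp
    obtain rfl : n = 1 := hn
    rwa [Subsingleton.elim p 1] at hp
  refine ⟨E, hEc, hEs, pc_le ?_, fun c hc0 hcg => ?_⟩
  · have : ∀ᶠ i in (hyperfilter ℕ : Filter ℕ), D i ⊆ C ∨ D i ⊆ crev C := Eventually.of_forall hsub
    rcases Ultrafilter.eventually_or.1 this with h | h
    · left; intro π hπ
      obtain ⟨i, h1, h2⟩ := (h.and hπ).exists
      exact h1 h2
    · right; intro π hπ
      obtain ⟨i, h1, h2⟩ := (h.and hπ).exists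
      exact h1 h2
  · rcases lt_or_ge c 1 with h1 | h1
    · refine ⟨1, 0, one_pos, fun n => ?_⟩
      have h2 : (1 : ℝ) ≤ pcount E n := by exact_mod_cast SumClosed.exists_len hEc hEs hpt Nat.one_pos n
      rw [pow_zero, one_mul, one_mul]
      exact (pow_le_one₀ hc0.le h1.le).trans h2
    · obtain ⟨c', h2, h3⟩ := exists_between hcg
      obtain ⟨N0, -, hN0⟩ := tl_lem h1 h2 (by linarith)
      have e1 : ∀ᶠ i in (hyperfilter ℕ : Filter ℕ), c' < u i := hle (hu.eventually (lt_mem_nhds h3))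
      have e2 : ∀ᶠ i in (hyperfilter ℕ : Filter ℕ), ∀ σ ∈ EN N0, (σ ∈ E ↔ σ ∈ D i) := by
        rw [Filter.eventually_all_finset]
        intro σ _
        by_cases hσ : σ ∈ E
        · have hσ' : ∀ᶠ i in (hyperfilter ℕ : Filter ℕ), σ ∈ D i := hσ
          filter_upwards [hσ'] with i hi
          exact ⟨fun _ => hi, fun _ => hσ⟩
        · have hσ' : ∀ᶠ i in (hyperfilter ℕ : Filter ℕ), ¬ σ ∈ D i := Ultrafilter.eventually_not.2 hσ
          filter_upwards [hσ'] with i hi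
          exact ⟨fun h => absurd h hσ, fun h => absurd h hi⟩
      obtain ⟨i, k1, k2⟩ := (e1.and e2).exists
      have k3 : 1 ≤ Wt E c N0 := by
        rw [Wt_cong (C := E) (D := D i) fun σ h _ => k2 σ (mem_EN.2 h)]
        by_contra hcon
        push Not at hcon
        have := hN0 (D i) (hD i) hcon.le (N i)
        have := Wt_anti (D := D i) (by linarith : 0 < c') k1.le (N i)
        have := hN i
        linarith
      exact ⟨c ^ N0, 0, by positivity, fun n => by
        rw [pow_zero, mul_one]; exact Wt_lower hEc hEs h1 k3 n⟩

/-- Layered permutations. -/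
def Lay : Set Permu := {σ | ∃ f : ℕ → ℕ, ∀ i j, i < j → j < σ.1 → f i ≤ f j ∧ (ev σ i < ev σ j ↔ f i < f j)}

theorem Lay_class : IsPermClass Lay := by
  rintro ⟨s, σ⟩ ⟨n, π⟩ ⟨q, hq, h⟩ ⟨f, hf⟩
  change Fin s → Fin n at q
  refine ⟨fun i => if h : i < s then f (q ⟨i, h⟩) else 0, fun i j hij hj => ?_⟩
  change j < s at hj
  have hi : i < s := by omega
  have := hf (q ⟨i, hi⟩) (q ⟨j, hj⟩) (hq (by simpa using hij)) (q ⟨j, hj⟩).2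
  have h2 := h ⟨i, hi⟩ ⟨j, hj⟩
  simp only [ev, hi, hj, dif_pos, Fin.is_lt] at this h2 ⊢
  exact ⟨this.1, by rw [← this.2]; exact h2⟩

theorem Lay_sum : SumClosed Lay := by
  rintro σ τ ⟨f, hf⟩ ⟨g, hg⟩
  obtain ⟨m, hm⟩ : ∃ m, ∀ i < σ.1, f i < m :=
    ⟨(Finset.range σ.1).sup f + 1, fun i hi => Nat.lt_succ_of_le (Finset.le_sup (Finset.mem_range.2 hi))⟩
  refine ⟨fun i => if i < σ.1 then f i else m + g (i - σ.1), fun i j hij hj => ?_⟩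
  change j < σ.1 + τ.1 at hj
  beta_reduce
  rcases lt_or_ge j σ.1 with h | h
  · have hi : i < σ.1 := by omega
    rw [if_pos hi, if_pos h, ev_psum_lt _ _ hi, ev_psum_lt _ _ h]
    exact hf i j hij h
  · obtain ⟨j, rfl⟩ : ∃ k, j = σ.1 + k := ⟨j - σ.1, by omega⟩
    rw [if_neg (by omega : ¬ σ.1 + j < σ.1), ev_psum_ge, Nat.add_sub_cancel_left]
    rcases lt_or_ge i σ.1 with hi | hi
    · rw [if_pos hi, ev_psum_lt _ _ hi]
      have := hm i hi
      have := ev_lt hi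
      omega
    · obtain ⟨i, rfl⟩ : ∃ k, i = σ.1 + k := ⟨i - σ.1, by omega⟩
      rw [if_neg (by omega : ¬ σ.1 + i < σ.1), ev_psum_ge, Nat.add_sub_cancel_left]
      have := hg i j (by omega) (by omega)
      omega

theorem Lay_anti {σ : Permu} (h : σ ∈ Lay) (hs : SI σ) : ∀ i j, i < j → j < σ.1 → ev σ j < ev σ i := by
  classical
  obtain ⟨f, hf⟩ := h
  have key : ∀ j < σ.1, f j = f 0 := by
    by_contra hcon
    push Not at hcon
    have hm := Nat.find_spec hcon
    have hmin := fun k => Nat.find_min hcon (m := k)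
    set m := Nat.find hcon
    clear_value m
    have m0 : 0 < m := Nat.pos_of_ne_zero fun h => hm.2 (by rw [h])
    obtain ⟨i, hi, hmi⟩ := hs.2 m m0 hm.1
    have fi : f i = f 0 := by
      by_contra h
      exact hmin i hi ⟨by omega, h⟩
    have h0m := (hf 0 m m0 hm.1).1
    have hsub : (Finset.Ico m σ.1).image (ev σ) ⊆ Finset.Ioo (ev σ i) σ.1 := by
      intro v hv
      obtain ⟨j, hj, rfl⟩ := Finset.mem_image.1 hv
      rw [Finset.mem_Ico] at hj
      refine Finset.mem_Ioo.2 ⟨((hf i j (by omega) hj.2).2).2 ?_, ev_lt hj.2⟩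
      rcases hj.1.eq_or_lt with e | e
      · rw [← e]; omega
      · have := (hf m j e hj.2).1; omega
    have := Finset.card_le_card hsub
    rw [Finset.card_image_of_injective _ (ev_inj σ), Nat.card_Ico, Nat.card_Ioo] at this
    have := hm.1
    omega
  intro i j hij hj
  have h1 := key i (by omega)
  have h2 := key j hj
  have h3 := (hf i j hij hj).2
  have : ev σ i ≠ ev σ j := fun e => by have := ev_inj _ e; omega
  omega

theorem Lay_sic_le (k : ℕ) : sic Lay k ≤ 1 := by
  rw [sic, pcount_eq, Finset.card_le_one]
  intro σ hσ τ hτ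
  have hs : ∀ σ ∈ PC (Lay ∩ {π | SI π}) k, StrictMono fun i => OrderDual.toDual (σ i) := by
    intro σ hσ i j hij
    have hh := mem_PC.1 hσ
    have := Lay_anti hh.1 hh.2 i j hij j.2
    rw [ev_fin ⟨k, σ⟩ i, ev_fin ⟨k, σ⟩ j] at this
    exact this
  have := (StrictMono.range_inj (hs σ hσ) (hs τ hτ)).1 (by
    have h : ∀ σ : Equiv.Perm (Fin k), Set.range (fun i => OrderDual.toDual (σ i)) = Set.univ := fun σ =>
      (OrderDual.toDual.surjective.comp σ.surjective).range_eq
    rw [h, h])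
  exact Equiv.ext fun i => OrderDual.toDual.injective (congrFun this i)

theorem Lay_sic_ge (k : ℕ) (hk : 1 ≤ k) : 1 ≤ sic Lay k := by
  rw [sic, pcount_eq, Nat.succ_le_iff, Finset.card_pos]
  have he : ∀ i < k, ev ⟨k, Fin.revPerm⟩ i = k - 1 - i := fun i hi => by
    simp [ev, hi, Fin.val_rev]; omega
  refine ⟨Fin.revPerm, mem_PC.2 ⟨⟨fun _ => 0, fun i j hij hj => ?_⟩, hk, fun m h1 h2 => ⟨0, h1, ?_⟩⟩⟩
  · change j < k at hj
    beta_reduce; rw [he i (by omega), he j hj]; omega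
  · change m < k at h2
    rw [he 0 (by omega)]; omega

theorem Lay_up (n : ℕ) : (pcount Lay n : ℝ) ≤ 2 ^ n := by
  refine Wt_upper Lay_class two_pos (fun N => ?_) n
  have h : Wt Lay 2 N ≤ ∑ k ∈ Finset.Icc 1 N, (1 : ℝ) / 2 ^ k := by
    refine Finset.sum_le_sum fun k _ => ?_
    have : (sic Lay k : ℝ) ≤ 1 := by exact_mod_cast Lay_sic_le k
    gcongr
  have h2 : ∑ k ∈ Finset.Icc 1 N, (1 : ℝ) / 2 ^ k = 1 - 1 / 2 ^ N := by
    clear h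
    induction N with
    | zero => simp
    | succ N ih => rw [Finset.sum_Icc_succ_top (by omega), ih, pow_succ]; field_simp; ring
  have : (0 : ℝ) < 1 / 2 ^ N := by positivity
  linarith

theorem Lay_lo (n : ℕ) : 2 ^ n ≤ 2 * pcount Lay n := by
  have h0 : 1 ≤ pcount Lay 0 := by
    rw [← card_PS, Nat.succ_le_iff, Finset.card_pos]
    exact ⟨⟨0, 1⟩, mem_PS.2 ⟨⟨fun _ => 0, fun i j _ hj => absurd hj (Nat.not_lt_zero _)⟩, rfl⟩⟩
  have hr : ∀ n, ∑ j ∈ Finset.range n, pcount Lay j ≤ pcount Lay n := fun n => by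
    refine le_trans ?_ (rec_lower Lay_sum (le_refl n))
    have : ∑ j ∈ Finset.range n, pcount Lay j = ∑ k ∈ Finset.Icc 1 n, pcount Lay (n - k) := by
      refine Finset.sum_nbij' (fun j => n - j) (fun j => n - j) ?_ ?_ ?_ ?_ ?_ <;> intro j hj <;>
        simp only [Finset.mem_range, Finset.mem_Icc] at hj ⊢ <;> try omega
      congr 1; omega
    rw [this]
    refine Finset.sum_le_sum fun k hk => ?_
    have := Lay_sic_ge k (Finset.mem_Icc.1 hk).1
    exact Nat.le_mul_of_pos_left _ this
  have hS : ∀ n, 2 ^ (n + 1) ≤ 2 * ∑ j ∈ Finset.range (n + 1), pcount Lay j := fun n => by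
    induction n with
    | zero => simp; omega
    | succ n ih =>
      rw [Finset.sum_range_succ, pow_succ]
      have := hr (n + 1)
      omega
  rcases n with _ | n
  · simp; omega
  · have := hS n
    have := hr (n + 1)
    omega

theorem xi_lt {ξ : ℝ} (hr : ξ ^ 5 - 2 * ξ ^ 4 - ξ ^ 2 - ξ - 1 = 0) : ξ < 2.3053 := by
  by_contra hcon
  push Not at hcon
  have h1 : 0 ≤ ξ ^ 2 * (ξ ^ 2 * (ξ - 2) - 2.3053 ^ 2 * 0.3053) :=
    mul_nonneg (by positivity) (by nlinarith [mul_nonneg (sq_nonneg ξ) (by linarith : (0:ℝ) ≤ ξ - 2.3053)])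
  nlinarith

theorem main_pos {x : ℝ} (hx : 0 < x) (hx2 : x < 2.3053) {C : Set Permu} (hC : IsPermClass C) (hT : Thin C x)
    (hne : ∀ n, pcount C n ≠ 0) : ∃ L : ℝ, Tendsto (fun n : ℕ => (pcount C n : ℝ) ^ ((n : ℝ)⁻¹)) atTop (nhds L) ∧
    ∃ D, IsPermClass D ∧ SumClosed D ∧ Tendsto (fun n : ℕ => (pcount D n : ℝ) ^ ((n : ℝ)⁻¹)) atTop (nhds L) := by
  have hbd : BddAbove (PG C) := ⟨x, fun g hg => PG_le hx hT hg⟩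
  have h1 := one_PG hC hne
  obtain ⟨u, -, hu, hP⟩ := exists_seq_tendsto_sSup ⟨1, h1⟩ hbd
  have hg1 : 1 ≤ sSup (PG C) := le_csSup hbd h1
  have hgx : sSup (PG C) ≤ x := csSup_le ⟨1, h1⟩ fun g hg => PG_le hx hT hg
  have hgt : ∀ a, sSup (PG C) < a → a ∉ PG C := fun a h h' => absurd (le_csSup hbd h') (not_le.2 h)
  set g0 := sSup (PG C)
  clear_value g0
  have hn : ∀ D : Set Permu, ∀ n, (0 : ℝ) ≤ pcount D n := fun D n => Nat.cast_nonneg _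
  have hup : ∀ g, g0 ≤ g → ((LinSep 2 C ∨ LinSep 2 (cinv C)) → 2 ≤ g) → ∀ b, g < b → b < 2.3053 →
      ∃ (K : ℝ) (d : ℕ), 0 ≤ K ∧ ∀ n, (pcount C n : ℝ) ≤ K * (n + 1) ^ d * b ^ n := by
    intro g h2 h3 b hb hb2
    obtain ⟨a, ha, hab⟩ := exists_between hb
    refine upper_lem hC hx hx2 hT (a := a) (by linarith) hab (by linarith) (LinSep 2 C ∨ LinSep 2 (cinv C))
      (fun h => (h3 h).trans_lt hb) not_or.1 ?_
    intro D k1 k2 k3 N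
    by_contra hcon
    push Not at hcon
    exact hgt a (by linarith) ⟨by linarith, D, k1, k2, k3, N, hcon.le⟩
  by_cases hfl : (LinSep 2 C ∨ LinSep 2 (cinv C)) ∧ g0 < 2
  · refine ⟨2, lim_lem (hn C) two_pos.le (by norm_num) (hup 2 hfl.2.le fun _ => le_rfl) ?_, Lay, Lay_class, Lay_sum,
      lim_lem (hn Lay) (B := 3) two_pos.le (by norm_num) ?_ ?_⟩
    · intro c hc hc2
      refine ⟨1, 2, one_pos, fun n => ?_⟩
      have h3 : 2 ^ n ≤ (n + 1) ^ 2 * pcount C n := by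
        rcases hfl.1 with h | h
        · exact h.count hC n
        · have := h.count hC.cinv n
          rwa [pcount_cinv] at this
      have h4 : (2 : ℝ) ^ n ≤ (n + 1) ^ 2 * pcount C n := by exact_mod_cast h3
      rw [one_mul]
      exact (pow_le_pow_left₀ hc.le hc2.le n).trans h4
    · intro b hb _
      refine ⟨1, 0, zero_le_one, fun n => ?_⟩
      rw [pow_zero, one_mul, one_mul]
      exact (Lay_up n).trans (pow_le_pow_left₀ two_pos.le hb.le n)
    · intro c hc hc2
      refine ⟨2, 0, two_pos, fun n => ?_⟩
      have h4 : (2 : ℝ) ^ n ≤ 2 * pcount Lay n := by exact_mod_cast Lay_lo n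
      rw [pow_zero, mul_one]
      exact (pow_le_pow_left₀ hc.le hc2.le n).trans h4
  · obtain ⟨D, hD, hS, hle, hlo⟩ := att hu hP (by linarith)
    have hle' : ∀ n, (pcount D n : ℝ) ≤ pcount C n := fun n => by exact_mod_cast hle n
    have hU := hup g0 le_rfl fun h => by
      by_contra h'
      exact hfl ⟨h, not_le.1 h'⟩
    refine ⟨g0, lim_lem (hn C) (by linarith) (by linarith) hU ?_, D, hD, hS, lim_lem (hn D) (B := 2.3053) (by linarith) (by linarith) ?_ hlo⟩
    · intro c hc hc2
      obtain ⟨K, d, hK, h⟩ := hlo c hc hc2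
      refine ⟨K, d, hK, fun n => (h n).trans (mul_le_mul_of_nonneg_left (hle' n) (by positivity))⟩
    · intro b hb hb2
      obtain ⟨K, d, hK, h⟩ := hU b hb hb2
      exact ⟨K, d, hK, fun n => (hle' n).trans (h n)⟩

theorem main_deg {C : Set Permu} (hC : IsPermClass C) {n : ℕ} (h : pcount C n = 0) :
    Tendsto (fun n : ℕ => (pcount C n : ℝ) ^ ((n : ℝ)⁻¹)) atTop (nhds 0) := by
  refine tendsto_const_nhds.congr' ?_
  filter_upwards [eventually_ge_atTop (n + 1)] with m hm
  have : pcount C m = 0 := by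
    by_contra h'
    rw [← card_PS, ← Ne, Finset.card_ne_zero] at h'
    obtain ⟨⟨k, π⟩, hp⟩ := h'
    obtain ⟨hπ, hk⟩ := mem_PS.1 hp
    obtain rfl : k = m := hk
    rw [← card_PS, Finset.card_eq_zero, Finset.eq_empty_iff_forall_notMem] at h
    obtain ⟨S, -, hS⟩ := Finset.exists_subset_card_eq (s := (Finset.univ : Finset (Fin k))) (n := n) (by simp; omega)
    exact h (pat π S) (mem_PS.2 ⟨hC _ _ (pat_ple π S) hπ, by rw [pat_card, hS]⟩)
  rw [this, Nat.cast_zero, Real.zero_rpow]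
  have : (m : ℝ) ≠ 0 := by exact_mod_cast (by omega : m ≠ 0)
  exact inv_ne_zero this

theorem thin_of {C : Set Permu} {x : ℝ} (hx : 0 < x) (h : ugr C < (x : EReal)) : Thin C x := by
  rw [ugr] at h
  filter_upwards [eventually_lt_of_limsup_lt h, eventually_ge_atTop 1] with n hn h1
  have h2 : (pcount C n : ℝ) ^ ((n : ℝ)⁻¹) < x := EReal.coe_lt_coe_iff.1 hn
  calc (pcount C n : ℝ) = ((pcount C n : ℝ) ^ ((n : ℝ)⁻¹)) ^ n :=
        (Real.rpow_inv_natCast_pow (Nat.cast_nonneg _) (by omega)).symm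
    _ ≤ x ^ n := pow_le_pow_left₀ (Real.rpow_nonneg (Nat.cast_nonneg _) _) h2.le n

/-- If `C` is a permutation class with upper growth rate below `ξ`,
then the growth rate of `C` exists and is the growth rate of a sum closed class. -/
theorem growth_rate_below_xi_exists_and_is_sum_closed
    (ξ : ℝ) (hpos : 0 < ξ) (hroot : ξ ^ 5 - 2 * ξ ^ 4 - ξ ^ 2 - ξ - 1 = 0)
    (C : Set Permu) (hC : IsPermClass C) (h : ugr C < (ξ : EReal)) :
    ∃ L : ℝ,
      Tendsto (fun n : ℕ => (pcount C n : ℝ) ^ ((n : ℝ)⁻¹)) atTop (nhds L) ∧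
      ∃ D : Set Permu, IsPermClass D ∧ SumClosed D ∧
        Tendsto (fun n : ℕ => (pcount D n : ℝ) ^ ((n : ℝ)⁻¹)) atTop (nhds L) := by
  by_cases hne : ∀ n, pcount C n ≠ 0
  · exact main_pos hpos (xi_lt hroot) hC (thin_of hpos h) hne
  · push Not at hne
    obtain ⟨n, hn⟩ := hne
    have h0 : IsPermClass (∅ : Set Permu) := fun _ _ _ h => h
    exact ⟨0, main_deg hC hn, ∅, h0, fun _ _ h _ => h, main_deg h0 (n := 0) (by simp [pcount])⟩
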